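/- Let n > 0 be a natural number and let κ be a C^(n)-weakly shrewd cardinal that is not C^(n)-strongly unfoldable. If δ is the least ordinal ε ≥ κ with the property that the set {ε} is definable by a Σ_{n+1}-formula with parameters in H(κ), then: (1) δ is a cardinal greater than κ whose cofinality is either less than κ or equal to δ; and (2) δ is a subtle cardinal in HOD. -/

import Mathlib

namespace Paper

/-- First-order formulas in the language of set theory (one binary relation, membership),
using de Bruijn variables; `all` binds the last variable. -/
inductive SetFormula : ℕ → Type
  | mem {n : ℕ} (i j : Fin n) : SetFormula n
  | eq {n : ℕ} (i j : Fin n) : SetFormula n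
  | fal {n : ℕ} : SetFormula n
  | imp {n : ℕ} (φ ψ : SetFormula n) : SetFormula n
  | all {n : ℕ} (φ : SetFormula (n + 1)) : SetFormula n

namespace SetFormula

/-- Negation. -/
def not {n : ℕ} (φ : SetFormula n) : SetFormula n := φ.imp .fal

/-- Conjunction. -/
def and {n : ℕ} (φ ψ : SetFormula n) : SetFormula n := (φ.imp ψ.not).not

/-- Existential quantification (over the last variable). -/
def ex {n : ℕ} (φ : SetFormula (n + 1)) : SetFormula n := (SetFormula.all φ.not).not

end SetFormula

/-- Satisfaction of a set-theoretic formula in a structure `(M, E)`, where `E` interprets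
the membership relation. -/
def Realize {M : Type*} (E : M → M → Prop) : ∀ {n : ℕ}, SetFormula n → (Fin n → M) → Prop
  | _, .mem i j, v => E (v i) (v j)
  | _, .eq i j, v => v i = v j
  | _, .fal, _ => False
  | _, .imp φ ψ, v => Realize E φ v → Realize E ψ v
  | _, .all φ, v => ∀ a, Realize E φ (Fin.snoc v a)

/-- Satisfaction of a formula relativized to the subclass `S` of `M`; all quantifiers
range over `S`, and the assignment is required to take values in `S`. -/
def RealizeIn {M : Type*} (E : M → M → Prop) (S : M → Prop) {n : ℕ}
    (φ : SetFormula n) (v : Fin n → M) : Prop :=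
  ∃ h : ∀ i, S (v i),
    Realize (fun a b : {x : M // S x} => E a.1 b.1) φ fun i => ⟨v i, h i⟩

/-- `Δ₀`-formulas: formulas all of whose quantifiers are bounded. -/
inductive IsDelta0 : ∀ {n : ℕ}, SetFormula n → Prop
  | mem {n : ℕ} (i j : Fin n) : IsDelta0 (.mem i j)
  | eq {n : ℕ} (i j : Fin n) : IsDelta0 (.eq i j)
  | fal {n : ℕ} : IsDelta0 (n := n) .fal
  | imp {n : ℕ} {φ ψ : SetFormula n} : IsDelta0 φ → IsDelta0 ψ → IsDelta0 (φ.imp ψ)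
  | ball {n : ℕ} (j : Fin n) {φ : SetFormula (n + 1)} :
      IsDelta0 φ → IsDelta0 (.all ((SetFormula.mem (Fin.last n) j.castSucc).imp φ))
  | bex {n : ℕ} (j : Fin n) {φ : SetFormula (n + 1)} :
      IsDelta0 φ → IsDelta0 (SetFormula.ex ((SetFormula.mem (Fin.last n) j.castSucc).and φ))

mutual
  /-- `Σₙ`-formulas of the Lévy hierarchy. -/
  inductive IsSigma : ℕ → ∀ {n : ℕ}, SetFormula n → Prop
    | ofDelta0 {k n : ℕ} {φ : SetFormula n} : IsDelta0 φ → IsSigma k φ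
    | ofPi {k n : ℕ} {φ : SetFormula n} : IsPi k φ → IsSigma (k + 1) φ
    | ex {k n : ℕ} {φ : SetFormula (n + 1)} : IsSigma (k + 1) φ → IsSigma (k + 1) φ.ex
  /-- `Πₙ`-formulas of the Lévy hierarchy. -/
  inductive IsPi : ℕ → ∀ {n : ℕ}, SetFormula n → Prop
    | ofDelta0 {k n : ℕ} {φ : SetFormula n} : IsDelta0 φ → IsPi k φ
    | ofSigma {k n : ℕ} {φ : SetFormula n} : IsSigma k φ → IsPi (k + 1) φ
    | all {k n : ℕ} {φ : SetFormula (n + 1)} : IsPi (k + 1) φ → IsPi (k + 1) φ.all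
end

end Paper
namespace Paper

section Generic

variable {M : Type*} (E : M → M → Prop)

/-- `x` is a transitive set (relative to the membership relation `E`). -/
def TransE (x : M) : Prop := ∀ y, E y x → ∀ z, E z y → E z x

/-- `x` is an ordinal: a transitive set all of whose elements are transitive. -/
def OrdE (x : M) : Prop := TransE E x ∧ ∀ y, E y x → TransE E y

/-- `a ⊆ b`. -/
def SubE (a b : M) : Prop := ∀ z, E z a → E z b

/-- `a ≤ b` for ordinals. -/
def LeE (a b : M) : Prop := E a b ∨ a = b

/-- `x` is the empty set. -/
def EmptyE (x : M) : Prop := ∀ z, ¬ E z x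

/-- `s = y ∪ {y}`. -/
def SuccSpecE (s y : M) : Prop := ∀ z, E z s ↔ (E z y ∨ z = y)

/-- `l` is a (nonzero) limit ordinal. -/
def LimitE (l : M) : Prop := OrdE E l ∧ (∃ w, E w l) ∧ ∀ α, E α l → ∃ β, E β l ∧ E α β

/-- `w` is the first infinite ordinal `ω`. -/
def OmegaSpecE (w : M) : Prop := LimitE E w ∧ ∀ x, E x w → ¬ LimitE E x

/-- `x` is an infinite ordinal, i.e. an ordinal with `ω ≤ x`. -/
def InfiniteOrdE (x : M) : Prop := OrdE E x ∧ ∃ w, OmegaSpecE E w ∧ LeE E w x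

/-- `p = {a, b}`. -/
def UPairE (p a b : M) : Prop := ∀ z, E z p ↔ (z = a ∨ z = b)

/-- `p` is the Kuratowski ordered pair `⟨a, b⟩`. -/
def OPairE (p a b : M) : Prop :=
  ∃ s t, UPairE E s a a ∧ UPairE E t a b ∧ UPairE E p s t

/-- The ordered pair `⟨x, y⟩` is an element of `f`. -/
def PairMemE (f x y : M) : Prop := ∃ p, E p f ∧ OPairE E p x y

/-- `f` is (the graph of) a function from `a` to `b`. -/
def IsFuncE (f a b : M) : Prop :=
  (∀ p, E p f → ∃ x y, E x a ∧ E y b ∧ OPairE E p x y) ∧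
    ∀ x, E x a → (∃ y, PairMemE E f x y) ∧
      ∀ y y', PairMemE E f x y → PairMemE E f x y' → y = y'

/-- `f` is a surjection from `a` onto `b`. -/
def SurjE (f a b : M) : Prop :=
  IsFuncE E f a b ∧ ∀ y, E y b → ∃ x, E x a ∧ PairMemE E f x y

/-- `f` is an injection from `a` into `b`. -/
def InjE (f a b : M) : Prop :=
  IsFuncE E f a b ∧ ∀ x x' y, E x a → E x' a →
    PairMemE E f x y → PairMemE E f x' y → x = x'

/-- `f` is a bijection between `a` and `b`. -/
def BijE (f a b : M) : Prop := SurjE E f a b ∧ InjE E f a b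

/-- `κ` is a cardinal: an ordinal not in bijection with any of its elements. -/
def CardE (κ : M) : Prop := OrdE E κ ∧ ∀ α, E α κ → ¬ ∃ f, BijE E f α κ

/-- `κ` is an infinite cardinal. -/
def InfCardE (κ : M) : Prop := CardE E κ ∧ InfiniteOrdE E κ

/-- `b = a ∩ c`. -/
def InterSpecE (b a c : M) : Prop := ∀ z, E z b ↔ (E z a ∧ E z c)

/-- `c` is unbounded in the ordinal `κ`. -/
def UnboundedInE (c κ : M) : Prop := ∀ α, E α κ → ∃ β, E β c ∧ E α β

/-- `c` is closed in the ordinal `κ`: it contains each of its limit points below `κ`. -/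
def ClosedInE (c κ : M) : Prop :=
  ∀ l, E l κ → (∃ w, E w l) → (∀ α, E α l → ∃ β, E β c ∧ E α β ∧ E β l) → E l c

/-- `c` is a closed unbounded subset of the ordinal `κ`. -/
def ClubInE (c κ : M) : Prop := SubE E c κ ∧ UnboundedInE E c κ ∧ ClosedInE E c κ

/-- `f` is (the graph of) a sequence `⟨A_α | α < κ⟩` with `A_α ⊆ α` for all `α < κ`. -/
def SeqSpecE (f κ : M) : Prop :=
  ∀ α, E α κ → (∃ A, PairMemE E f α A ∧ SubE E A α) ∧
    ∀ A A', PairMemE E f α A → PairMemE E f α A' → A = A'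

/-- `κ` is a subtle cardinal. -/
def SubtleE (κ : M) : Prop :=
  InfCardE E κ ∧ ∀ f, SeqSpecE E f κ → ∀ c, ClubInE E c κ →
    ∃ α β, E α c ∧ E β c ∧ E α β ∧
      ∃ A B, PairMemE E f α A ∧ PairMemE E f β B ∧ InterSpecE E A B α

/-- `κ` is a regular ordinal: every function from an element of `κ` to `κ` has
bounded range. -/
def RegularE (κ : M) : Prop :=
  OrdE E κ ∧ ∀ γ f, E γ κ → IsFuncE E f γ κ →
    ∃ β, E β κ ∧ ∀ x y, PairMemE E f x y → E y β

/-- `p = 𝒫(a)`. -/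
def PowSpecE (p a : M) : Prop := ∀ z, E z p ↔ SubE E z a

/-- `κ` is a strong limit cardinal: for every `α < κ`, `2^|α| < κ`. -/
def StrongLimitE (κ : M) : Prop :=
  ∀ α, E α κ → ∀ p, PowSpecE E p α → ∃ β f, E β κ ∧ InjE E f p β

/-- `κ` is a strongly inaccessible cardinal: an uncountable regular strong limit
cardinal. -/
def InaccE (κ : M) : Prop :=
  CardE E κ ∧ (∃ w, OmegaSpecE E w ∧ E w κ) ∧ RegularE E κ ∧ StrongLimitE E κ

/-- `z` belongs to the transitive closure of `x`. -/
def TCMemE (z x : M) : Prop := ∀ t, TransE E t → SubE E x t → E z t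

/-- `x ∈ H(θ)`: the transitive closure of `x` has cardinality less than `θ`. -/
def HMemE (x θ : M) : Prop :=
  ∃ t, TransE E t ∧ SubE E x t ∧ ∃ β f, E β θ ∧ SurjE E f β t

/-- `f` is (the graph of) the cumulative-hierarchy sequence `⟨V_β | β < α⟩`,
determined by the recursion `V_β = {z | ∃ γ < β, z ⊆ V_γ}`. -/
def VHierE (f α : M) : Prop :=
  OrdE E α ∧ ∀ β, E β α →
    (∃ w, PairMemE E f β w ∧
      ∀ z, E z w ↔ ∃ γ, E γ β ∧ ∃ u, PairMemE E f γ u ∧ SubE E z u) ∧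
    ∀ w w', PairMemE E f β w → PairMemE E f β w' → w = w'

/-- `x ∈ V_α`. -/
def VMemE (x α : M) : Prop :=
  OrdE E α ∧ ∃ f, VHierE E f α ∧ ∃ β u, E β α ∧ PairMemE E f β u ∧ SubE E x u

/-- The class `S` is a `Σₙ`-elementary subclass of the class `T`. -/
def SigmaElemPairE (n : ℕ) (S T : M → Prop) : Prop :=
  (∀ x, S x → T x) ∧
    ∀ ⦃k : ℕ⦄ (φ : SetFormula k), IsSigma n φ → ∀ v : Fin k → M, (∀ i, S (v i)) →
      (RealizeIn E S φ v ↔ RealizeIn E T φ v)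

/-- The class `S` is a (fully) elementary subclass of the class `T`. -/
def ElemPairE (S T : M → Prop) : Prop :=
  (∀ x, S x → T x) ∧
    ∀ ⦃k : ℕ⦄ (φ : SetFormula k) (v : Fin k → M), (∀ i, S (v i)) →
      (RealizeIn E S φ v ↔ RealizeIn E T φ v)

/-- `j` is an elementary map from the class `S` into the class `T`. -/
def ElemMapE (S T : M → Prop) (j : M → M) : Prop :=
  (∀ x, S x → T (j x)) ∧
    ∀ ⦃k : ℕ⦄ (φ : SetFormula k) (v : Fin k → M), (∀ i, S (v i)) →
      (RealizeIn E S φ v ↔ RealizeIn E T φ fun i => j (v i))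

/-- `α ∈ C⁽ⁿ⁾`: the ordinal `α` is `Σₙ`-correct, i.e. `V_α` is a `Σₙ`-elementary
submodel of the universe. -/
def CnE (n : ℕ) (α : M) : Prop :=
  OrdE E α ∧ SigmaElemPairE E n (fun x => VMemE E x α) fun _ => True

/-- `κ` is a weakly shrewd cardinal. -/
def WeaklyShrewdE (κ : M) : Prop :=
  CardE E κ ∧ ∀ (φ : SetFormula 2) (θ z : M), CardE E θ → E κ θ → SubE E z κ →
    RealizeIn E (fun x => HMemE E x θ) φ ![z, κ] →
    ∃ κ' θ' z', CardE E κ' ∧ CardE E θ' ∧ E κ' θ' ∧ E κ' κ ∧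
      InterSpecE E z' z κ' ∧ RealizeIn E (fun x => HMemE E x θ') φ ![z', κ']

/-- `κ` is a `C⁽ⁿ⁾`-weakly shrewd cardinal. -/
def CnWeaklyShrewdE (n : ℕ) (κ : M) : Prop :=
  CardE E κ ∧ ∀ (φ : SetFormula 2) (θ z : M), CardE E θ → CnE E n θ → E κ θ →
    SubE E z κ → RealizeIn E (fun x => HMemE E x θ) φ ![z, κ] →
    ∃ κ' θ' z', CardE E κ' ∧ CardE E θ' ∧ CnE E n θ' ∧ E κ' θ' ∧ E κ' κ ∧
      InterSpecE E z' z κ' ∧ RealizeIn E (fun x => HMemE E x θ') φ ![z', κ']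

/-- Axiom of extensionality for `(M, E)`. -/
def AxExtE : Prop := ∀ x y : M, (∀ z, E z x ↔ E z y) → x = y

/-- Axiom of pairing for `(M, E)`. -/
def AxPairE : Prop := ∀ a b : M, ∃ p, UPairE E p a b

/-- Axiom of union for `(M, E)`. -/
def AxUnionE : Prop := ∀ a : M, ∃ u, ∀ z, E z u ↔ ∃ y, E y a ∧ E z y

/-- Axiom of power set for `(M, E)`. -/
def AxPowE : Prop := ∀ a : M, ∃ p, PowSpecE E p a

/-- Axiom of infinity for `(M, E)`. -/
def AxInfE : Prop :=
  ∃ I : M, (∃ e, E e I ∧ EmptyE E e) ∧ ∀ y, E y I → ∃ s, E s I ∧ SuccSpecE E s y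

/-- Axiom of foundation for `(M, E)`. -/
def AxFoundE : Prop :=
  ∀ a : M, (∃ z, E z a) → ∃ m, E m a ∧ ∀ z, E z a → ¬ E z m

/-- Separation scheme for `(M, E)`. -/
def AxSepE : Prop :=
  ∀ (k : ℕ) (φ : SetFormula (k + 1)) (p : Fin k → M) (a : M),
    ∃ s : M, ∀ z, E z s ↔ (E z a ∧ Realize E φ (Fin.cons z p))

/-- Replacement scheme for `(M, E)`. -/
def AxReplE : Prop :=
  ∀ (k : ℕ) (φ : SetFormula (k + 2)) (p : Fin k → M) (a : M),
    (∀ x, E x a → ∀ y y', Realize E φ (Fin.cons x (Fin.cons y p)) →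
      Realize E φ (Fin.cons x (Fin.cons y' p)) → y = y') →
    ∃ b : M, ∀ y, E y b ↔ ∃ x, E x a ∧ Realize E φ (Fin.cons x (Fin.cons y p))

/-- Axiom of choice for `(M, E)`. -/
def AxChoiceE : Prop :=
  ∀ a : M, (∀ x, E x a → ∃ z, E z x) →
    (∀ x y, E x a → E y a → x ≠ y → ¬ ∃ z, E z x ∧ E z y) →
    ∃ c, ∀ x, E x a → ∃ z, E z c ∧ E z x ∧ ∀ z', E z' c → E z' x → z' = z

/-- `(M, E)` is a model of `ZF⁻` (Zermelo–Fraenkel set theory without the power set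
axiom). -/
def IsZFMinusE : Prop :=
  AxExtE E ∧ AxPairE E ∧ AxUnionE E ∧ AxInfE E ∧ AxFoundE E ∧ AxSepE E ∧ AxReplE E

/-- `(M, E)` is a model of `ZFC`. -/
def IsZFCE : Prop :=
  Nonempty M ∧ IsZFMinusE E ∧ AxPowE E ∧ AxChoiceE E

/-- The set `m` is, with the induced membership relation, a transitive model
of `ZF⁻`. -/
def ZFMinusModelE (m : M) : Prop :=
  IsZFMinusE fun a b : {x : M // E x m} => E a.1 b.1

/-- `x` has cardinality `κ`. -/
def CardEqE (x κ : M) : Prop := ∃ f, BijE E f κ x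

/-- `m` is closed under sequences of length less than `κ`: `^{<κ}m ⊆ m`. -/
def SmallSeqClosedE (m κ : M) : Prop := ∀ γ f, E γ κ → IsFuncE E f γ m → E f m

/-- `κ` is a `C⁽ⁿ⁾`-strongly unfoldable cardinal. -/
def CnStronglyUnfoldableE (n : ℕ) (κ : M) : Prop :=
  InaccE E κ ∧ ∀ lam, CnE E n lam → E κ lam →
    ∀ m, TransE E m → ZFMinusModelE E m → CardEqE E m κ → E κ m →
      SmallSeqClosedE E m κ →
      ∃ N j κ', TransE E N ∧ (∀ x, VMemE E x lam → E x N) ∧ IsFuncE E j m N ∧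
        (∀ ⦃k : ℕ⦄ (φ : SetFormula k) (v w : Fin k → M), (∀ i, E (v i) m) →
          (∀ i, PairMemE E j (v i) (w i)) →
          (RealizeIn E (fun x => E x m) φ v ↔ RealizeIn E (fun x => E x N) φ w)) ∧
        (∀ α, E α κ → PairMemE E j α α) ∧ PairMemE E j κ κ' ∧ E lam κ' ∧
        SigmaElemPairE E n (fun x => VMemE E x lam) fun x => E x N ∧ VMemE E x κ'

/-- `x` is ordinal definable. -/
def IsODE (x : M) : Prop :=
  ∃ (k : ℕ) (φ : SetFormula (k + 1)) (p : Fin k → M), (∀ i, OrdE E (p i)) ∧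
    Realize E φ (Fin.cons x p) ∧ ∀ y, Realize E φ (Fin.cons y p) → y = x

/-- `x` is hereditarily ordinal definable, i.e. `x ∈ HOD`. -/
def IsHODE (x : M) : Prop := IsODE E x ∧ ∀ z, TCMemE E z x → IsODE E z

/-- The instance of the principle "`Ord` is essentially faint" for the class
sequence `⟨{A | Efam α A} | α ∈ Ord⟩`. -/
def FaintForE (Efam : M → M → Prop) : Prop :=
  (∀ α, OrdE E α → (∃ A, Efam α A) ∧ ∀ A, Efam α A → SubE E A α) →
    ∀ ξ, OrdE E ξ → ∃ α β A B, OrdE E α ∧ OrdE E β ∧ E ξ α ∧ E α β ∧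
      Efam β A ∧ InterSpecE E B A α ∧ Efam α B

/-- `C` is a closed unbounded class of ordinals. -/
def ClubClassE (C : M → Prop) : Prop :=
  (∀ x, C x → OrdE E x) ∧ (∀ α, OrdE E α → ∃ β, C β ∧ E α β) ∧
    ∀ l, OrdE E l → (∃ w, E w l) → (∀ α, E α l → ∃ β, C β ∧ E α β ∧ E β l) → C l

/-- The instance of the principle "`Ord` is essentially subtle" for the class
sequence `⟨{A | Efam α A} | α ∈ Ord⟩` and the class `C`. -/
def SubtleForE (Efam : M → M → Prop) (C : M → Prop) : Prop :=
  (∀ α, OrdE E α → (∃ A, Efam α A) ∧ ∀ A, Efam α A → SubE E A α) →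
    ClubClassE E C →
    ∃ α β A B, C α ∧ C β ∧ E α β ∧ Efam β A ∧ InterSpecE E B A α ∧ Efam α B

/-- The scheme "`Ord` is essentially faint" holds in `(M, E)`: every instance for a
definable (with parameters) class sequence holds. -/
def OrdFaintDefE : Prop :=
  ∀ (k : ℕ) (φ : SetFormula (k + 2)) (p : Fin k → M),
    FaintForE E fun α A => Realize E φ (Fin.cons α (Fin.cons A p))

/-- The scheme "`Ord` is essentially subtle" holds in `(M, E)`: every instance for
definable (with parameters) class sequences and club classes holds. -/
def OrdSubtleDefE : Prop :=
  ∀ (k k' : ℕ) (φ : SetFormula (k + 2)) (p : Fin k → M)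
    (ψ : SetFormula (k' + 1)) (q : Fin k' → M),
    SubtleForE E (fun α A => Realize E φ (Fin.cons α (Fin.cons A p)))
      fun x => Realize E ψ (Fin.cons x q)

/-- There is a proper class of subtle cardinals in `(M, E)`. -/
def ProperClassSubtleE : Prop := ∀ α, OrdE E α → ∃ κ, SubtleE E κ ∧ E α κ

/-- There are no strongly inaccessible cardinals in `(M, E)`. -/
def NoInaccE : Prop := ∀ κ, ¬ InaccE E κ

end Generic

end Paper
namespace Paper

/-- The membership relation on the universe `ZFSet` of sets. -/
def zmem : ZFSet.{0} → ZFSet.{0} → Prop := fun x y => x ∈ y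

/-- The membership relation on the inner model `HOD` of all hereditarily ordinal
definable sets. -/
def hodMem : {x : ZFSet.{0} // IsHODE zmem x} → {x : ZFSet.{0} // IsHODE zmem x} → Prop :=
  fun a b => a.1 ∈ b.1

/-- `κ` is a subtle cardinal in the inner model `HOD`. -/
def IsSubtleInHOD (κ : ZFSet.{0}) : Prop :=
  ∃ h : IsHODE zmem κ, SubtleE hodMem ⟨κ, h⟩

end Paper
namespace Paper

/-- The set `{ε}` is definable by a `Σₙ`-formula with parameters from the class
`P` (over the universe `ZFSet`). -/
def SigmaDefinableSingleton (n : ℕ) (ε : ZFSet.{0}) (P : ZFSet.{0} → Prop) : Prop :=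
  ∃ (k : ℕ) (φ : SetFormula (k + 1)) (p : Fin k → ZFSet.{0}),
    IsSigma n φ ∧ (∀ i, P (p i)) ∧
    Realize zmem φ (Fin.cons ε p) ∧ ∀ y, Realize zmem φ (Fin.cons y p) → y = ε

end Paper

namespace Paper

/-- `f` is a cofinal function from `γ` into the ordinal `δ`. -/
def CofinalMapZ (f γ δ : ZFSet.{0}) : Prop :=
  IsFuncE zmem f γ δ ∧
    ∀ β, β ∈ δ → ∃ x y, x ∈ γ ∧ PairMemE zmem f x y ∧ (β ∈ y ∨ β = y)

end Paper

namespace Paper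

/-! ### Renaming of variables -/

/-- Lift a renaming below a binder. -/
def liftR {k l : ℕ} (σ : Fin k → Fin l) : Fin (k + 1) → Fin (l + 1) :=
  Fin.snoc (α := fun _ => Fin (l + 1)) (fun i => (σ i).castSucc) (Fin.last l)

@[simp] theorem liftR_castSucc {k l : ℕ} (σ : Fin k → Fin l) (i : Fin k) :
    liftR σ i.castSucc = (σ i).castSucc := by simp [liftR]

@[simp] theorem liftR_last {k l : ℕ} (σ : Fin k → Fin l) :
    liftR σ (Fin.last k) = Fin.last l := by simp [liftR]

/-- Rename the free variables of a formula. -/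
def ren : ∀ {k l : ℕ}, (Fin k → Fin l) → SetFormula k → SetFormula l
  | _, _, σ, .mem i j => .mem (σ i) (σ j)
  | _, _, σ, .eq i j => .eq (σ i) (σ j)
  | _, _, _, .fal => .fal
  | _, _, σ, .imp φ ψ => .imp (ren σ φ) (ren σ ψ)
  | _, _, σ, .all φ => .all (ren (liftR σ) φ)

theorem snoc_liftR {M : Type*} {k l : ℕ} (σ : Fin k → Fin l) (v : Fin l → M) (a : M) :
    (fun i => (Fin.snoc v a : Fin (l + 1) → M) (liftR σ i)) =
      (Fin.snoc (fun i => v (σ i)) a : Fin (k + 1) → M) := by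
  funext i
  refine Fin.lastCases ?_ (fun i => ?_) i <;> simp

theorem realize_ren {M : Type*} (E : M → M → Prop) {k : ℕ} (φ : SetFormula k) :
    ∀ {l : ℕ} (σ : Fin k → Fin l) (v : Fin l → M),
      Realize E (ren σ φ) v ↔ Realize E φ (fun i => v (σ i)) := by
  induction φ with
  | mem i j => intros; rfl
  | eq i j => intros; rfl
  | fal => intros; rfl
  | imp φ ψ h1 h2 => intro l σ v; simp only [ren, Realize, h1, h2]
  | all φ h =>
    intro l σ v
    simp only [ren, Realize, h, snoc_liftR]

theorem ren_delta0 {k : ℕ} {φ : SetFormula k} (h : IsDelta0 φ) :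
    ∀ {l : ℕ} (σ : Fin k → Fin l), IsDelta0 (ren σ φ) := by
  induction h with
  | mem i j => intros; exact .mem _ _
  | eq i j => intros; exact .eq _ _
  | fal => intros; exact .fal
  | imp _ _ h1 h2 => intro l σ; exact .imp (h1 σ) (h2 σ)
  | ball j _ h =>
    intro l σ
    simp only [ren, liftR_last, liftR_castSucc]
    exact .ball _ (h _)
  | bex j _ h =>
    intro l σ
    simp only [ren, SetFormula.ex, SetFormula.and, SetFormula.not, liftR_last, liftR_castSucc]
    exact .bex _ (h _)

mutual
  theorem ren_sigma : ∀ {m k : ℕ} {φ : SetFormula k}, IsSigma m φ →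
      ∀ {l : ℕ} (σ : Fin k → Fin l), IsSigma m (ren σ φ)
    | _, _, _, .ofDelta0 h, _, σ => .ofDelta0 (ren_delta0 h σ)
    | _, _, _, .ofPi h, _, σ => .ofPi (ren_pi h σ)
    | _, _, _, .ex h, _, σ => .ex (ren_sigma h (liftR σ))
  theorem ren_pi : ∀ {m k : ℕ} {φ : SetFormula k}, IsPi m φ →
      ∀ {l : ℕ} (σ : Fin k → Fin l), IsPi m (ren σ φ)
    | _, _, _, .ofDelta0 h, _, σ => .ofDelta0 (ren_delta0 h σ)
    | _, _, _, .ofSigma h, _, σ => .ofSigma (ren_sigma h σ)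
    | _, _, _, .all h, _, σ => .all (ren_pi h (liftR σ))
end

/-! ### Basic semantics -/

section
variable {M : Type*} (E : M → M → Prop) {k : ℕ}

@[simp] theorem realize_not (φ : SetFormula k) (v : Fin k → M) :
    Realize E φ.not v ↔ ¬ Realize E φ v := by
  simp [SetFormula.not, Realize]

@[simp] theorem realize_and (φ ψ : SetFormula k) (v : Fin k → M) :
    Realize E (φ.and ψ) v ↔ (Realize E φ v ∧ Realize E ψ v) := by
  simp [SetFormula.and, SetFormula.not, Realize]

@[simp] theorem realize_ex (φ : SetFormula (k + 1)) (v : Fin k → M) :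
    Realize E φ.ex v ↔ ∃ a, Realize E φ (Fin.snoc v a) := by
  simp [SetFormula.ex, SetFormula.not, Realize]

@[simp] theorem realize_all (φ : SetFormula (k + 1)) (v : Fin k → M) :
    Realize E φ.all v ↔ ∀ a, Realize E φ (Fin.snoc v a) := Iff.rfl

@[simp] theorem realize_imp (φ ψ : SetFormula k) (v : Fin k → M) :
    Realize E (φ.imp ψ) v ↔ (Realize E φ v → Realize E ψ v) := Iff.rfl

@[simp] theorem realize_mem (i j : Fin k) (v : Fin k → M) :
    Realize E (.mem i j) v ↔ E (v i) (v j) := Iff.rfl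

@[simp] theorem realize_eq (i j : Fin k) (v : Fin k → M) :
    Realize E (.eq i j) v ↔ v i = v j := Iff.rfl

@[simp] theorem realize_fal (v : Fin k → M) :
    Realize E .fal v ↔ False := Iff.rfl

end

mutual
  theorem neg_sigma : ∀ {m k : ℕ} {φ : SetFormula k}, IsSigma m φ →
      ∃ ψ : SetFormula k, IsPi m ψ ∧ ∀ (M : Type 1) (E : M → M → Prop) (v : Fin k → M),
        Realize E ψ v ↔ ¬ Realize E φ v
    | _, _, φ, .ofDelta0 h => ⟨φ.not, .ofDelta0 (.imp h .fal), fun _ E v => realize_not E φ v⟩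
    | _, _, _, .ofPi h => by
      obtain ⟨ψ, h1, h2⟩ := neg_pi h
      exact ⟨ψ, .ofSigma h1, h2⟩
    | _, _, _, .ex h => by
      obtain ⟨ψ, h1, h2⟩ := neg_sigma h
      exact ⟨ψ.all, .all h1, fun M E v => by simp [h2]⟩
  theorem neg_pi : ∀ {m k : ℕ} {φ : SetFormula k}, IsPi m φ →
      ∃ ψ : SetFormula k, IsSigma m ψ ∧ ∀ (M : Type 1) (E : M → M → Prop) (v : Fin k → M),
        Realize E ψ v ↔ ¬ Realize E φ v
    | _, _, φ, .ofDelta0 h => ⟨φ.not, .ofDelta0 (.imp h .fal), fun _ E v => realize_not E φ v⟩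
    | _, _, _, .ofSigma h => by
      obtain ⟨ψ, h1, h2⟩ := neg_sigma h
      exact ⟨ψ, .ofPi h1, h2⟩
    | _, _, _, .all h => by
      obtain ⟨ψ, h1, h2⟩ := neg_pi h
      exact ⟨ψ.ex, .ex h1, fun M E v => by simp [h2]⟩
end

/-- Move a fresh last variable behind another fresh variable. -/
def swapR (k : ℕ) : Fin (k + 1) → Fin (k + 2) :=
  Fin.snoc (α := fun _ => Fin (k + 2)) (fun i => i.castSucc.castSucc) (Fin.last (k + 1))

theorem snoc_swapR {M : Type*} {k : ℕ} (v : Fin k → M) (a y : M) :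
    (fun i => (Fin.snoc (Fin.snoc v a : Fin (k + 1) → M) y : Fin (k + 2) → M) (swapR k i)) =
      (Fin.snoc v y : Fin (k + 1) → M) := by
  funext i
  refine Fin.lastCases ?_ (fun i => ?_) i <;> simp [swapR]

mutual
  theorem and_sigma : ∀ {m k : ℕ} {φ : SetFormula k}, IsSigma m φ →
      ∀ {χ : SetFormula k}, IsDelta0 χ →
      ∃ ψ : SetFormula k, IsSigma m ψ ∧ ∀ (M : Type 1) (E : M → M → Prop) [Nonempty M] (v : Fin k → M),
        Realize E ψ v ↔ (Realize E φ v ∧ Realize E χ v)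
    | _, _, φ, .ofDelta0 h, χ, hχ =>
      ⟨φ.and χ, .ofDelta0 (.imp (.imp h (.imp hχ .fal)) .fal), fun _ E _ v => realize_and E φ χ v⟩
    | _, _, _, .ofPi h, _, hχ => by
      obtain ⟨ψ, h1, h2⟩ := and_pi h hχ
      exact ⟨ψ, .ofPi h1, h2⟩
    | _, _, _, .ex h, _, hχ => by
      obtain ⟨ψ, h1, h2⟩ := and_sigma h (ren_delta0 hχ Fin.castSucc)
      exact ⟨ψ.ex, .ex h1, fun M E _ v => by simp [h2, realize_ren]⟩
  theorem and_pi : ∀ {m k : ℕ} {φ : SetFormula k}, IsPi m φ →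
      ∀ {χ : SetFormula k}, IsDelta0 χ →
      ∃ ψ : SetFormula k, IsPi m ψ ∧ ∀ (M : Type 1) (E : M → M → Prop) [Nonempty M]
        (v : Fin k → M), Realize E ψ v ↔ (Realize E φ v ∧ Realize E χ v)
    | _, _, φ, .ofDelta0 h, χ, hχ =>
      ⟨φ.and χ, .ofDelta0 (.imp (.imp h (.imp hχ .fal)) .fal), fun _ E _ v => realize_and E φ χ v⟩
    | _, _, _, .ofSigma h, _, hχ => by
      obtain ⟨ψ, h1, h2⟩ := and_sigma h hχ
      exact ⟨ψ, .ofSigma h1, h2⟩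
    | _, _, _, .all h, _, hχ => by
      obtain ⟨ψ, h1, h2⟩ := and_pi h (ren_delta0 hχ Fin.castSucc)
      exact ⟨ψ.all, .all h1, fun M E _ v => by simp [h2, realize_ren, forall_and]⟩
end

end Paper

namespace Paper

/-! ### Definable predicates, uniformly over all structures -/

/-- A `k`-ary predicate on all structures. -/
abbrev Pred (k : ℕ) : Type 2 := ∀ (M : Type 1) (_ : M → M → Prop), (Fin k → M) → Prop

/-- The predicate is defined by a formula. -/
class Dfn {k : ℕ} (P : Pred k) : Prop where
  out : ∃ φ : SetFormula k, ∀ M E v, Realize E φ v ↔ P M E v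

/-- The predicate is defined by a `Δ₀`-formula. -/
class Dfn0 {k : ℕ} (P : Pred k) : Prop where
  out : ∃ φ : SetFormula k, IsDelta0 φ ∧ ∀ M E v, Realize E φ v ↔ P M E v

theorem isDelta0_and {k : ℕ} {φ ψ : SetFormula k} (h1 : IsDelta0 φ) (h2 : IsDelta0 ψ) :
    IsDelta0 (φ.and ψ) := .imp (.imp h1 (.imp h2 .fal)) .fal

section
variable {k : ℕ}

instance (priority := 10) Dfn.of0 {P : Pred k} [h : Dfn0 P] : Dfn P :=
  ⟨by obtain ⟨φ, _, h⟩ := h.out; exact ⟨φ, h⟩⟩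

theorem Dfn.congr {P Q : Pred k} (h : Dfn P) (e : ∀ M E v, P M E v ↔ Q M E v) : Dfn Q :=
  ⟨by obtain ⟨φ, h⟩ := h.out; exact ⟨φ, fun M E v => (h M E v).trans (e M E v)⟩⟩

theorem Dfn0.congr {P Q : Pred k} (h : Dfn0 P) (e : ∀ M E v, P M E v ↔ Q M E v) : Dfn0 Q :=
  ⟨by obtain ⟨φ, h0, h⟩ := h.out; exact ⟨φ, h0, fun M E v => (h M E v).trans (e M E v)⟩⟩

instance Dfn0.mem (i j : Fin k) : Dfn0 (fun _ E v => E (v i) (v j)) :=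
  ⟨.mem i j, .mem i j, fun _ _ _ => Iff.rfl⟩

instance Dfn0.eq (i j : Fin k) : Dfn0 (fun _ _ v => v i = v j) :=
  ⟨.eq i j, .eq i j, fun _ _ _ => Iff.rfl⟩

instance Dfn0.fal : Dfn0 (k := k) (fun _ _ _ => False) :=
  ⟨.fal, .fal, fun _ _ _ => Iff.rfl⟩

instance Dfn0.tru : Dfn0 (k := k) (fun _ _ _ => True) :=
  ⟨.imp .fal .fal, .imp .fal .fal, fun _ _ _ => by simp⟩

instance Dfn0.imp {P Q : Pred k} [h1 : Dfn0 P] [h2 : Dfn0 Q] :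
    Dfn0 (fun M E v => P M E v → Q M E v) := by
  obtain ⟨φ, a, hφ⟩ := h1.out
  obtain ⟨ψ, b, hψ⟩ := h2.out
  exact ⟨φ.imp ψ, .imp a b, fun M E v => by simp [hφ, hψ]⟩

instance Dfn0.and {P Q : Pred k} [h1 : Dfn0 P] [h2 : Dfn0 Q] :
    Dfn0 (fun M E v => P M E v ∧ Q M E v) := by
  obtain ⟨φ, a, hφ⟩ := h1.out
  obtain ⟨ψ, b, hψ⟩ := h2.out
  exact ⟨φ.and ψ, isDelta0_and a b, fun M E v => by simp [hφ, hψ]⟩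

instance Dfn0.not {P : Pred k} [h1 : Dfn0 P] :
    Dfn0 (fun M E v => ¬ P M E v) := by
  obtain ⟨φ, a, hφ⟩ := h1.out
  exact ⟨φ.not, .imp a .fal, fun M E v => by simp [hφ]⟩

instance Dfn0.or {P Q : Pred k} [h1 : Dfn0 P] [h2 : Dfn0 Q] :
    Dfn0 (fun M E v => P M E v ∨ Q M E v) :=
  Dfn0.congr (P := fun M E v => (¬ P M E v → Q M E v)) inferInstance
    fun M E v => by tauto

instance Dfn0.iff {P Q : Pred k} [h1 : Dfn0 P] [h2 : Dfn0 Q] :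
    Dfn0 (fun M E v => P M E v ↔ Q M E v) :=
  Dfn0.congr (P := fun M E v => (P M E v → Q M E v) ∧ (Q M E v → P M E v)) inferInstance
    fun M E v => by tauto

theorem snoc_eta {M : Type*} (v : Fin k → M) (a : M) :
    (fun i : Fin k => (Fin.snoc v a : Fin (k + 1) → M) i.castSucc) = v := by
  funext i; simp

instance Dfn0.ball (j : Fin k) {P : ∀ (M : Type 1) (_ : M → M → Prop), (Fin k → M) → M → Prop}
    [h : Dfn0 (k := k + 1) (fun M E w => P M E (fun i => w i.castSucc) (w (Fin.last k)))] :
    Dfn0 (fun M E v => ∀ a, E a (v j) → P M E v a) := by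
  obtain ⟨φ, a, hφ⟩ := h.out
  exact ⟨_, .ball j a, fun M E v => by simp [hφ]⟩

instance Dfn0.bex (j : Fin k) {P : ∀ (M : Type 1) (_ : M → M → Prop), (Fin k → M) → M → Prop}
    [h : Dfn0 (k := k + 1) (fun M E w => P M E (fun i => w i.castSucc) (w (Fin.last k)))] :
    Dfn0 (fun M E v => ∃ a, E a (v j) ∧ P M E v a) := by
  obtain ⟨φ, a, hφ⟩ := h.out
  exact ⟨_, .bex j a, fun M E v => by simp [hφ]⟩

instance Dfn0.bex' (j : Fin k) : Dfn0 (fun M E v => ∃ a : M, E a (v j)) :=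
  Dfn0.congr (P := fun M E v => ∃ a : M, E a (v j) ∧ True) inferInstance fun M E v => by simp

instance Dfn0.nbex' (j : Fin k) : Dfn0 (fun M E v => ∀ a : M, ¬ E a (v j)) :=
  Dfn0.congr (P := fun M E v => ∀ a : M, E a (v j) → False) inferInstance fun M E v => by simp

instance Dfn.imp {P Q : Pred k} [h1 : Dfn P] [h2 : Dfn Q] :
    Dfn (fun M E v => P M E v → Q M E v) := by
  obtain ⟨φ, hφ⟩ := h1.out
  obtain ⟨ψ, hψ⟩ := h2.out
  exact ⟨φ.imp ψ, fun M E v => by simp [hφ, hψ]⟩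

instance Dfn.and {P Q : Pred k} [h1 : Dfn P] [h2 : Dfn Q] :
    Dfn (fun M E v => P M E v ∧ Q M E v) := by
  obtain ⟨φ, hφ⟩ := h1.out
  obtain ⟨ψ, hψ⟩ := h2.out
  exact ⟨φ.and ψ, fun M E v => by simp [hφ, hψ]⟩

instance Dfn.not {P : Pred k} [h1 : Dfn P] :
    Dfn (fun M E v => ¬ P M E v) := by
  obtain ⟨φ, hφ⟩ := h1.out
  exact ⟨φ.not, fun M E v => by simp [hφ]⟩

instance Dfn.or {P Q : Pred k} [h1 : Dfn P] [h2 : Dfn Q] :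
    Dfn (fun M E v => P M E v ∨ Q M E v) :=
  Dfn.congr (P := fun M E v => (¬ P M E v → Q M E v)) inferInstance
    fun M E v => by tauto

instance Dfn.iff {P Q : Pred k} [h1 : Dfn P] [h2 : Dfn Q] :
    Dfn (fun M E v => P M E v ↔ Q M E v) :=
  Dfn.congr (P := fun M E v => (P M E v → Q M E v) ∧ (Q M E v → P M E v)) inferInstance
    fun M E v => by tauto

instance Dfn.all {P : ∀ (M : Type 1) (_ : M → M → Prop), (Fin k → M) → M → Prop}
    [h : Dfn (k := k + 1) (fun M E w => P M E (fun i => w i.castSucc) (w (Fin.last k)))] :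
    Dfn (fun M E v => ∀ a, P M E v a) := by
  obtain ⟨φ, hφ⟩ := h.out
  exact ⟨φ.all, fun M E v => by simp [hφ]⟩

instance Dfn.ex {P : ∀ (M : Type 1) (_ : M → M → Prop), (Fin k → M) → M → Prop}
    [h : Dfn (k := k + 1) (fun M E w => P M E (fun i => w i.castSucc) (w (Fin.last k)))] :
    Dfn (fun M E v => ∃ a, P M E v a) := by
  obtain ⟨φ, hφ⟩ := h.out
  exact ⟨φ.ex, fun M E v => by simp [hφ]⟩

theorem Dfn.ren {l : ℕ} {P : Pred k} (h : Dfn P) (σ : Fin k → Fin l) :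
    Dfn (fun M E v => P M E (fun i => v (σ i))) := by
  obtain ⟨φ, hφ⟩ := h.out
  exact ⟨Paper.ren σ φ, fun M E v => by simp [hφ, realize_ren]⟩

theorem Dfn0.ren {l : ℕ} {P : Pred k} (h : Dfn0 P) (σ : Fin k → Fin l) :
    Dfn0 (fun M E v => P M E (fun i => v (σ i))) := by
  obtain ⟨φ, h0, hφ⟩ := h.out
  exact ⟨Paper.ren σ φ, ren_delta0 h0 σ, fun M E v => by simp [hφ, realize_ren]⟩

instance Dfn.realize {l : ℕ} (χ : SetFormula k) (σ : Fin k → Fin l) :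
    Dfn (fun M E v => Realize E χ (fun i => v (σ i))) :=
  Dfn.ren (P := fun M E v => Realize E χ v) ⟨χ, fun _ _ _ => Iff.rfl⟩ σ

instance Dfn.finAll {K : ℕ} {P : Fin K → Pred k} [h : ∀ i, Dfn (P i)] :
    Dfn (fun M E v => ∀ i, P i M E v) := by
  induction K with
  | zero => exact Dfn.congr (P := fun _ _ _ => True) inferInstance fun M E v => by simp
  | succ K ih =>
    have := ih (P := fun i => P i.castSucc)
    exact Dfn.congr (P := fun M E v => (∀ i : Fin K, P i.castSucc M E v) ∧ P (Fin.last K) M E v)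
      inferInstance fun M E v => (Fin.forall_fin_succ' (P := fun i => P i M E v)).symm

theorem Dfn.exTuple {K : ℕ} : ∀ {k : ℕ} (P : Pred (k + K)), Dfn P →
    Dfn (fun M E (v : Fin k → M) => ∃ b : Fin K → M, P M E (Fin.append v b)) := by
  induction K with
  | zero =>
    intro k P h
    refine h.congr fun M E v => ?_
    constructor
    · intro h; exact ⟨Fin.elim0, by rw [Fin.append_elim0]; exact h⟩
    · rintro ⟨b, h⟩
      have : b = Fin.elim0 := funext fun i => i.elim0
      subst this; rw [Fin.append_elim0] at h; exact h
  | succ K ih =>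
    intro k P h
    have h' := ih (k := k) (fun M E v => ∃ a, P M E (Fin.snoc v a)) 
      (Dfn.ex (k := k + K) (P := fun M E v a => P M E (Fin.snoc v a)) (h := by
        refine Dfn.congr h fun M E v => ?_
        rw [Fin.snoc_init_self (n := k + K) (α := fun _ => M) v |>.symm]
        simp
        ))
    refine h'.congr fun M E v => ?_
    constructor
    · rintro ⟨b, a, h⟩
      exact ⟨Fin.snoc b a, by rw [Fin.append_snoc]; exact h⟩
    · rintro ⟨b, h⟩
      refine ⟨Fin.init b, b (Fin.last K), ?_⟩
      rw [← Fin.append_snoc, Fin.snoc_init_self]; exact h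

end

end Paper

namespace Paper

section
variable {M : Type*} {E : M → M → Prop}

theorem upairE_iff {p a b : M} :
    UPairE E p a b ↔ (∀ z, E z p → (z = a ∨ z = b)) ∧ E a p ∧ E b p := by
  unfold UPairE
  constructor
  · intro h
    exact ⟨fun z => (h z).1, (h a).2 (Or.inl rfl), (h b).2 (Or.inr rfl)⟩
  · rintro ⟨h, ha, hb⟩ z
    exact ⟨h z, by rintro (rfl | rfl) <;> assumption⟩

theorem opairE_iff {p a b : M} :
    OPairE E p a b ↔ ∃ s, E s p ∧ ∃ t, E t p ∧ (UPairE E s a a ∧ UPairE E t a b ∧ UPairE E p s t) := by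
  unfold OPairE
  constructor
  · rintro ⟨s, t, h1, h2, h3⟩
    exact ⟨s, (h3 s).2 (Or.inl rfl), t, (h3 t).2 (Or.inr rfl), h1, h2, h3⟩
  · rintro ⟨s, _, t, _, h⟩
    exact ⟨s, t, h⟩

theorem opairE_snd {p a b : M} (h : OPairE E p a b) : ∃ t, E t p ∧ E a t ∧ E b t := by
  obtain ⟨s, t, h1, h2, h3⟩ := h
  exact ⟨t, (h3 t).2 (Or.inr rfl), (h2 a).2 (Or.inl rfl), (h2 b).2 (Or.inr rfl)⟩

theorem ex_pairmem {f x : M} {Q : M → Prop} :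
    (∃ y, PairMemE E f x y ∧ Q y) ↔
      ∃ p, E p f ∧ ∃ t, E t p ∧ ∃ y, E y t ∧ (OPairE E p x y ∧ Q y) := by
  constructor
  · rintro ⟨y, ⟨p, hp, h⟩, hq⟩
    obtain ⟨t, h1, _, h2⟩ := opairE_snd h
    exact ⟨p, hp, t, h1, y, h2, h, hq⟩
  · rintro ⟨p, hp, t, h1, y, h2, h, hq⟩
    exact ⟨y, ⟨p, hp, h⟩, hq⟩

theorem all_pairmem {f x : M} {Q : M → Prop} :
    (∀ y, PairMemE E f x y → Q y) ↔
      ∀ p, E p f → ∀ t, E t p → ∀ y, E y t → (OPairE E p x y → Q y) := by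
  constructor
  · rintro h p hp t ht y hy ho
    exact h y ⟨p, hp, ho⟩
  · rintro h y ⟨p, hp, ho⟩
    obtain ⟨t, h1, _, h2⟩ := opairE_snd ho
    exact h p hp t h1 y h2 ho
end

section
variable {k : ℕ}

instance Dfn0.transE (i : Fin k) : Dfn0 (fun _ E v => TransE E (v i)) := by
  unfold TransE; infer_instance

instance Dfn0.ordE (i : Fin k) : Dfn0 (fun _ E v => OrdE E (v i)) := by
  unfold OrdE; infer_instance

instance Dfn0.subE (i j : Fin k) : Dfn0 (fun _ E v => SubE E (v i) (v j)) := by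
  unfold SubE; infer_instance

instance Dfn0.leE (i j : Fin k) : Dfn0 (fun _ E v => LeE E (v i) (v j)) := by
  unfold LeE; infer_instance

instance Dfn0.emptyE (i : Fin k) : Dfn0 (fun _ E v => EmptyE E (v i)) := by
  unfold EmptyE; infer_instance

instance Dfn0.succSpecE (i j : Fin k) : Dfn0 (fun _ E v => SuccSpecE E (v i) (v j)) :=
  Dfn0.congr (P := fun _ E v => (∀ z, E z (v i) → (E z (v j) ∨ z = v j)) ∧
      (∀ z, E z (v j) → E z (v i)) ∧ E (v j) (v i)) inferInstance fun M E v => by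
    unfold SuccSpecE
    constructor
    · rintro ⟨h1, h2, h3⟩ z
      exact ⟨h1 z, by rintro (h | rfl); exacts [h2 _ h, h3]⟩
    · intro h
      exact ⟨fun z => (h z).1, fun z hz => (h z).2 (Or.inl hz), (h _).2 (Or.inr rfl)⟩

instance Dfn0.limitE (i : Fin k) : Dfn0 (fun _ E v => LimitE E (v i)) := by
  unfold LimitE; infer_instance

instance Dfn0.omegaSpecE (i : Fin k) : Dfn0 (fun _ E v => OmegaSpecE E (v i)) := by
  unfold OmegaSpecE; infer_instance

instance Dfn0.infiniteOrdE (i : Fin k) : Dfn0 (fun _ E v => InfiniteOrdE E (v i)) :=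
  Dfn0.congr (P := fun _ E v => OrdE E (v i) ∧ ((∃ w, E w (v i) ∧ OmegaSpecE E w) ∨
      OmegaSpecE E (v i))) inferInstance fun M E v => by
    unfold InfiniteOrdE LeE
    constructor
    · rintro ⟨h, (⟨w, h1, h2⟩ | h1)⟩
      exacts [⟨h, w, h2, Or.inl h1⟩, ⟨h, _, h1, Or.inr rfl⟩]
    · rintro ⟨h, w, h1, (h2 | rfl)⟩
      exacts [⟨h, Or.inl ⟨w, h2, h1⟩⟩, ⟨h, Or.inr h1⟩]

instance Dfn0.upairE (i j l : Fin k) : Dfn0 (fun _ E v => UPairE E (v i) (v j) (v l)) := by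
  simp only [upairE_iff]; infer_instance

instance Dfn0.opairE (i j l : Fin k) : Dfn0 (fun _ E v => OPairE E (v i) (v j) (v l)) := by
  simp only [opairE_iff]; infer_instance

instance Dfn0.pairMemE (i j l : Fin k) : Dfn0 (fun _ E v => PairMemE E (v i) (v j) (v l)) := by
  unfold PairMemE; infer_instance

instance Dfn0.exPair (i j : Fin k)
    {P : ∀ (M : Type 1) (_ : M → M → Prop), (Fin k → M) → M → Prop}
    [h : Dfn0 (k := k + 1) (fun M E w => P M E (fun i => w i.castSucc) (w (Fin.last k)))] :
    Dfn0 (fun M E v => ∃ y, PairMemE E (v i) (v j) y ∧ P M E v y) := by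
  simp only [ex_pairmem]
  have := h.ren (l := k + 3) (fun i => Fin.snoc (α := fun _ => Fin (k+3))
    (fun i => i.castSucc.castSucc.castSucc) (Fin.last (k+2)) i)
  simp only [Fin.snoc_castSucc, Fin.snoc_last] at this
  infer_instance

instance Dfn0.allPair (i j : Fin k)
    {P : ∀ (M : Type 1) (_ : M → M → Prop), (Fin k → M) → M → Prop}
    [h : Dfn0 (k := k + 1) (fun M E w => P M E (fun i => w i.castSucc) (w (Fin.last k)))] :
    Dfn0 (fun M E v => ∀ y, PairMemE E (v i) (v j) y → P M E v y) := by
  simp only [all_pairmem]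
  have := h.ren (l := k + 3) (fun i => Fin.snoc (α := fun _ => Fin (k+3))
    (fun i => i.castSucc.castSucc.castSucc) (Fin.last (k+2)) i)
  simp only [Fin.snoc_castSucc, Fin.snoc_last] at this
  infer_instance

instance Dfn0.funcE (i j l : Fin k) : Dfn0 (fun _ E v => IsFuncE E (v i) (v j) (v l)) :=
  Dfn0.congr (P := fun _ E v => (∀ p, E p (v i) → ∃ x, E x (v j) ∧ ∃ y, E y (v l) ∧ OPairE E p x y) ∧
    ∀ x, E x (v j) → (∃ y, PairMemE E (v i) x y ∧ True) ∧
      ∀ y, PairMemE E (v i) x y → ∀ y', PairMemE E (v i) x y' → y = y') inferInstance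
    fun M E v => by
      unfold IsFuncE
      simp only [and_true]
      constructor
      · rintro ⟨h1, h2⟩
        refine ⟨fun p hp => ?_, fun x hx => ⟨(h2 x hx).1, fun y y' h h' => (h2 x hx).2 y h y' h'⟩⟩
        obtain ⟨x, hx, y, hy, h⟩ := h1 p hp
        exact ⟨x, y, hx, hy, h⟩
      · rintro ⟨h1, h2⟩
        refine ⟨fun p hp => ?_, fun x hx => ⟨(h2 x hx).1, fun y h y' h' => (h2 x hx).2 y y' h h'⟩⟩
        obtain ⟨x, y, hx, hy, h⟩ := h1 p hp
        exact ⟨x, hx, y, hy, h⟩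

instance Dfn0.surjE (i j l : Fin k) : Dfn0 (fun _ E v => SurjE E (v i) (v j) (v l)) := by
  unfold SurjE; infer_instance

instance Dfn0.injE (i j l : Fin k) : Dfn0 (fun _ E v => InjE E (v i) (v j) (v l)) :=
  Dfn0.congr (P := fun _ E v => IsFuncE E (v i) (v j) (v l) ∧ ∀ x, E x (v j) → ∀ x', E x' (v j) →
    ∀ y, PairMemE E (v i) x y → (PairMemE E (v i) x' y → x = x')) inferInstance
    fun M E v => by
      unfold InjE
      exact and_congr_right fun _ => ⟨fun h x x' y h1 h2 => h x h1 x' h2 y,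
        fun h x h1 x' h2 y => h x x' y h1 h2⟩

instance Dfn0.bijE (i j l : Fin k) : Dfn0 (fun _ E v => BijE E (v i) (v j) (v l)) := by
  unfold BijE; infer_instance

instance Dfn0.interSpecE (i j l : Fin k) : Dfn0 (fun _ E v => InterSpecE E (v i) (v j) (v l)) :=
  Dfn0.congr (P := fun _ E v => (∀ z, E z (v i) → (E z (v j) ∧ E z (v l))) ∧
    ∀ z, E z (v j) → (E z (v l) → E z (v i))) inferInstance
    fun M E v => by
      unfold InterSpecE
      constructor
      · rintro ⟨h1, h2⟩ z
        exact ⟨h1 z, fun h => h2 z h.1 h.2⟩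
      · intro h
        exact ⟨fun z => (h z).1, fun z h1 h2 => (h z).2 ⟨h1, h2⟩⟩

instance Dfn0.clubInE (i j : Fin k) : Dfn0 (fun _ E v => ClubInE E (v i) (v j)) := by
  unfold ClubInE UnboundedInE ClosedInE; infer_instance

instance Dfn0.seqSpecE (i j : Fin k) : Dfn0 (fun _ E v => SeqSpecE E (v i) (v j)) :=
  Dfn0.congr (P := fun _ E v => ∀ α, E α (v j) → (∃ A, PairMemE E (v i) α A ∧ SubE E A α) ∧
    ∀ A, PairMemE E (v i) α A → ∀ A', PairMemE E (v i) α A' → A = A') inferInstance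
    fun M E v => by
      unfold SeqSpecE
      exact forall₂_congr fun α _ => and_congr_right fun _ => ⟨fun h A A' h1 h2 => h A h1 A' h2,
        fun h A h1 A' h2 => h A A' h1 h2⟩

/-- `(f, c)` is a counterexample to the subtlety of `d`. -/
def CexE {M : Type*} (E : M → M → Prop) (f c d : M) : Prop :=
  SeqSpecE E f d ∧ ClubInE E c d ∧ ¬ ∃ α, E α c ∧ ∃ β, E β c ∧ (E α β ∧
      ∃ A, PairMemE E f α A ∧ ∃ B, PairMemE E f β B ∧ InterSpecE E A B α)

instance Dfn0.cexE (i j l : Fin k) : Dfn0 (fun _ E v => CexE E (v i) (v j) (v l)) := by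
  unfold CexE; infer_instance

/-- `f` is a cofinal map. -/
def CofE {M : Type*} (E : M → M → Prop) (f γ δ : M) : Prop :=
  IsFuncE E f γ δ ∧ ∀ β, E β δ → ∃ x, E x γ ∧ ∃ y, PairMemE E f x y ∧ LeE E β y

instance Dfn0.cofE (i j l : Fin k) : Dfn0 (fun _ E v => CofE E (v i) (v j) (v l)) := by
  unfold CofE; infer_instance

instance Dfn.vHierE (i j : Fin k) : Dfn (fun _ E v => VHierE E (v i) (v j)) := by
  unfold VHierE; infer_instance

instance Dfn.vMemE (i j : Fin k) : Dfn (fun _ E v => VMemE E (v i) (v j)) := by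
  unfold VMemE; infer_instance

end

/-! ### Absoluteness of `Δ₀` predicates -/

/-- Induced relation on a subclass. -/
abbrev indE {M : Type*} (E : M → M → Prop) (S : M → Prop) : {x : M // S x} → {x : M // S x} → Prop :=
  fun a b => E a.1 b.1

theorem snoc_val {M : Type*} {S : M → Prop} {k : ℕ} (v : Fin k → {x : M // S x}) (a : {x : M // S x}) :
    (fun i => ((Fin.snoc v a : Fin (k + 1) → {x : M // S x}) i).1) =
      (Fin.snoc (fun i => (v i).1) a.1 : Fin (k + 1) → M) := by
  funext i
  refine Fin.lastCases ?_ (fun i => ?_) i <;> simp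

theorem delta0_abs {M : Type*} {E : M → M → Prop} {S : M → Prop}
    (hS : ∀ x, S x → ∀ y, E y x → S y) {k : ℕ} {φ : SetFormula k} (h : IsDelta0 φ) :
    ∀ v : Fin k → {x : M // S x}, Realize (indE E S) φ v ↔ Realize E φ (fun i => (v i).1) := by
  induction h with
  | mem i j => intro v; rfl
  | eq i j => intro v; simp [Subtype.ext_iff]
  | fal => intro v; rfl
  | imp _ _ h1 h2 => intro v; simp [h1, h2]
  | ball j _ h =>
    intro v
    simp [h, snoc_val]
    exact ⟨fun H a ha => H a (hS _ (v j).2 _ ha) ha, fun H a _ ha => H a ha⟩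
  | bex j _ h =>
    intro v
    simp [h, snoc_val]
    exact ⟨fun ⟨a, ⟨_, h1⟩, ha⟩ => ⟨a, h1, ha⟩,
      fun ⟨a, h1, ha⟩ => ⟨a, ⟨hS _ (v j).2 _ h1, h1⟩, ha⟩⟩

theorem Dfn0.abs {k : ℕ} {P : Pred k} (h : Dfn0 P) {M : Type 1} {E : M → M → Prop} {S : M → Prop}
    (hS : ∀ x, S x → ∀ y, E y x → S y) (v : Fin k → {x : M // S x}) :
    P _ (indE E S) v ↔ P M E (fun i => (v i).1) := by
  obtain ⟨φ, h0, hφ⟩ := h.out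
  rw [← hφ, ← hφ, delta0_abs hS h0]

end Paper

namespace Paper
open Ordinal Cardinal

/-! ### Semantics over `ZFSet` -/

theorem ordE_iff' {x : ZFSet.{0}} : OrdE zmem x ↔ x.IsOrdinal := by
  rw [ZFSet.isOrdinal_iff_forall_mem_isTransitive]
  rfl

theorem ordE_iff {x : ZFSet.{0}} : OrdE zmem x ↔ ∃ o : Ordinal.{0}, x = o.toZFSet := by
  rw [ordE_iff', ZFSet.isOrdinal_iff_mem_range_toZFSet]
  exact ⟨fun ⟨o, h⟩ => ⟨o, h.symm⟩, fun ⟨o, h⟩ => ⟨o, h.symm⟩⟩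

theorem ordE_toZFSet (o : Ordinal.{0}) : OrdE zmem o.toZFSet := ordE_iff.2 ⟨o, rfl⟩

theorem upair_iff {p a b : ZFSet.{0}} : UPairE zmem p a b ↔ p = {a, b} := by
  unfold UPairE zmem
  rw [ZFSet.ext_iff]
  simp

theorem opair_iff {p a b : ZFSet.{0}} : OPairE zmem p a b ↔ p = ZFSet.pair a b := by
  unfold OPairE
  simp only [upair_iff]
  constructor
  · rintro ⟨s, t, rfl, rfl, rfl⟩
    simp [ZFSet.pair]
  · rintro rfl
    exact ⟨_, _, rfl, rfl, by simp [ZFSet.pair]⟩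

theorem pairMem_iff {f x y : ZFSet.{0}} : PairMemE zmem f x y ↔ ZFSet.pair x y ∈ f := by
  unfold PairMemE
  simp only [opair_iff, zmem]
  exact ⟨fun ⟨p, h, e⟩ => e ▸ h, fun h => ⟨_, h, rfl⟩⟩

/-- Image of a set under an arbitrary function. -/
noncomputable def im (a : ZFSet.{0}) (g : ZFSet.{0} → ZFSet.{0}) : ZFSet.{0} :=
  ZFSet.range (fun x : a => g x.1)

@[simp] theorem mem_im {a : ZFSet.{0}} {g : ZFSet.{0} → ZFSet.{0}} {y : ZFSet.{0}} :
    y ∈ im a g ↔ ∃ x ∈ a, g x = y := by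
  simp [im]

/-- Graph of a function on a set. -/
noncomputable def graph (a : ZFSet.{0}) (g : ZFSet.{0} → ZFSet.{0}) : ZFSet.{0} :=
  im a (fun x => ZFSet.pair x (g x))

@[simp] theorem pair_mem_graph {a : ZFSet.{0}} {g : ZFSet.{0} → ZFSet.{0}} {x y : ZFSet.{0}} :
    ZFSet.pair x y ∈ graph a g ↔ x ∈ a ∧ y = g x := by
  simp only [graph, mem_im, ZFSet.pair_inj]
  exact ⟨fun ⟨x', h, h1, h2⟩ => by subst h1; exact ⟨h, h2.symm⟩,
    fun ⟨h, h1⟩ => ⟨x, h, rfl, h1.symm⟩⟩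

theorem isFunc_graph {a b : ZFSet.{0}} {g : ZFSet.{0} → ZFSet.{0}} (h : ∀ x ∈ a, g x ∈ b) :
    IsFuncE zmem (graph a g) a b := by
  unfold IsFuncE
  simp only [pairMem_iff, opair_iff, pair_mem_graph, zmem]
  refine ⟨fun p hp => ?_, fun x hx => ⟨⟨g x, hx, rfl⟩, fun y y' h h' => h.2.trans h'.2.symm⟩⟩
  simp only [graph, mem_im] at hp
  obtain ⟨x, hx, rfl⟩ := hp
  exact ⟨x, _, hx, h x hx, rfl⟩

theorem surj_card {f a b : ZFSet.{0}} (h : SurjE zmem f a b) : b.card ≤ a.card := by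
  have h1 : ∀ y : b, ∃ x : a, ZFSet.pair x.1 y.1 ∈ f := fun y => by
    obtain ⟨x, hx, hxy⟩ := h.2 y.1 y.2
    exact ⟨⟨x, hx⟩, pairMem_iff.1 hxy⟩
  choose g hg using h1
  have hinj : Function.Injective g := by
    intro y y' e
    have h1 := hg y
    have h2 := hg y'
    rw [← e] at h2
    exact Subtype.ext ((h.1.2 _ (g y).2).2 _ _ (pairMem_iff.2 h1) (pairMem_iff.2 h2))
  have := Cardinal.mk_le_of_injective hinj
  simpa [ZFSet.cardinalMk_coe_sort] using this

theorem inj_card {f a b : ZFSet.{0}} (h : InjE zmem f a b) : a.card ≤ b.card := by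
  have h1 : ∀ x : a, ∃ y : b, ZFSet.pair x.1 y.1 ∈ f := fun x => by
    obtain ⟨y, hy⟩ := (h.1.2 x.1 x.2).1
    obtain ⟨p, hp, ho⟩ := hy
    obtain ⟨x', y', hx', hy', ho'⟩ := h.1.1 p hp
    rw [opair_iff] at ho ho'
    have := ho.symm.trans ho'
    rw [ZFSet.pair_inj] at this
    refine ⟨⟨y, this.2 ▸ hy'⟩, ?_⟩
    rw [← ho]; exact hp
  choose g hg using h1
  have hinj : Function.Injective g := by
    intro y y' e
    have h1 := hg y
    have h2 := hg y'
    rw [← e] at h2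
    exact Subtype.ext (h.2 _ _ _ y.2 y'.2 (pairMem_iff.2 h1) (pairMem_iff.2 h2))
  have := Cardinal.mk_le_of_injective hinj
  simpa [ZFSet.cardinalMk_coe_sort] using this

theorem bij_card {f a b : ZFSet.{0}} (h : BijE zmem f a b) : a.card = b.card :=
  le_antisymm (inj_card h.2) (surj_card h.1)

theorem exists_bij {a b : ZFSet.{0}} (h : a.card = b.card) : ∃ f, BijE zmem f a b := by
  have h' : #a = #b := by simp [ZFSet.cardinalMk_coe_sort, h]
  obtain ⟨e⟩ := Cardinal.eq.1 h'
  classical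
  let g : ZFSet.{0} → ZFSet.{0} := fun x => if hx : x ∈ a then (e ⟨x, hx⟩).1 else ∅
  have hg : ∀ x (hx : x ∈ a), g x = (e ⟨x, hx⟩).1 := fun x hx => by simp [g, hx]
  have hf : IsFuncE zmem (graph a g) a b := isFunc_graph fun x hx => by
    rw [hg x hx]; exact (e ⟨x, hx⟩).2
  refine ⟨graph a g, ⟨hf, fun y hy => ?_⟩, hf, fun x x' y hx hx' h1 h2 => ?_⟩
  · refine ⟨(e.symm ⟨y, hy⟩).1, (e.symm ⟨y, hy⟩).2, ?_⟩
    rw [pairMem_iff, pair_mem_graph]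
    refine ⟨(e.symm ⟨y, hy⟩).2, ?_⟩
    rw [hg _ (e.symm ⟨y, hy⟩).2]
    simp
  · rw [pairMem_iff, pair_mem_graph] at h1 h2
    have h3 := h1.2.symm.trans h2.2
    rw [hg _ hx, hg _ hx'] at h3
    exact congrArg Subtype.val (e.injective (Subtype.ext h3))

theorem cardE_iff {o : Ordinal.{0}} : CardE zmem o.toZFSet ↔ o.card.ord = o := by
  constructor
  · rintro ⟨_, h⟩
    by_contra hne
    have hlt : o.card.ord < o := lt_of_le_of_ne (Cardinal.ord_card_le o) hne
    refine h o.card.ord.toZFSet (Ordinal.toZFSet_mem_toZFSet_iff.2 hlt) (exists_bij ?_)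
    simp
  · intro h
    refine ⟨ordE_toZFSet o, fun α hα => ?_⟩
    obtain ⟨a, ha, rfl⟩ := Ordinal.mem_toZFSet_iff.1 hα
    rintro ⟨f, hf⟩
    have := bij_card hf
    rw [Ordinal.card_toZFSet, Ordinal.card_toZFSet] at this
    rw [← h, ← this] at ha
    exact absurd ha (not_lt.2 (Cardinal.ord_card_le a))

theorem exists_surj_ord (b : ZFSet.{0}) : ∃ f, SurjE zmem f b.card.ord.toZFSet b := by
  obtain ⟨f, hf⟩ := exists_bij (a := b.card.ord.toZFSet) (b := b) (by simp)
  exact ⟨f, hf.1⟩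

theorem hmem_iff {x : ZFSet.{0}} {o : Ordinal.{0}} (ho : o.card.ord = o) :
    HMemE zmem x o.toZFSet ↔ ∃ t : ZFSet.{0}, t.IsTransitive ∧ x ⊆ t ∧ t.card < o.card := by
  constructor
  · rintro ⟨t, h1, h2, β, f, hβ, hf⟩
    obtain ⟨b, hb, rfl⟩ := Ordinal.mem_toZFSet_iff.1 hβ
    refine ⟨t, h1, h2, (surj_card hf).trans_lt ?_⟩
    rw [Ordinal.card_toZFSet]
    rw [← ho] at hb
    exact Cardinal.lt_ord.1 hb
  · rintro ⟨t, h1, h2, h3⟩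
    obtain ⟨f, hf⟩ := exists_surj_ord t
    refine ⟨t, h1, h2, _, f, ?_, hf⟩
    refine Ordinal.toZFSet_mem_toZFSet_iff.2 ?_
    rw [← ho]
    exact Cardinal.ord_lt_ord.2 h3

end Paper

namespace Paper
open Ordinal Cardinal
open scoped ZFSet

/-! ### The cumulative hierarchy -/

/-- Successor-closed ordinals (limit or zero). -/
def SC (l : Ordinal.{0}) : Prop := ∀ a < l, Order.succ a < l

theorem rank_pair_lt {l : Ordinal.{0}} (hl : SC l) {x y : ZFSet.{0}} (hx : x.rank < l)
    (hy : y.rank < l) : (ZFSet.pair x y).rank < l := by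
  unfold ZFSet.pair
  simp only [ZFSet.rank_pair, ZFSet.rank_singleton]
  have h1 := hl _ hx
  have h2 := hl _ hy
  exact max_lt (hl _ h1) (hl _ (max_lt h1 h2))

theorem pair_rank_left (x y : ZFSet.{0}) : x.rank < (ZFSet.pair x y).rank := by
  unfold ZFSet.pair
  simp only [ZFSet.rank_pair, ZFSet.rank_singleton]
  refine lt_max_of_lt_left ?_
  exact (Order.lt_succ _).trans (Order.lt_succ _)

theorem pair_rank_right (x y : ZFSet.{0}) : y.rank < (ZFSet.pair x y).rank := by
  unfold ZFSet.pair
  simp only [ZFSet.rank_pair, ZFSet.rank_singleton]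
  refine lt_max_of_lt_right ?_
  refine (Order.lt_succ _).trans ((Order.lt_succ_iff).2 (le_max_right _ _))

/-- A class closed under elements and subsets. -/
def SupT (S : ZFSet.{0} → Prop) : Prop := (∀ x, S x → ∀ y, zmem y x → S y) ∧ ∀ x y, S x → y ⊆ x → S y

theorem supT_V (o : Ordinal.{0}) : SupT (fun x => x ∈ V_ o) :=
  ⟨fun _ hx _ hy => (ZFSet.isTransitive_vonNeumann o).mem_trans hy hx,
    fun _ _ hx hy => ZFSet.mem_vonNeumann_of_subset hy hx⟩

theorem ordE_abs {S : ZFSet.{0} → Prop} (hS : ∀ x, S x → ∀ y, zmem y x → S y) (a : {x // S x}) :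
    OrdE (indE zmem S) a ↔ OrdE zmem a.1 :=
  (Dfn0.ordE (k := 1) 0).abs hS ![a]

theorem pairMem_abs {S : ZFSet.{0} → Prop} (hS : ∀ x, S x → ∀ y, zmem y x → S y)
    (a b c : {x // S x}) : PairMemE (indE zmem S) a b c ↔ PairMemE zmem a.1 b.1 c.1 :=
  (Dfn0.pairMemE (k := 3) 0 1 2).abs hS ![a, b, c]

theorem subE_abs {S : ZFSet.{0} → Prop} (hS : ∀ x, S x → ∀ y, zmem y x → S y)
    (a b : {x // S x}) : SubE (indE zmem S) a b ↔ a.1 ⊆ b.1 :=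
  (Dfn0.subE (k := 2) 0 1).abs hS ![a, b]

theorem pairMem_trans {S : ZFSet.{0} → Prop} (hS : ∀ x, S x → ∀ y, zmem y x → S y)
    {f x y : ZFSet.{0}} (hf : S f) (h : PairMemE zmem f x y) : S x ∧ S y := by
  obtain ⟨p, hp, ho⟩ := h
  obtain ⟨t, h1, h2, h3⟩ := opairE_snd ho
  have := hS _ (hS _ hf _ hp) _ h1
  exact ⟨hS _ this _ h2, hS _ this _ h3⟩

theorem vhier_abs {S : ZFSet.{0} → Prop} (hS : SupT S) (f α : {x // S x}) :
    VHierE (indE zmem S) f α ↔ VHierE zmem f.1 α.1 := by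
  unfold VHierE
  rw [ordE_abs hS.1]
  refine and_congr_right fun _ => ?_
  constructor
  · intro h β hβ
    have hβS := hS.1 _ α.2 _ hβ
    obtain ⟨⟨w, hw1, hw2⟩, h2⟩ := h ⟨β, hβS⟩ hβ
    rw [pairMem_abs hS.1] at hw1
    refine ⟨⟨w.1, hw1, fun z => ?_⟩, fun w w' h3 h4 => ?_⟩
    · constructor
      · intro hz
        obtain ⟨γ, h5, u, h6, h7⟩ := (hw2 ⟨z, hS.1 _ w.2 _ hz⟩).1 hz
        rw [pairMem_abs hS.1] at h6
        rw [subE_abs hS.1] at h7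
        exact ⟨γ.1, h5, u.1, h6, h7⟩
      · rintro ⟨γ, h5, u, h6, h7⟩
        have h8 := pairMem_trans hS.1 f.2 h6
        refine (hw2 ⟨z, hS.2 _ _ h8.2 h7⟩).2 ⟨⟨γ, h8.1⟩, h5, ⟨u, h8.2⟩, ?_, ?_⟩
        · rw [pairMem_abs hS.1]; exact h6
        · rw [subE_abs hS.1]; exact h7
    · have := h2 ⟨w, (pairMem_trans hS.1 f.2 h3).2⟩ ⟨w', (pairMem_trans hS.1 f.2 h4).2⟩
        ((pairMem_abs hS.1 _ _ _).2 h3) ((pairMem_abs hS.1 _ _ _).2 h4)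
      exact congrArg Subtype.val this
  · intro h β hβ
    obtain ⟨⟨w, hw1, hw2⟩, h2⟩ := h β.1 hβ
    refine ⟨⟨⟨w, (pairMem_trans hS.1 f.2 hw1).2⟩, (pairMem_abs hS.1 _ _ _).2 hw1, fun z => ?_⟩,
      fun w w' h3 h4 => ?_⟩
    · refine (hw2 z.1).trans ?_
      constructor
      · rintro ⟨γ, h5, u, h6, h7⟩
        have h8 := pairMem_trans hS.1 f.2 h6
        exact ⟨⟨γ, h8.1⟩, h5, ⟨u, h8.2⟩, (pairMem_abs hS.1 _ _ _).2 h6, (subE_abs hS.1 _ _).2 h7⟩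
      · rintro ⟨γ, h5, u, h6, h7⟩
        exact ⟨γ.1, h5, u.1, (pairMem_abs hS.1 _ _ _).1 h6, (subE_abs hS.1 _ _).1 h7⟩
    · exact Subtype.ext (h2 _ _ ((pairMem_abs hS.1 _ _ _).1 h3) ((pairMem_abs hS.1 _ _ _).1 h4))

theorem mem_V_iff {z : ZFSet.{0}} {b : Ordinal.{0}} :
    z ∈ V_ b ↔ ∃ a < b, z ⊆ V_ a := by
  rw [ZFSet.mem_vonNeumann]
  simp only [ZFSet.subset_vonNeumann]
  exact ⟨fun h => ⟨_, h, le_rfl⟩, fun ⟨a, h1, h2⟩ => h2.trans_lt h1⟩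

theorem vhier_val {f : ZFSet.{0}} {o : Ordinal.{0}} (h : VHierE zmem f o.toZFSet) :
    ∀ b < o, ∀ w, PairMemE zmem f b.toZFSet w ↔ w = V_ b := by
  intro b
  induction b using WellFoundedLT.induction with
  | _ b ih =>
    intro hb w
    obtain ⟨⟨w0, h1, h2⟩, h3⟩ := h.2 b.toZFSet (Ordinal.toZFSet_mem_toZFSet_iff.2 hb)
    have hw0 : w0 = V_ b := by
      ext z
      rw [mem_V_iff]
      refine (h2 z).trans ?_
      constructor
      · rintro ⟨γ, hγ, u, hu, hz⟩
        obtain ⟨a, ha, rfl⟩ := Ordinal.mem_toZFSet_iff.1 hγ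
        rw [ih a ha (ha.trans hb)] at hu
        subst hu
        exact ⟨a, ha, hz⟩
      · rintro ⟨a, ha, hz⟩
        exact ⟨a.toZFSet, Ordinal.toZFSet_mem_toZFSet_iff.2 ha, _, (ih a ha (ha.trans hb) _).2 rfl, hz⟩
    subst hw0
    exact ⟨fun h => h3 _ _ h h1, fun h => h ▸ h1⟩

/-- The canonical hierarchy function. -/
noncomputable def hierF (o : Ordinal.{0}) : ZFSet.{0} := graph o.toZFSet (fun β => V_ β.rank)

theorem hierF_spec (o : Ordinal.{0}) : VHierE zmem (hierF o) o.toZFSet := by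
  refine ⟨ordE_toZFSet o, fun β hβ => ?_⟩
  obtain ⟨b, hb, rfl⟩ := Ordinal.mem_toZFSet_iff.1 hβ
  simp only [pairMem_iff, hierF, pair_mem_graph]
  refine ⟨⟨V_ b, ⟨hβ, by simp⟩, fun z => ?_⟩, fun w w' h h' => h.2.trans h'.2.symm⟩
  change z ∈ V_ b ↔ _
  rw [mem_V_iff]
  constructor
  · rintro ⟨a, ha, hz⟩
    exact ⟨a.toZFSet, Ordinal.toZFSet_mem_toZFSet_iff.2 ha, V_ a,
      ⟨Ordinal.toZFSet_mem_toZFSet_iff.2 (ha.trans hb), by simp⟩, hz⟩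
  · rintro ⟨γ, hγ, u, ⟨_, hu⟩, hz⟩
    obtain ⟨a, ha, rfl⟩ := Ordinal.mem_toZFSet_iff.1 hγ
    subst hu
    exact ⟨a, ha, by rw [Ordinal.rank_toZFSet] at hz; exact hz⟩

theorem vmem_iff {x : ZFSet.{0}} {o : Ordinal.{0}} : VMemE zmem x o.toZFSet ↔ x ∈ V_ o := by
  rw [mem_V_iff]
  constructor
  · rintro ⟨_, f, hf, β, u, hβ, hu, hx⟩
    obtain ⟨b, hb, rfl⟩ := Ordinal.mem_toZFSet_iff.1 hβ
    rw [vhier_val hf b hb] at hu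
    subst hu
    exact ⟨b, hb, hx⟩
  · rintro ⟨b, hb, hx⟩
    exact ⟨ordE_toZFSet o, hierF o, hierF_spec o, b.toZFSet, V_ b,
      Ordinal.toZFSet_mem_toZFSet_iff.2 hb, (vhier_val (hierF_spec o) b hb _).2 rfl, hx⟩

theorem hierF_rank {l o : Ordinal.{0}} (hl : SC l) (ho : o < l) : (hierF o).rank < l := by
  have : ∀ a < l, Order.succ (Order.succ a) < l := fun a ha => hl _ (hl _ ha)
  refine lt_of_le_of_lt (b := Order.succ (Order.succ o)) ?_ (this o ho)
  rw [ZFSet.rank_le_iff]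
  intro y hy
  simp only [hierF, graph, mem_im] at hy
  obtain ⟨β, hβ, rfl⟩ := hy
  obtain ⟨b, hb, rfl⟩ := Ordinal.mem_toZFSet_iff.1 hβ
  unfold ZFSet.pair
  simp only [ZFSet.rank_pair, ZFSet.rank_singleton, Ordinal.rank_toZFSet, ZFSet.rank_vonNeumann,
    max_self, Order.succ_lt_succ_iff]
  exact hb

theorem vmem_abs {l : Ordinal.{0}} (hl : SC l) (x α : {x // x ∈ V_ l}) :
    VMemE (indE zmem (fun x => x ∈ V_ l)) x α ↔ VMemE zmem x.1 α.1 := by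
  have hS := supT_V l
  unfold VMemE
  rw [ordE_abs hS.1]
  refine and_congr_right fun ho => ?_
  constructor
  · rintro ⟨f, hf, β, u, h1, h2, h3⟩
    exact ⟨f.1, (vhier_abs hS f α).1 hf, β.1, u.1, h1, (pairMem_abs hS.1 _ _ _).1 h2,
      (subE_abs hS.1 _ _).1 h3⟩
  · rintro ⟨f, hf, β, u, h1, h2, h3⟩
    obtain ⟨o, ho⟩ := ordE_iff.1 ho
    have hlt : o < l := by
      have := α.2
      rw [ho, ZFSet.mem_vonNeumann, Ordinal.rank_toZFSet] at this
      exact this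
    rw [ho] at hf h1
    obtain ⟨b, hb, rfl⟩ := Ordinal.mem_toZFSet_iff.1 h1
    have h2' := (vhier_val (hierF_spec o) b hb u).2 ((vhier_val hf b hb u).1 h2)
    have hfl : hierF o ∈ V_ l := ZFSet.mem_vonNeumann.2 (hierF_rank hl hlt)
    have h8 := pairMem_trans hS.1 hfl h2'
    refine ⟨⟨hierF o, hfl⟩, ?_, ⟨_, h8.1⟩, ⟨u, h8.2⟩, ?_, ?_, ?_⟩
    · rw [vhier_abs hS, ho]; exact hierF_spec o
    · change b.toZFSet ∈ α.1
      rw [ho]; exact h1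
    · rw [pairMem_abs hS.1]; exact h2'
    · rw [subE_abs hS.1]; exact h3

end Paper

namespace Paper
open Ordinal Cardinal
open scoped ZFSet

/-! ### Reflection -/

/-- The membership relation of `V_o`. -/
abbrev vE (o : Ordinal.{0}) : {x // x ∈ V_ o} → {x // x ∈ V_ o} → Prop :=
  indE zmem (fun x => x ∈ V_ o)

theorem realize_iso {M N : Type*} {E : M → M → Prop} {E' : N → N → Prop} (f : M → N)
    (hf : Function.Bijective f) (hE : ∀ a b, E a b ↔ E' (f a) (f b)) {k : ℕ} (φ : SetFormula k) :
    ∀ v : Fin k → M, Realize E φ v ↔ Realize E' φ (fun i => f (v i)) := by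
  induction φ with
  | mem i j => intro v; exact hE _ _
  | eq i j => intro v; exact hf.1.eq_iff.symm
  | fal => intro v; rfl
  | imp φ ψ h1 h2 => intro v; simp [h1, h2]
  | all φ h =>
    intro v
    have key : ∀ a, (fun i => f ((Fin.snoc v a : Fin (_ + 1) → M) i)) =
        (Fin.snoc (fun i => f (v i)) (f a) : Fin (_ + 1) → N) := fun a => by
      funext i
      refine Fin.lastCases ?_ (fun i => ?_) i <;> simp
    simp only [realize_all, h, key]
    exact ⟨fun H b => by obtain ⟨a, rfl⟩ := hf.2 b; exact H a, fun H a => H _⟩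

theorem realizeIn_true {M : Type*} {E : M → M → Prop} {k : ℕ} {φ : SetFormula k} {v : Fin k → M} :
    RealizeIn E (fun _ => True) φ v ↔ Realize E φ v := by
  unfold RealizeIn
  have := realize_iso (E := fun a b : {x : M // True} => E a.1 b.1) (E' := E) Subtype.val
    ⟨Subtype.val_injective, fun b => ⟨⟨b, trivial⟩, rfl⟩⟩ (fun _ _ => Iff.rfl) φ
  constructor
  · rintro ⟨h, h'⟩
    exact (this _).1 h'
  · intro h
    exact ⟨fun _ => trivial, (this _).2 h⟩

theorem realizeIn_congr {M : Type*} {E : M → M → Prop} {S T : M → Prop} (h : ∀ x, S x ↔ T x)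
    {k : ℕ} {φ : SetFormula k} {v : Fin k → M} : RealizeIn E S φ v ↔ RealizeIn E T φ v := by
  have : S = T := funext fun x => propext (h x)
  rw [this]

/-- Full elementarity of `V_θ`. -/
def FullV (θ : Ordinal.{0}) : Prop := ∀ ⦃k : ℕ⦄ (φ : SetFormula k) (v : Fin k → {x // x ∈ V_ θ}),
  Realize (vE θ) φ v ↔ Realize zmem φ (fun i => (v i).1)

/-- `Σₙ`-elementarity of `V_θ`. -/
def CV (n : ℕ) (θ : Ordinal.{0}) : Prop :=
  ∀ ⦃k : ℕ⦄ (φ : SetFormula k), IsSigma n φ → ∀ (v : Fin k → {x // x ∈ V_ θ}),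
  Realize (vE θ) φ v ↔ Realize zmem φ (fun i => (v i).1)

theorem FullV.cv {θ : Ordinal.{0}} (h : FullV θ) (n : ℕ) : CV n θ := fun _ φ _ v => h φ v

theorem cnE_iff {n : ℕ} {θ : Ordinal.{0}} : CnE zmem n θ.toZFSet ↔ CV n θ := by
  unfold CnE SigmaElemPairE
  constructor
  · rintro ⟨_, _, h⟩ k φ hφ v
    have := h φ hφ (fun i => (v i).1) (fun i => vmem_iff.2 (v i).2)
    rw [realizeIn_true, realizeIn_congr fun x => vmem_iff] at this
    rw [← this]
    exact ⟨fun h => ⟨fun i => (v i).2, h⟩, fun ⟨_, h⟩ => h⟩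
  · intro h
    refine ⟨ordE_toZFSet θ, fun _ _ => trivial, fun k φ hφ v hv => ?_⟩
    rw [realizeIn_true, realizeIn_congr fun x => vmem_iff]
    have := h φ hφ (fun i => ⟨v i, vmem_iff.1 (hv i)⟩)
    rw [← this]
    exact ⟨fun ⟨_, h⟩ => h, fun h => ⟨fun i => vmem_iff.1 (hv i), h⟩⟩

open Classical in
/-- Rank of a witness. -/
noncomputable def wit {k : ℕ} (φ : SetFormula (k + 1)) (v : Fin k → ZFSet.{0}) : Ordinal.{0} :=
  if h : ∃ a, Realize zmem φ (Fin.snoc v a) then (Classical.choose h).rank else 0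

theorem wit_spec {k : ℕ} {φ : SetFormula (k + 1)} {v : Fin k → ZFSet.{0}}
    (h : ∃ a, Realize zmem φ (Fin.snoc v a)) :
    ∃ a, Realize zmem φ (Fin.snoc v a) ∧ a.rank = wit φ v := by
  refine ⟨Classical.choose h, Classical.choose_spec h, ?_⟩
  simp [wit, h]

/-- One step of the Skolem closure. -/
noncomputable def stepF (o : Ordinal.{0}) : Ordinal.{0} :=
  max (⨆ t : (Σ k : ℕ, SetFormula (k + 1) × (Fin k → (V_ o : ZFSet.{0}))),
    Order.succ (wit t.2.1 (fun i => (t.2.2 i).1))) (Order.succ o.card).ord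

theorem lt_stepF (o : Ordinal.{0}) : o < stepF o :=
  lt_max_of_lt_right (Cardinal.lt_ord.2 (Order.lt_succ _))

theorem wit_lt_stepF {o : Ordinal.{0}} {k : ℕ} (φ : SetFormula (k + 1)) (v : Fin k → ZFSet.{0})
    (hv : ∀ i, v i ∈ V_ o) : wit φ v < stepF o := by
  refine lt_max_of_lt_left ((Order.lt_succ _).trans_le ?_)
  exact le_ciSup (f := fun t : (Σ k : ℕ, SetFormula (k + 1) × (Fin k → (V_ o : ZFSet.{0}))) =>
    Order.succ (wit t.2.1 (fun i => (t.2.2 i).1))) (Ordinal.bddAbove_of_small)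
    ⟨k, φ, fun i => ⟨v i, hv i⟩⟩

/-- Iterated Skolem closure. -/
noncomputable def iterF (o : Ordinal.{0}) (m : ℕ) : Ordinal.{0} := stepF^[m] (Order.succ o)

theorem iterF_succ (o : Ordinal.{0}) (m : ℕ) : iterF o (m + 1) = stepF (iterF o m) :=
  Function.iterate_succ_apply' _ _ _

theorem iterF_mono (o : Ordinal.{0}) : StrictMono (iterF o) :=
  strictMono_nat_of_lt_succ fun m => by rw [iterF_succ]; exact lt_stepF _

theorem reflection (o : Ordinal.{0}) :
    ∃ θ : Ordinal.{0}, o < θ ∧ θ.card.ord = θ ∧ SC θ ∧ FullV θ := by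
  set θ : Ordinal.{0} := ⨆ m, iterF o m with hθ
  have hle : ∀ m, iterF o m ≤ θ := fun m => le_ciSup (Ordinal.bddAbove_of_small) m
  have hlt : ∀ m, iterF o m < θ := fun m => ((iterF_mono o) (Nat.lt_succ_self m)).trans_le (hle _)
  have hex : ∀ a < θ, ∃ m, a < iterF o m := fun a ha => (Ordinal.lt_iSup_iff).1 ha
  refine ⟨θ, (Order.lt_succ o).trans_le (hle 0), ?_, ?_, ?_⟩
  · by_contra hne
    have hlt' : θ.card.ord < θ := lt_of_le_of_ne (Cardinal.ord_card_le θ) hne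
    obtain ⟨m, hm⟩ := hex _ hlt'
    have h1 : θ.card ≤ (iterF o m).card := by
      have := Ordinal.card_le_card hm.le
      rwa [Cardinal.card_ord] at this
    have h2 : (Order.succ (iterF o m).card) ≤ θ.card := by
      have := Ordinal.card_le_card (show (Order.succ (iterF o m).card).ord ≤ θ from
        le_trans (by rw [iterF_succ]; exact le_max_right _ _) (hle (m + 1)))
      rwa [Cardinal.card_ord] at this
    exact absurd ((Order.lt_succ _).trans_le (h2.trans h1)) (lt_irrefl _)
  · intro a ha
    obtain ⟨m, hm⟩ := hex a ha
    exact (Order.succ_le_of_lt hm).trans_lt (hlt m)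
  · intro k φ
    induction φ with
    | mem i j => intro v; rfl
    | eq i j => intro v; exact Subtype.ext_iff
    | fal => intro v; rfl
    | imp φ ψ h1 h2 => intro v; simp [h1, h2]
    | @all k φ h =>
      intro v
      simp only [realize_all, h, snoc_val]
      refine ⟨fun H a => ?_, fun H a => H a.1⟩
      by_contra hn
      have hv : ∃ m, ∀ i, (v i).1 ∈ V_ (iterF o m) := by
        have : ∀ i, ∃ m, (v i).1.rank < iterF o m := fun i =>
          hex _ (ZFSet.mem_vonNeumann.1 (v i).2)
        choose g hg using this
        refine ⟨Finset.univ.sup g, fun i => ZFSet.mem_vonNeumann.2 ((hg i).trans_le ?_)⟩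
        exact (iterF_mono o).monotone (Finset.le_sup (Finset.mem_univ i))
      obtain ⟨m, hm⟩ := hv
      obtain ⟨b, hb, hr⟩ := wit_spec (φ := φ.not) (v := fun i => (v i).1)
        ⟨a, by rw [realize_not]; exact hn⟩
      have hlt2 := wit_lt_stepF φ.not (fun i => (v i).1) hm
      rw [← iterF_succ, ← hr] at hlt2
      rw [realize_not] at hb
      exact hb (H ⟨b, ZFSet.mem_vonNeumann.2 (hlt2.trans (hlt _))⟩)

/-! ### Consequences of `Σ₁`-correctness -/

theorem CV.sc {n : ℕ} (hn : 0 < n) {θ : Ordinal.{0}} (h : CV n θ) : SC θ := by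
  intro a ha
  obtain ⟨n, rfl⟩ : ∃ m, n = m + 1 := ⟨n - 1, by omega⟩
  have haV : a.toZFSet ∈ V_ θ := by rw [ZFSet.mem_vonNeumann, Ordinal.rank_toZFSet]; exact ha
  have := (h (k := 1) (SetFormula.ex (.mem 0 1)) (.ex (.ofDelta0 (.mem 0 1)))
    (fun _ => ⟨a.toZFSet, haV⟩)).2 (by
      rw [realize_ex]
      refine ⟨{a.toZFSet}, ?_⟩
      change a.toZFSet ∈ ({a.toZFSet} : ZFSet.{0})
      simp)
  rw [realize_ex] at this
  obtain ⟨y, hy⟩ := this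
  have hy' : a.toZFSet ∈ y.1 := hy
  have h1 := ZFSet.rank_lt_of_mem hy'
  rw [Ordinal.rank_toZFSet] at h1
  exact (Order.succ_le_of_lt h1).trans_lt (ZFSet.mem_vonNeumann.1 y.2)

theorem rank_card_le {t : ZFSet.{0}} (ht : t.IsTransitive) : t.rank.card ≤ t.card := by
  have key : ∀ y : ZFSet.{0}, y ∈ t → ∀ a ≤ y.rank, ∃ z ∈ t, z.rank = a := by
    intro y
    induction y using ZFSet.inductionOn with
    | _ y ih =>
      intro hy a ha
      rcases ha.eq_or_lt with rfl | ha
      · exact ⟨y, hy, rfl⟩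
      · obtain ⟨z, hz, hza⟩ := ZFSet.lt_rank_iff.1 ha
        exact ih z hz (ht.mem_trans hz hy) a hza
  have hsub : t.rank.toZFSet ⊆ ZFSet.range (fun x : t => x.1.rank.toZFSet) := by
    intro x hx
    obtain ⟨a, ha, rfl⟩ := Ordinal.mem_toZFSet_iff.1 hx
    obtain ⟨y, hy, hya⟩ := ZFSet.lt_rank_iff.1 ha
    obtain ⟨z, hz, rfl⟩ := key y hy a hya
    exact ZFSet.mem_range.2 ⟨⟨z, hz⟩, rfl⟩
  have h1 := ZFSet.card_mono hsub
  rw [Ordinal.card_toZFSet] at h1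
  refine h1.trans ?_
  have := ZFSet.lift_card_range_le (f := fun x : t => x.1.rank.toZFSet)
  rw [ZFSet.cardinalMk_coe_sort] at this
  simpa using this

theorem surjE_abs {S : ZFSet.{0} → Prop} (hS : ∀ x, S x → ∀ y, zmem y x → S y)
    (a b c : {x // S x}) : SurjE (indE zmem S) a b c ↔ SurjE zmem a.1 b.1 c.1 :=
  (Dfn0.surjE (k := 3) 0 1 2).abs hS ![a, b, c]

theorem CV.hmem {n : ℕ} (hn : 0 < n) {θ : Ordinal.{0}} (h : CV n θ) (hc : θ.card.ord = θ)
    {x : ZFSet.{0}} : HMemE zmem x θ.toZFSet ↔ x ∈ V_ θ := by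
  constructor
  · intro hx
    obtain ⟨t, h1, h2, h3⟩ := (hmem_iff hc).1 hx
    rw [ZFSet.mem_vonNeumann]
    refine (ZFSet.rank_mono h2).trans_lt ?_
    have := (rank_card_le h1).trans_lt h3
    rw [← hc]
    exact Cardinal.lt_ord.2 this
  · intro hx
    obtain ⟨n, rfl⟩ : ∃ m, n = m + 1 := ⟨n - 1, by omega⟩
    have hd : Dfn0 (k := 4) (fun _ E v => TransE E (v 1) ∧ SubE E (v 0) (v 1) ∧ OrdE E (v 2) ∧
      SurjE E (v 3) (v 2) (v 1)) := inferInstance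
    obtain ⟨φ, h0, hφ⟩ := hd.out
    have key := (h (k := 1) φ.ex.ex.ex (.ex (.ex (.ex (.ofDelta0 h0)))) (fun _ => ⟨x, hx⟩)).2 (by
      simp only [realize_ex, hφ]
      obtain ⟨f, hf⟩ := exists_surj_ord (V_ x.rank)
      exact ⟨V_ x.rank, _, f, ZFSet.isTransitive_vonNeumann _, ZFSet.subset_vonNeumann_self x,
        ordE_toZFSet _, hf⟩)
    simp only [realize_ex, hφ] at key
    obtain ⟨t, β, f, h1, h2, h3, h4⟩ := key
    have hS := (supT_V θ).1
    have h1' : TransE zmem t.1 := ((Dfn0.transE (k := 1) 0).abs hS ![t]).1 h1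
    have h2' : SubE zmem x t.1 := (subE_abs hS ⟨x, hx⟩ t).1 h2
    have h3' : OrdE zmem β.1 := (ordE_abs hS β).1 h3
    have h4' : SurjE zmem f.1 β.1 t.1 := (surjE_abs hS f β t).1 h4
    refine ⟨t.1, h1', h2', β.1, f.1, ?_, h4'⟩
    obtain ⟨b, hb⟩ := ordE_iff.1 h3'
    have := β.2
    rw [hb, ZFSet.mem_vonNeumann, Ordinal.rank_toZFSet] at this
    rw [hb]
    exact Ordinal.toZFSet_mem_toZFSet_iff.2 this

theorem CV.up {n : ℕ} {θ : Ordinal.{0}} (hC : CV n θ) : ∀ {k : ℕ} {φ : SetFormula k},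
    IsSigma (n + 1) φ → ∀ v : Fin k → {x // x ∈ V_ θ}, Realize (vE θ) φ v →
      Realize zmem φ (fun i => (v i).1)
  | _, _, .ofDelta0 h, v, hv => (delta0_abs (supT_V θ).1 h v).1 hv
  | _, φ, .ofPi h, v, hv => by
    obtain ⟨ψ, h1, h2⟩ := neg_pi h
    have := hC ψ h1 v
    rw [h2, h2] at this
    by_contra hn
    exact this.2 hn hv
  | _, _, .ex h, v, hv => by
    rw [realize_ex] at hv ⊢
    obtain ⟨a, ha⟩ := hv
    have := CV.up hC h _ ha
    rw [snoc_val] at this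
    exact ⟨a.1, this⟩

end Paper

namespace Paper
open Ordinal Cardinal
open scoped ZFSet

/-! ### Shrewdness, semantically -/

/-- Shrewdness restated with ordinals and initial segments `V_θ`. -/
def ShrewdO (n : ℕ) (k : Ordinal.{0}) : Prop :=
  ∀ P : Pred 2, Dfn P → ∀ θ : Ordinal.{0}, θ.card.ord = θ → CV n θ → k < θ →
    ∀ z K : {x // x ∈ V_ θ}, z.1 ⊆ k.toZFSet → K.1 = k.toZFSet → P _ (vE θ) ![z, K] →
    ∃ (k' θ' : Ordinal.{0}) (z' K' : {x // x ∈ V_ θ'}), k' < k ∧ k' < θ' ∧ k'.card.ord = k' ∧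
      θ'.card.ord = θ' ∧ CV n θ' ∧ K'.1 = k'.toZFSet ∧
      (∀ x, x ∈ z'.1 ↔ x ∈ z.1 ∧ x ∈ k'.toZFSet) ∧ P _ (vE θ') ![z', K']

theorem vec2_val {S : ZFSet.{0} → Prop} (a b : {x // S x}) :
    (fun i => ((![a, b] : Fin 2 → {x // S x}) i).1) = ![a.1, b.1] := by
  funext i; fin_cases i <;> rfl

theorem vec2_mk {S : ZFSet.{0} → Prop} {a b : ZFSet.{0}} (h : ∀ i, S ((![a, b] : Fin 2 → ZFSet.{0}) i)) :
    (fun i => (⟨(![a, b] : Fin 2 → ZFSet.{0}) i, h i⟩ : {x // S x})) = ![⟨a, h 0⟩, ⟨b, h 1⟩] := by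
  funext i; fin_cases i <;> rfl

theorem shrewd_use {n : ℕ} (hn : 0 < n) {κ : ZFSet.{0}} (h1 : CnWeaklyShrewdE zmem n κ) :
    ∃ k : Ordinal.{0}, κ = k.toZFSet ∧ k.card.ord = k ∧ ShrewdO n k := by
  obtain ⟨hc, h⟩ := h1
  obtain ⟨k, rfl⟩ := ordE_iff.1 hc.1
  refine ⟨k, rfl, cardE_iff.1 hc, ?_⟩
  intro P hP θ hθ hC hk z K hz hK hPz
  obtain ⟨φ, hφ⟩ := hP.out
  obtain ⟨κ', θ', z', h1, h2, h3, h4, h5, h6, h7⟩ := h φ θ.toZFSet z.1 (cardE_iff.2 hθ) (cnE_iff.2 hC)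
    (Ordinal.toZFSet_mem_toZFSet_iff.2 hk) hz (by
      rw [realizeIn_congr fun x => hC.hmem hn hθ]
      refine ⟨?_, ?_⟩
      · rw [← hK]
        intro i; fin_cases i
        exacts [z.2, K.2]
      · rw [hφ, vec2_mk]
        convert hPz using 2
        simp [← hK])
  obtain ⟨k', hk', rfl⟩ := Ordinal.mem_toZFSet_iff.1 h5
  obtain ⟨t', rfl⟩ := ordE_iff.1 h2.1
  rw [cardE_iff] at h1 h2
  rw [cnE_iff] at h3
  rw [realizeIn_congr fun x => h3.hmem hn h2] at h7
  obtain ⟨h8, h9⟩ := h7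
  rw [hφ, vec2_mk] at h9
  exact ⟨k', t', ⟨z', h8 0⟩, ⟨k'.toZFSet, h8 1⟩, hk', Ordinal.toZFSet_mem_toZFSet_iff.1 h4, h1, h2, h3, rfl, h6, h9⟩

theorem mem_V_toZFSet {a o : Ordinal.{0}} : a.toZFSet ∈ V_ o ↔ a < o := by
  rw [ZFSet.mem_vonNeumann, Ordinal.rank_toZFSet]

theorem ShrewdO.limit {n : ℕ} {k : Ordinal.{0}} (h : ShrewdO n k) : 0 < k ∧ SC k := by
  obtain ⟨θ, h1, h2, h3, h4⟩ := reflection k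
  constructor
  · obtain ⟨k', -, -, -, hk', -⟩ := h (fun _ _ _ => True) inferInstance θ h2 (h4.cv n) h1
      ⟨k.toZFSet, mem_V_toZFSet.2 h1⟩ ⟨k.toZFSet, mem_V_toZFSet.2 h1⟩ (fun _ h => h) rfl trivial
    exact zero_le.trans_lt hk'
  · intro a ha
    by_contra hn
    have hk : k = Order.succ a := le_antisymm (not_lt.1 hn) (Order.succ_le_of_lt ha)
    have hsub : ({a.toZFSet} : ZFSet.{0}) ⊆ k.toZFSet := by
      intro x hx
      rw [ZFSet.mem_singleton] at hx
      rw [hx]; exact Ordinal.toZFSet_mem_toZFSet_iff.2 ha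
    have hS : ({a.toZFSet} : ZFSet.{0}) ∈ V_ θ :=
      ZFSet.mem_vonNeumann_of_subset hsub (mem_V_toZFSet.2 h1)
    obtain ⟨k', θ', z', K', hk', -, -, -, -, hK', hz', y, hy⟩ :=
      h (fun _ E v => ∃ y, E y (v 0)) inferInstance θ h2 (h4.cv n) h1
      ⟨_, hS⟩ ⟨k.toZFSet, mem_V_toZFSet.2 h1⟩ hsub rfl
      ⟨⟨a.toZFSet, mem_V_toZFSet.2 (ha.trans h1)⟩, by
        change a.toZFSet ∈ ({a.toZFSet} : ZFSet.{0}); simp⟩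
    have := (hz' y.1).1 hy
    rw [ZFSet.mem_singleton] at this
    rw [this.1, Ordinal.toZFSet_mem_toZFSet_iff] at this
    have h5 := Order.succ_le_of_lt this.2
    rw [← hk] at h5
    exact absurd hk' (not_lt.2 h5)

theorem aleph0_le_of_sc {k : Ordinal.{0}} (h0 : 0 < k) (h : SC k) : Cardinal.aleph0 ≤ k.card := by
  rw [← Cardinal.ord_le, Cardinal.ord_aleph0]
  by_contra hn
  obtain ⟨m, rfl⟩ := Ordinal.lt_omega0.1 (not_le.1 hn)
  have : ∀ j : ℕ, (j : Ordinal.{0}) < m := by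
    intro j
    induction j with
    | zero => simpa using h0
    | succ j ih => 
      have := h _ ih
      rwa [Order.succ_eq_add_one] at this
  exact lt_irrefl _ (this m)

/-! ### Reduction to a single parameter -/

theorem hmem_pair {k : Ordinal.{0}} (hk : k.card.ord = k) (hi : Cardinal.aleph0 ≤ k.card)
    {x y : ZFSet.{0}} (hx : HMemE zmem x k.toZFSet) (hy : HMemE zmem y k.toZFSet) :
    HMemE zmem (ZFSet.pair x y) k.toZFSet := by
  rw [hmem_iff hk] at *
  obtain ⟨s, h1, h2, h3⟩ := hx
  obtain ⟨t, g1, g2, g3⟩ := hy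
  have hu := h1.union g1
  have hins : ∀ T w : ZFSet.{0}, T.IsTransitive → w ⊆ T → (insert w T).IsTransitive := by
    intro T w hT hw a ha
    rw [ZFSet.mem_insert_iff] at ha
    intro b hb
    rw [ZFSet.mem_insert_iff]
    rcases ha with rfl | ha
    · exact Or.inr (hw hb)
    · exact Or.inr (hT.mem_trans hb ha)
  have hcard : ∀ T w : ZFSet.{0}, T.card < k.card → (insert w T).card < k.card := fun T w hT =>
    ZFSet.card_insert_le.trans_lt (Cardinal.add_lt_of_lt hi hT (Cardinal.one_lt_aleph0.trans_le hi))
  have hc0 : (s ∪ t).card < k.card :=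
    ZFSet.card_union_le.trans_lt (Cardinal.add_lt_of_lt hi h3 g3)
  refine ⟨insert {x} (insert {x, y} (insert x (insert y (s ∪ t)))), ?_, ?_, ?_⟩
  · refine hins _ _ (hins _ _ (hins _ _ (hins _ _ hu ?_) ?_) ?_) ?_
    · intro z hz; rw [ZFSet.mem_union]; exact Or.inr (g2 hz)
    · intro z hz; simp only [ZFSet.mem_insert_iff, ZFSet.mem_union]; exact Or.inr (Or.inl (h2 hz))
    · intro z hz; simp only [ZFSet.mem_insert_iff, ZFSet.mem_singleton] at hz ⊢; tauto
    · intro z hz; simp only [ZFSet.mem_insert_iff, ZFSet.mem_singleton] at hz ⊢; tauto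
  · intro z hz
    simp only [ZFSet.pair, ZFSet.mem_insert_iff, ZFSet.mem_singleton] at hz ⊢; tauto
  · exact hcard _ _ (hcard _ _ (hcard _ _ (hcard _ _ hc0)))

theorem sigma_one_param_aux {m : ℕ} {H : ZFSet.{0} → Prop}
    (hH : ∀ x y, H x → H y → H (ZFSet.pair x y)) : ∀ (k : ℕ) (φ : SetFormula (k + 2)),
    IsSigma (m + 1) φ → ∀ (x : ZFSet.{0}) (p : Fin k → ZFSet.{0}), H x → (∀ i, H (p i)) →
    ∃ (ψ : SetFormula 2) (q : ZFSet.{0}), IsSigma (m + 1) ψ ∧ H q ∧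
      ∀ d, Realize zmem φ (Fin.cons d (Fin.cons x p)) ↔ Realize zmem ψ ![d, q]
  | 0, φ, hφ, x, p, hx, _ => ⟨φ, x, hφ, hx, fun d => by
      have : (Fin.cons d (Fin.cons x p) : Fin 2 → ZFSet.{0}) = ![d, x] := by
        funext i; fin_cases i <;> rfl
      rw [this]⟩
  | k + 1, φ, hφ, x, p, hx, hp => by
    -- variables of the new formula: `d, q, p'`, then `x, y`
    have hd : Dfn0 (k := k + 2 + 2) (fun _ E v => OPairE E (v ((1 : Fin (k + 2)).castSucc.castSucc))
      (v (Fin.last (k + 2)).castSucc) (v (Fin.last (k + 3)))) := inferInstance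
    obtain ⟨D, hD0, hD⟩ := hd.out
    let σ : Fin (k + 3) → Fin (k + 4) := Fin.cons (0 : Fin (k + 2)).castSucc.castSucc
      (Fin.cons (Fin.last (k + 2)).castSucc (Fin.cons (Fin.last (k + 3))
        (fun i : Fin k => i.succ.succ.castSucc.castSucc)))
    obtain ⟨ψ, hψ, hψ'⟩ := and_sigma (ren_sigma hφ σ) hD0
    obtain ⟨χ, q, h1, h2, h3⟩ := sigma_one_param_aux hH k ψ.ex.ex (.ex (.ex hψ))
      (ZFSet.pair x (p 0)) (fun i => p i.succ) (hH _ _ hx (hp 0)) (fun i => hp _)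
    refine ⟨χ, q, h1, h2, fun d => ?_⟩
    rw [← h3]
    have key : ∀ a b : ZFSet.{0}, (fun i => (Fin.snoc (Fin.snoc (Fin.cons d (Fin.cons (ZFSet.pair x (p 0))
        (fun i => p i.succ)) : Fin (k + 2) → ZFSet.{0}) a : Fin (k + 3) → ZFSet.{0}) b :
          Fin (k + 4) → ZFSet.{0}) (σ i)) =
        (Fin.cons d (Fin.cons a (Fin.cons b fun i => p i.succ)) : Fin (k + 3) → ZFSet.{0}) := by
      intro a b
      funext i
      refine Fin.cases ?_ (fun i => ?_) i
      · simp only [σ, Fin.cons_zero, Fin.snoc_castSucc]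
      refine Fin.cases ?_ (fun i => ?_) i
      · simp only [σ, Fin.cons_zero, Fin.cons_succ, Fin.snoc_castSucc, Fin.snoc_last]
      refine Fin.cases ?_ (fun i => ?_) i
      · simp only [σ, Fin.cons_zero, Fin.cons_succ, Fin.snoc_last]
      · simp only [σ, Fin.cons_succ, Fin.snoc_castSucc]
    have e1 : (Fin.cons d (Fin.cons (ZFSet.pair x (p 0)) fun i => p i.succ) :
      Fin (k + 2) → ZFSet.{0}) 1 = ZFSet.pair x (p 0) := rfl
    have e2 : (Fin.cons d (Fin.cons x (Fin.cons (p 0) fun i => p i.succ)) : Fin (k + 3) → ZFSet.{0}) =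
      Fin.cons d (Fin.cons x p) := by
      have : (Fin.cons (p 0) (fun i => p i.succ) : Fin (k + 1) → ZFSet.{0}) = p :=
        Fin.cons_self_tail p
      rw [this]
    simp only [realize_ex, hψ', realize_ren, key, hD, Fin.snoc_castSucc, Fin.snoc_last, e1, opair_iff,
      ZFSet.pair_inj]
    constructor
    · intro h
      exact ⟨x, p 0, e2 ▸ h, rfl, rfl⟩
    · rintro ⟨a, b, h, rfl, rfl⟩
      exact e2 ▸ h

theorem sigma_one_param {m : ℕ} {H : ZFSet.{0} → Prop} (h0 : ∃ x, H x)
    (hH : ∀ x y, H x → H y → H (ZFSet.pair x y)) {ε : ZFSet.{0}}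
    (h : SigmaDefinableSingleton (m + 1) ε H) :
    ∃ (ψ : SetFormula 2) (q : ZFSet.{0}), IsSigma (m + 1) ψ ∧ H q ∧
      ∀ d, Realize zmem ψ ![d, q] ↔ d = ε := by
  obtain ⟨k, φ, p, h1, h2, h3, h4⟩ := h
  obtain ⟨x0, hx0⟩ := h0
  let σ : Fin (k + 1) → Fin (k + 2) := Fin.cons 0 (fun i => i.succ.succ)
  obtain ⟨ψ, q, g1, g2, g3⟩ := sigma_one_param_aux hH k (ren σ φ) (ren_sigma h1 σ) x0 p hx0 h2
  refine ⟨ψ, q, g1, g2, fun d => ?_⟩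
  rw [← g3, realize_ren]
  have : (fun i => (Fin.cons d (Fin.cons x0 p) : Fin (k + 2) → ZFSet.{0}) (σ i)) = Fin.cons d p := by
    funext i
    refine Fin.cases ?_ (fun i => ?_) i <;> simp [σ]
  rw [this]
  exact ⟨h4 d, fun h => h ▸ h3⟩

end Paper

namespace Paper
open Ordinal Cardinal
open scoped ZFSet

/-! ### Coding elements of `H(κ)` by subsets of `κ` -/

section
variable {M : Type*} (E : M → M → Prop)

/-- `⟨⟨a, b⟩, y⟩ ∈ H`. -/
def TripE (H a b y : M) : Prop :=
  ∃ p, E p H ∧ ∃ s, E s p ∧ ∃ q, E q s ∧ (OPairE E q a b ∧ OPairE E p q y)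

/-- Domain of the pairing function. -/
def DomE (β a b : M) : Prop := (E a β ∧ E b β) ∨ a = β

/-- Lexicographical order. -/
def LexE (s t a b : M) : Prop := E s a ∨ (s = a ∧ E t b)

/-- The coded relation. -/
def RzE (z κ H a b : M) : Prop := ∃ y, E y κ ∧ (TripE E H a b y ∧ E y z)

/-- `H` is the pairing function. -/
def PairingE (κ β H : M) : Prop :=
  (∀ a, E a κ → ∀ b, E b κ → (DomE E β a b → ∃ y, E y κ ∧ TripE E H a b y)) ∧
  (∀ a, E a κ → ∀ b, E b κ → (DomE E β a b → ∀ y, E y κ → (TripE E H a b y → ∀ u, E u κ →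
    (E u y ↔ (E u β ∨ u = β ∨ ∃ a', E a' κ ∧ ∃ b', E b' κ ∧
      (DomE E β a' b' ∧ LexE E a' b' a b ∧ TripE E H a' b' u))))))

/-- `F` is the decoding function. -/
def DecodeE (z κ β H F : M) : Prop :=
  (∀ η, E η β → ∃ w, PairMemE E F η w ∧ True) ∧
  (∀ η, E η β → ∀ w, PairMemE E F η w →
    ((∀ u, E u w → ∃ ξ, E ξ β ∧ (¬ ξ = η ∧ RzE E z κ H ξ η ∧ PairMemE E F ξ u)) ∧
    (∀ ξ, E ξ β → ((¬ ξ = η ∧ RzE E z κ H ξ η) → ∀ u, PairMemE E F ξ u → E u w))))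

/-- `z` codes `A` and `x`. -/
def CodeE (z κ β H F A x : M) : Prop :=
  (E β z ∧ ∀ u, E u z → (u = β ∨ E β u)) ∧ PairingE E κ β H ∧ DecodeE E z κ β H F ∧
  (∀ u, E u x → ∃ ξ, E ξ β ∧ (RzE E z κ H ξ ξ ∧ PairMemE E F ξ u)) ∧
  (∀ ξ, E ξ β → (RzE E z κ H ξ ξ → ∀ u, PairMemE E F ξ u → E u x)) ∧
  (∀ ξ, E ξ A → (E ξ κ ∧ RzE E z κ H β ξ)) ∧
  (∀ ξ, E ξ κ → (RzE E z κ H β ξ → E ξ A))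

end

section
variable {k : ℕ}

instance Dfn0.tripE (i j l m : Fin k) : Dfn0 (fun _ E v => TripE E (v i) (v j) (v l) (v m)) := by
  unfold TripE; infer_instance
instance Dfn0.domE (i j l : Fin k) : Dfn0 (fun _ E v => DomE E (v i) (v j) (v l)) := by
  unfold DomE; infer_instance
instance Dfn0.lexE (i j l m : Fin k) : Dfn0 (fun _ E v => LexE E (v i) (v j) (v l) (v m)) := by
  unfold LexE; infer_instance
instance Dfn0.rzE (i j l m p : Fin k) :
    Dfn0 (fun _ E v => RzE E (v i) (v j) (v l) (v m) (v p)) := by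
  unfold RzE; infer_instance
instance Dfn0.pairingE (i j l : Fin k) : Dfn0 (fun _ E v => PairingE E (v i) (v j) (v l)) := by
  unfold PairingE; infer_instance
instance Dfn0.decodeE (i j l m p : Fin k) :
    Dfn0 (fun _ E v => DecodeE E (v i) (v j) (v l) (v m) (v p)) := by
  unfold DecodeE; infer_instance
instance Dfn0.codeE (i j l m p q r : Fin k) :
    Dfn0 (fun _ E v => CodeE E (v i) (v j) (v l) (v m) (v p) (v q) (v r)) := by
  unfold CodeE; infer_instance
end

theorem toZ_inj {a b : Ordinal.{0}} : a.toZFSet = b.toZFSet ↔ a = b :=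
  Ordinal.toZFSet_injective.eq_iff

theorem trip_iff {H a b y : ZFSet.{0}} :
    TripE zmem H a b y ↔ ZFSet.pair (ZFSet.pair a b) y ∈ H := by
  unfold TripE
  simp only [opair_iff]
  constructor
  · rintro ⟨p, hp, s, hs, q, hq, rfl, rfl⟩; exact hp
  · intro h
    exact ⟨_, h, {ZFSet.pair a b}, by simp [zmem, ZFSet.pair], _, by simp [zmem], rfl, rfl⟩

/-- The pairing function. -/
noncomputable def hh (β a b : Ordinal.{0}) : Ordinal.{0} := (β + 1) + (β * a + b)

/-- Its domain. -/
def Dm (β a b : Ordinal.{0}) : Prop := (a < β ∧ b < β) ∨ a = β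

theorem hh_lt_of_lex {β a b a' b' : Ordinal.{0}} (hd : Dm β a b) (hd' : Dm β a' b')
    (h : a' < a ∨ (a' = a ∧ b' < b)) : hh β a' b' < hh β a b := by
  unfold hh
  rw [add_lt_add_iff_left]
  rcases h with h | ⟨rfl, h⟩
  · have ha : a ≤ β := by rcases hd with h | h; exacts [h.1.le, h.le]
    have hb' : b' < β := by
      rcases hd' with h' | h'
      · exact h'.2
      · exact absurd (h.trans_le ha) (by simp [h'])
    calc β * a' + b' < β * a' + β := by rwa [add_lt_add_iff_left]
      _ = β * (a' + 1) := by rw [mul_add_one]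
      _ ≤ β * a := by
        apply mul_le_mul_right
        rw [← Order.succ_eq_add_one]
        exact Order.succ_le_of_lt h
      _ ≤ _ := le_self_add
  · rwa [add_lt_add_iff_left]

theorem hh_inj {β a b a' b' : Ordinal.{0}} (hd : Dm β a b) (hd' : Dm β a' b')
    (h : hh β a' b' = hh β a b) : a' = a ∧ b' = b := by
  rcases lt_trichotomy a' a with h1 | h1 | h1
  · exact absurd h (hh_lt_of_lex hd hd' (Or.inl h1)).ne
  · refine ⟨h1, ?_⟩
    rcases lt_trichotomy b' b with h2 | h2 | h2
    · exact absurd h (hh_lt_of_lex hd hd' (Or.inr ⟨h1, h2⟩)).ne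
    · exact h2
    · exact absurd h (hh_lt_of_lex hd' hd (Or.inr ⟨h1.symm, h2⟩)).ne'
  · exact absurd h (hh_lt_of_lex hd' hd (Or.inl h1)).ne'

theorem lt_hh_iff {β a b u : Ordinal.{0}} (hd : Dm β a b) : u < hh β a b ↔
    u < β ∨ u = β ∨ ∃ a' b', Dm β a' b' ∧ (a' < a ∨ (a' = a ∧ b' < b)) ∧ u = hh β a' b' := by
  have hb : β < β + 1 := by rw [← Order.succ_eq_add_one]; exact Order.lt_succ β
  constructor
  · intro hu
    rcases lt_or_ge u (β + 1) with h | h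
    · rw [← Order.succ_eq_add_one, Order.lt_succ_iff, le_iff_lt_or_eq] at h
      tauto
    · right; right
      obtain ⟨v, rfl⟩ := exists_add_of_le h
      unfold hh at hu
      rw [add_lt_add_iff_left] at hu
      rcases lt_or_ge v (β * a) with h1 | h1
      · have hβ : β ≠ 0 := by rintro rfl; simp at h1
        have h2 : v / β < a := (Ordinal.lt_mul_iff_div_lt hβ).1 h1
        have ha : a ≤ β := by rcases hd with h | h; exacts [h.1.le, h.le]
        exact ⟨v / β, v % β, Or.inl ⟨h2.trans_le ha, Ordinal.mod_lt _ hβ⟩, Or.inl h2, by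
          unfold hh; rw [Ordinal.div_add_mod]⟩
      · obtain ⟨w, rfl⟩ := exists_add_of_le h1
        rw [add_lt_add_iff_left] at hu
        refine ⟨a, w, ?_, Or.inr ⟨rfl, hu⟩, rfl⟩
        rcases hd with h | h
        · exact Or.inl ⟨h.1, hu.trans h.2⟩
        · exact Or.inr h
  · rintro (h | rfl | ⟨a', b', h1, h2, rfl⟩)
    · exact (h.trans hb).trans_le le_self_add
    · exact hb.trans_le le_self_add
    · exact hh_lt_of_lex hd h1 h2

theorem hh_lt {k : Ordinal.{0}} (hk : k.card.ord = k) (hi : Cardinal.aleph0 ≤ k.card) 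
    {β a b : Ordinal.{0}} (hβ : β < k) (ha : a < k) (hb : b < k) : hh β a b < k := by
  have h1 : IsPrincipal (· + ·) k := hk ▸ Ordinal.isPrincipal_add_ord hi
  have h2 : IsPrincipal (· * ·) k := hk ▸ Ordinal.isPrincipal_mul_ord hi
  have h3 : (1 : Ordinal.{0}) < k := by
    rw [← hk]
    exact Ordinal.one_lt_omega0.trans_le (by rw [← Cardinal.ord_aleph0]; exact Cardinal.ord_le_ord.2 hi)
  exact h1 (h1 hβ h3) (h1 (h2 hβ ha) hb)

/-- The set of ordinals coding. -/
def Zp (β : Ordinal.{0}) (g : Ordinal.{0} → ZFSet.{0}) (A x : ZFSet.{0}) (u : Ordinal.{0}) : Prop :=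
  u = β ∨ (∃ a b, a < β ∧ b < β ∧ ((a ≠ b ∧ g a ∈ g b) ∨ (a = b ∧ g a ∈ x)) ∧ u = hh β a b) ∨
    ∃ b, b.toZFSet ∈ A ∧ u = hh β β b

theorem ne_hh {β a b : Ordinal.{0}} (h : Dm β a b) : hh β a b ≠ β :=
  ((lt_hh_iff h).2 (Or.inr (Or.inl rfl))).ne'

theorem zp_hh {β : Ordinal.{0}} {g : Ordinal.{0} → ZFSet.{0}} {A x : ZFSet.{0}} {a b : Ordinal.{0}}
    (ha : a < β) (hb : b < β) : Zp β g A x (hh β a b) ↔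
      ((a ≠ b ∧ g a ∈ g b) ∨ (a = b ∧ g a ∈ x)) := by
  have hd : Dm β a b := Or.inl ⟨ha, hb⟩
  constructor
  · rintro (h | ⟨a', b', h1, h2, h3, h4⟩ | ⟨b', h1, h2⟩)
    · exact absurd h (ne_hh hd)
    · obtain ⟨rfl, rfl⟩ := hh_inj (Or.inl ⟨h1, h2⟩) hd h4
      exact h3
    · obtain ⟨rfl, -⟩ := hh_inj (Or.inr rfl) hd h2
      exact absurd ha (lt_irrefl _)
  · intro h
    exact Or.inr (Or.inl ⟨a, b, ha, hb, h, rfl⟩)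

theorem zp_hh' {β : Ordinal.{0}} {g : Ordinal.{0} → ZFSet.{0}} {A x : ZFSet.{0}} {b : Ordinal.{0}} :
    Zp β g A x (hh β β b) ↔ b.toZFSet ∈ A := by
  have hd : Dm β β b := Or.inr rfl
  constructor
  · rintro (h | ⟨a', b', h1, h2, h3, h4⟩ | ⟨b', h1, h2⟩)
    · exact absurd h (ne_hh hd)
    · obtain ⟨rfl, -⟩ := hh_inj (Or.inl ⟨h1, h2⟩) hd h4
      exact absurd h1 (lt_irrefl _)
    · obtain ⟨-, rfl⟩ := hh_inj (Or.inr rfl) hd h2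
      exact h1
  · intro h
    exact Or.inr (Or.inr ⟨b, h, rfl⟩)

theorem zp_ge {β : Ordinal.{0}} {g : Ordinal.{0} → ZFSet.{0}} {A x : ZFSet.{0}} {u : Ordinal.{0}}
    (h : Zp β g A x u) : u = β ∨ β < u := by
  rcases h with h | ⟨a, b, h1, h2, h3, rfl⟩ | ⟨b, h1, rfl⟩
  · exact Or.inl h
  · exact Or.inr ((lt_hh_iff (Or.inl ⟨h1, h2⟩)).2 (Or.inr (Or.inl rfl)))
  · exact Or.inr ((lt_hh_iff (Or.inr rfl)).2 (Or.inr (Or.inl rfl)))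

theorem dom_iff {β a b : Ordinal.{0}} : DomE zmem β.toZFSet a.toZFSet b.toZFSet ↔ Dm β a b := by
  unfold DomE Dm zmem
  simp only [Ordinal.toZFSet_mem_toZFSet_iff, toZ_inj]

theorem lex_iff {a' b' a b : Ordinal.{0}} : LexE zmem a'.toZFSet b'.toZFSet a.toZFSet b.toZFSet ↔ 
    (a' < a ∨ (a' = a ∧ b' < b)) := by
  unfold LexE zmem
  simp only [Ordinal.toZFSet_mem_toZFSet_iff, toZ_inj]

theorem all_mem_ord {o : Ordinal.{0}} {P : ZFSet.{0} → Prop} :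
    (∀ x, zmem x o.toZFSet → P x) ↔ ∀ a < o, P a.toZFSet := by
  unfold zmem
  simp only [Ordinal.mem_toZFSet_iff]
  constructor
  · intro h a ha; exact h _ ⟨a, ha, rfl⟩
  · rintro h _ ⟨a, ha, rfl⟩; exact h a ha

theorem ex_mem_ord {o : Ordinal.{0}} {P : ZFSet.{0} → Prop} :
    (∃ x, zmem x o.toZFSet ∧ P x) ↔ ∃ a < o, P a.toZFSet := by
  unfold zmem
  simp only [Ordinal.mem_toZFSet_iff]
  constructor
  · rintro ⟨_, ⟨a, ha, rfl⟩, h⟩; exact ⟨a, ha, h⟩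
  · rintro ⟨a, ha, h⟩; exact ⟨_, ⟨a, ha, rfl⟩, h⟩

theorem zmem_ord {a b : Ordinal.{0}} : zmem a.toZFSet b.toZFSet ↔ a < b :=
  Ordinal.toZFSet_mem_toZFSet_iff

theorem pairing_iff {k β : Ordinal.{0}} {H : ZFSet.{0}} (hβ : β < k) :
    PairingE zmem k.toZFSet β.toZFSet H ↔ ∀ a < k, ∀ b < k, Dm β a b → hh β a b < k ∧
      ∀ y < k, (TripE zmem H a.toZFSet b.toZFSet y.toZFSet ↔ y = hh β a b) := by
  unfold PairingE
  simp only [all_mem_ord, ex_mem_ord, dom_iff, lex_iff, zmem_ord, toZ_inj]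
  constructor
  · rintro ⟨h1, h2⟩ a
    induction a using WellFoundedLT.induction with
    | _ a iha =>
    intro ha b
    induction b using WellFoundedLT.induction with
    | _ b ihb =>
    intro hb hd
    have key : ∀ y < k, TripE zmem H a.toZFSet b.toZFSet y.toZFSet → y = hh β a b := by
      intro y hy ht
      have h3 := h2 a ha b hb hd y hy ht
      have ih : ∀ a' b', a' < k → b' < k → Dm β a' b' → (a' < a ∨ (a' = a ∧ b' < b)) → hh β a' b' < k ∧
          ∀ y < k, (TripE zmem H a'.toZFSet b'.toZFSet y.toZFSet ↔ y = hh β a' b') := by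
        rintro a' b' ha' hb' hd' (h | ⟨rfl, h⟩)
        · exact iha a' h ha' b' hb' hd'
        · exact ihb b' h hb' hd'
      refine eq_of_forall_lt_iff fun u => ?_
      rw [lt_hh_iff hd]
      constructor
      · intro hu
        rcases (h3 u (hu.trans hy)).1 hu with h | h | ⟨a', ha', b', hb', hd', hl, ht'⟩
        · exact Or.inl h
        · exact Or.inr (Or.inl h)
        · exact Or.inr (Or.inr ⟨a', b', hd', hl,
            ((ih a' b' ha' hb' hd' hl).2 u (hu.trans hy)).1 ht'⟩)
      · rintro (h | rfl | ⟨a', b', hd', hl, rfl⟩)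
        · exact (h3 u (h.trans hβ)).2 (Or.inl h)
        · exact (h3 _ hβ).2 (Or.inr (Or.inl rfl))
        · have ha' : a' < k := by
            rcases hl with h | ⟨rfl, h⟩
            exacts [h.trans ha, ha]
          have hb' : b' < k := by
            rcases hd' with h | h
            · exact h.2.trans hβ
            · rcases hl with h' | ⟨-, h'⟩
              · exfalso
                rcases hd with h4 | h4
                · exact absurd (h'.trans h4.1) (by simp [h])
                · exact absurd h' (by simp [h, h4])
              · exact h'.trans hb
          obtain ⟨h4, h5⟩ := ih a' b' ha' hb' hd' hl
          exact (h3 _ h4).2 (Or.inr (Or.inr ⟨a', ha', b', hb', hd', hl, (h5 _ h4).2 rfl⟩))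
    obtain ⟨y, hy, ht⟩ := h1 a ha b hb hd
    have hyy := key y hy ht
    refine ⟨hyy ▸ hy, fun y' hy' => ⟨key y' hy', ?_⟩⟩
    rintro rfl
    rw [← hyy]; exact ht
  · intro h
    refine ⟨fun a ha b hb hd => ⟨_, (h a ha b hb hd).1, ((h a ha b hb hd).2 _ (h a ha b hb hd).1).2 rfl⟩, ?_⟩
    intro a ha b hb hd y hy ht u hu
    rw [((h a ha b hb hd).2 y hy).1 ht, lt_hh_iff hd]
    refine or_congr_right (or_congr_right ?_)
    constructor
    · rintro ⟨a', b', hd', hl, rfl⟩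
      have ha' : a' < k := by
        rcases hl with h | ⟨rfl, h⟩
        exacts [h.trans ha, ha]
      have hb' : b' < k := by
        rcases hd' with h | h
        · exact h.2.trans hβ
        · rcases hl with h' | ⟨-, h'⟩
          · exfalso
            rcases hd with h4 | h4
            · exact absurd (h'.trans h4.1) (by simp [h])
            · exact absurd h' (by simp [h, h4])
          · exact h'.trans hb
      exact ⟨a', ha', b', hb', hd', hl, ((h a' ha' b' hb' hd').2 _ hu).2 rfl⟩
    · rintro ⟨a', ha', b', hb', hd', hl, ht'⟩
      exact ⟨a', b', hd', hl, ((h a' ha' b' hb' hd').2 _ hu).1 ht'⟩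

theorem rz_iff {k β : Ordinal.{0}} {H z : ZFSet.{0}} (hβ : β < k)
    (hH : PairingE zmem k.toZFSet β.toZFSet H) {a b : Ordinal.{0}} (ha : a < k) (hb : b < k)
    (hd : Dm β a b) : RzE zmem z k.toZFSet H a.toZFSet b.toZFSet ↔ (hh β a b).toZFSet ∈ z := by
  obtain ⟨h1, h2⟩ := (pairing_iff hβ).1 hH a ha b hb hd
  unfold RzE
  rw [ex_mem_ord]
  constructor
  · rintro ⟨y, hy, ht, hz⟩
    rw [← (h2 y hy).1 ht]; exact hz
  · intro h
    exact ⟨_, h1, (h2 _ h1).2 rfl, h⟩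

theorem code_decode {k β : Ordinal.{0}} {g : Ordinal.{0} → ZFSet.{0}} {A x z H F A' x' : ZFSet.{0}}
    {β' : ZFSet.{0}}
    (hg : ∀ η < β, ∀ u ∈ g η, ∃ ξ < β, g ξ = u) (hx : ∀ u ∈ x, ∃ ξ < β, g ξ = u)
    (hz : ∀ u, u ∈ z ↔ ∃ o < k, u = o.toZFSet ∧ Zp β g A x o)
    (h : CodeE zmem z k.toZFSet β' H F A' x') :
    x' = x ∧ ∀ u, u ∈ A' ↔ u ∈ A ∧ u ∈ k.toZFSet := by
  obtain ⟨⟨h1, h2⟩, h3, ⟨h4, h5⟩, h6, h7, h8, h9⟩ := h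
  obtain ⟨b', hb', rfl, hzb⟩ := (hz _).1 h1
  have hbb : b' = β := by
    rcases zp_ge hzb with h | h
    · exact h
    · have h11 : zmem β.toZFSet z := (hz _).2 ⟨β, h.trans hb', rfl, Or.inl rfl⟩
      rcases h2 _ h11 with h | h'
      · rw [toZ_inj] at h; exact h.symm
      · rw [zmem_ord] at h'; exact absurd h (lt_asymm h')
  subst hbb
  have hmz : ∀ o : Ordinal.{0}, o < k → (o.toZFSet ∈ z ↔ Zp b' g A x o) := by
    intro o ho
    rw [hz]
    constructor
    · rintro ⟨o', -, h, h'⟩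
      rw [toZ_inj] at h; rw [h]; exact h'
    · intro h; exact ⟨o, ho, rfl, h⟩
  have hR : ∀ a b, a < b' → b < b' → (RzE zmem z k.toZFSet H a.toZFSet b.toZFSet ↔
      ((a ≠ b ∧ g a ∈ g b) ∨ (a = b ∧ g a ∈ x))) := by
    intro a b ha hb
    have hd : Dm b' a b := Or.inl ⟨ha, hb⟩
    rw [rz_iff hb' h3 (ha.trans hb') (hb.trans hb') hd, hmz, zp_hh ha hb]
    exact ((pairing_iff hb').1 h3 a (ha.trans hb') b (hb.trans hb') hd).1
  have hR' : ∀ b, b < k → (RzE zmem z k.toZFSet H b'.toZFSet b.toZFSet ↔ b.toZFSet ∈ A) := by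
    intro b hb
    have hd : Dm b' b' b := Or.inr rfl
    rw [rz_iff hb' h3 hb' hb hd, hmz, zp_hh']
    exact ((pairing_iff hb').1 h3 _ hb' b hb hd).1
  simp only [all_mem_ord, ex_mem_ord, toZ_inj] at h4 h5 h6 h7
  have hF : ∀ w : ZFSet.{0}, ∀ η < b', g η = w → ∀ w', PairMemE zmem F η.toZFSet w' → w' = w := by
    intro w
    induction w using ZFSet.inductionOn with
    | _ w ih =>
    rintro η hη rfl w' hw'
    obtain ⟨h10, h11⟩ := h5 η hη w' hw'
    ext u
    constructor
    · intro hu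
      obtain ⟨ξ, hξ, hne, hr, hp⟩ := h10 u hu
      rcases (hR ξ η hξ hη).1 hr with h | h
      · rw [ih (g ξ) h.2 ξ hξ rfl u hp]; exact h.2
      · exact absurd h.1 hne
    · intro hu
      obtain ⟨ξ, hξ, rfl⟩ := hg η hη u hu
      have hne : ¬ ξ = η := by rintro rfl; exact ZFSet.mem_irrefl _ hu
      obtain ⟨w, hw, -⟩ := h4 ξ hξ
      have := h11 ξ hξ ⟨hne, (hR ξ η hξ hη).2 (Or.inl ⟨hne, hu⟩)⟩ w hw
      rw [ih (g ξ) hu ξ hξ rfl w hw] at this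
      exact this
  refine ⟨?_, ?_⟩
  · ext u
    constructor
    · intro hu
      obtain ⟨ξ, hξ, hr, hp⟩ := h6 u hu
      rw [hF _ ξ hξ rfl u hp]
      rcases (hR ξ ξ hξ hξ).1 hr with h | h
      · exact absurd rfl h.1
      · exact h.2
    · intro hu
      obtain ⟨ξ, hξ, rfl⟩ := hx u hu
      obtain ⟨w, hw, -⟩ := h4 ξ hξ
      have := h7 ξ hξ ((hR ξ ξ hξ hξ).2 (Or.inr ⟨rfl, hu⟩)) w hw
      rwa [hF _ ξ hξ rfl w hw] at this
  · intro u
    constructor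
    · intro hu
      obtain ⟨h10, h11⟩ := h8 u hu
      refine ⟨?_, h10⟩
      obtain ⟨o, ho, rfl⟩ := Ordinal.mem_toZFSet_iff.1 h10
      exact (hR' o ho).1 h11
    · rintro ⟨h10, h11⟩
      obtain ⟨o, ho, rfl⟩ := Ordinal.mem_toZFSet_iff.1 h11
      exact h9 _ h11 ((hR' o ho).2 h10)

theorem code_exists {k β : Ordinal.{0}} (hk : k.card.ord = k) (hi : Cardinal.aleph0 ≤ k.card) (hs : SC k)
    (hβ : β < k) {g : Ordinal.{0} → ZFSet.{0}} {A x z : ZFSet.{0}} (hA : A ⊆ k.toZFSet)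
    (hgk : ∀ η < β, (g η).rank < k)
    (hg : ∀ η < β, ∀ u ∈ g η, ∃ ξ < β, g ξ = u) (hx : ∀ u ∈ x, ∃ ξ < β, g ξ = u)
    (hz : ∀ u, u ∈ z ↔ ∃ o < k, u = o.toZFSet ∧ Zp β g A x o) :
    ∃ H F, H ⊆ V_ k ∧ F ⊆ V_ k ∧ CodeE zmem z k.toZFSet β.toZFSet H F A x := by
  let H : ZFSet.{0} := ZFSet.sep (fun p => ∃ a b, Dm β a b ∧
    p = ZFSet.pair (ZFSet.pair a.toZFSet b.toZFSet) (hh β a b).toZFSet) (V_ k)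
  let F : ZFSet.{0} := graph β.toZFSet (fun u => g u.rank)
  have hFi : ∀ η < β, ∀ w, PairMemE zmem F η.toZFSet w ↔ w = g η := by
    intro η hη w
    rw [pairMem_iff, pair_mem_graph, Ordinal.rank_toZFSet]
    simp [Ordinal.toZFSet_mem_toZFSet_iff, hη]
  have hH : PairingE zmem k.toZFSet β.toZFSet H := by
    rw [pairing_iff hβ]
    intro a ha b hb hd
    have hlt := hh_lt hk hi hβ ha hb
    refine ⟨hlt, fun y hy => ?_⟩
    rw [trip_iff, ZFSet.mem_sep]
    constructor
    · rintro ⟨-, a', b', -, h⟩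
      rw [ZFSet.pair_inj, ZFSet.pair_inj] at h
      simp only [toZ_inj] at h
      obtain ⟨⟨rfl, rfl⟩, rfl⟩ := h
      rfl
    · rintro rfl
      refine ⟨?_, a, b, hd, rfl⟩
      rw [ZFSet.mem_vonNeumann]
      refine rank_pair_lt hs (rank_pair_lt hs ?_ ?_) ?_ <;> rwa [Ordinal.rank_toZFSet]
  have hmz : ∀ o : Ordinal.{0}, o < k → (o.toZFSet ∈ z ↔ Zp β g A x o) := by
    intro o ho
    rw [hz]
    constructor
    · rintro ⟨o', -, h, h'⟩
      rw [toZ_inj] at h; rw [h]; exact h'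
    · intro h; exact ⟨o, ho, rfl, h⟩
  have hR : ∀ a b, a < β → b < β → (RzE zmem z k.toZFSet H a.toZFSet b.toZFSet ↔
      ((a ≠ b ∧ g a ∈ g b) ∨ (a = b ∧ g a ∈ x))) := by
    intro a b ha hb
    have hd : Dm β a b := Or.inl ⟨ha, hb⟩
    rw [rz_iff hβ hH (ha.trans hβ) (hb.trans hβ) hd, hmz, zp_hh ha hb]
    exact ((pairing_iff hβ).1 hH a (ha.trans hβ) b (hb.trans hβ) hd).1
  have hR' : ∀ b, b < k → (RzE zmem z k.toZFSet H β.toZFSet b.toZFSet ↔ b.toZFSet ∈ A) := by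
    intro b hb
    have hd : Dm β β b := Or.inr rfl
    rw [rz_iff hβ hH hβ hb hd, hmz, zp_hh']
    exact ((pairing_iff hβ).1 hH _ hβ b hb hd).1
  refine ⟨H, F, ?_, ?_, ?_⟩
  · intro p hp; exact (ZFSet.mem_sep.1 hp).1
  · intro p hp
    obtain ⟨u, hu, rfl⟩ := mem_im.1 hp
    obtain ⟨o, ho, rfl⟩ := Ordinal.mem_toZFSet_iff.1 hu
    rw [ZFSet.mem_vonNeumann]
    refine rank_pair_lt hs ?_ ?_
    · rw [Ordinal.rank_toZFSet]; exact ho.trans hβ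
    · simp only [Ordinal.rank_toZFSet]; exact hgk o ho
  · refine ⟨⟨(hz _).2 ⟨β, hβ, rfl, Or.inl rfl⟩, ?_⟩, hH, ⟨?_, ?_⟩, ?_, ?_, ?_, ?_⟩
    · intro u hu
      obtain ⟨o, ho, rfl, h⟩ := (hz _).1 hu
      rw [zmem_ord, toZ_inj]
      exact zp_ge h
    · rw [all_mem_ord]
      intro η hη
      exact ⟨g η, (hFi η hη _).2 rfl, trivial⟩
    · rw [all_mem_ord]
      intro η hη w hw
      rw [hFi η hη] at hw
      subst hw
      simp only [all_mem_ord, ex_mem_ord, toZ_inj]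
      constructor
      · intro u hu
        obtain ⟨ξ, hξ, rfl⟩ := hg η hη u hu
        have hne : ¬ ξ = η := by rintro rfl; exact ZFSet.mem_irrefl _ hu
        exact ⟨ξ, hξ, hne, (hR ξ η hξ hη).2 (Or.inl ⟨hne, hu⟩), (hFi ξ hξ _).2 rfl⟩
      · rintro ξ hξ ⟨hne, hr⟩ u hu
        rw [(hFi ξ hξ _).1 hu]
        rcases (hR ξ η hξ hη).1 hr with h | h
        · exact h.2
        · exact absurd h.1 hne
    · intro u hu
      rw [ex_mem_ord]
      obtain ⟨ξ, hξ, rfl⟩ := hx u hu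
      exact ⟨ξ, hξ, (hR ξ ξ hξ hξ).2 (Or.inr ⟨rfl, hu⟩), (hFi ξ hξ _).2 rfl⟩
    · rw [all_mem_ord]
      intro ξ hξ hr u hu
      rw [(hFi ξ hξ _).1 hu]
      rcases (hR ξ ξ hξ hξ).1 hr with h | h
      · exact absurd rfl h.1
      · exact h.2
    · intro ξ hξ
      refine ⟨hA hξ, ?_⟩
      obtain ⟨o, ho, rfl⟩ := Ordinal.mem_toZFSet_iff.1 (hA hξ)
      exact (hR' o ho).2 hξ
    · rw [all_mem_ord]
      intro o ho h
      exact (hR' o ho).1 h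

end Paper

namespace Paper
open Ordinal Cardinal
open scoped ZFSet

instance Dfn.realize2 {k : ℕ} (φ : SetFormula 2) (i j : Fin k) :
    Dfn (fun _ E v => Realize E φ ![v i, v j]) :=
  Dfn.congr (Dfn.realize φ ![i, j]) fun M E v => by
    have : (fun t => v ((![i, j] : Fin 2 → Fin k) t)) = ![v i, v j] := by
      funext t; fin_cases t <;> rfl
    rw [this]

instance Dfn.realize3 {k : ℕ} (φ : SetFormula 3) (i j l : Fin k) :
    Dfn (fun _ E v => Realize E φ ![v i, v j, v l]) :=
  Dfn.congr (Dfn.realize φ ![i, j, l]) fun M E v => by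
    have : (fun t => v ((![i, j, l] : Fin 3 → Fin k) t)) = ![v i, v j, v l] := by
      funext t; fin_cases t <;> rfl
    rw [this]

theorem codeE_abs {S : ZFSet.{0} → Prop} (hS : ∀ x, S x → ∀ y, zmem y x → S y)
    (a b c d e f g : {x // S x}) : CodeE (indE zmem S) a b c d e f g ↔
      CodeE zmem a.1 b.1 c.1 d.1 e.1 f.1 g.1 :=
  (Dfn0.codeE (k := 7) 0 1 2 3 4 5 6).abs hS ![a, b, c, d, e, f, g]

/-- Shrewdness with a subset of `κ` and an element of `H(κ)` as parameters. -/
theorem ShrewdO.param {n : ℕ} {k : Ordinal.{0}} (hk : k.card.ord = k) (hS : ShrewdO n k)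
    {P : Pred 3} (hP : Dfn P) {θ : Ordinal.{0}} (hθ : θ.card.ord = θ) (hC : CV n θ) (hkθ : k < θ)
    (K A x : {x // x ∈ V_ θ}) (hK : K.1 = k.toZFSet) (hA : A.1 ⊆ k.toZFSet)
    (hx : HMemE zmem x.1 k.toZFSet) (h : P _ (vE θ) ![K, A, x]) :
    ∃ (k' θ' : Ordinal.{0}) (K' A' x' : {x // x ∈ V_ θ'}), k' < k ∧ CV n θ' ∧
      K'.1 = k'.toZFSet ∧ (∀ u, u ∈ A'.1 ↔ u ∈ A.1 ∧ u ∈ k'.toZFSet) ∧ x'.1 = x.1 ∧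
      P _ (vE θ') ![K', A', x'] := by
  obtain ⟨h0, hs⟩ := hS.limit
  have hi := aleph0_le_of_sc h0 hs
  obtain ⟨φ, hφ⟩ := hP.out
  rw [hmem_iff hk] at hx
  obtain ⟨t, ht, hxt, htk⟩ := hx
  obtain ⟨β, hβk, g, hgt⟩ : ∃ β < k, ∃ g : Ordinal.{0} → ZFSet.{0}, ∀ u, u ∈ t ↔ ∃ ξ < β, g ξ = u := by
    obtain ⟨f, ⟨hf1, hf2⟩, hf3⟩ := exists_surj_ord t
    refine ⟨t.card.ord, ?_, ?_⟩
    · rw [← hk]; exact Cardinal.ord_lt_ord.2 htk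
    · have : ∀ ξ : Ordinal.{0}, ∃ y, ξ < t.card.ord → PairMemE zmem f ξ.toZFSet y := by
        intro ξ
        by_cases hξ : ξ < t.card.ord
        · obtain ⟨y, hy⟩ := (hf2 ξ.toZFSet (zmem_ord.2 hξ)).1
          exact ⟨y, fun _ => hy⟩
        · exact ⟨∅, fun h => absurd h hξ⟩
      choose g hg using this
      refine ⟨g, fun u => ⟨fun hu => ?_, ?_⟩⟩
      · obtain ⟨x, hx, hp⟩ := hf3 u hu
        obtain ⟨ξ, hξ, rfl⟩ := Ordinal.mem_toZFSet_iff.1 hx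
        exact ⟨ξ, hξ, (hf2 _ hx).2 _ _ (hg ξ hξ) hp⟩
      · rintro ⟨ξ, hξ, rfl⟩
        obtain ⟨p, hp, hpo⟩ := hg ξ hξ
        obtain ⟨a, b, ha, hb, hab⟩ := hf1 p hp
        rw [opair_iff] at hpo hab
        rw [hpo, ZFSet.pair_inj] at hab
        rw [hab.2]; exact hb
  have hgk : ∀ η < β, (g η).rank < k := by
    intro η hη
    have h1 : (g η).rank < t.rank := ZFSet.rank_lt_of_mem ((hgt _).2 ⟨η, hη, rfl⟩)
    refine h1.trans ?_
    rw [← hk, Cardinal.lt_ord]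
    exact (rank_card_le ht).trans_lt htk
  have hg : ∀ η < β, ∀ u ∈ g η, ∃ ξ < β, g ξ = u := fun η hη u hu =>
    (hgt u).1 (ht.mem_trans hu ((hgt _).2 ⟨η, hη, rfl⟩))
  have hx' : ∀ u ∈ x.1, ∃ ξ < β, g ξ = u := fun u hu => (hgt u).1 (hxt hu)
  let z : ZFSet.{0} := ZFSet.sep (fun u => ∃ o < k, u = o.toZFSet ∧ Zp β g A.1 x.1 o) k.toZFSet
  have hz : ∀ u, u ∈ z ↔ ∃ o < k, u = o.toZFSet ∧ Zp β g A.1 x.1 o := by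
    intro u
    rw [ZFSet.mem_sep]
    refine ⟨fun h => h.2, fun h => ⟨?_, h⟩⟩
    obtain ⟨o, ho, rfl, -⟩ := h
    exact zmem_ord.2 ho
  obtain ⟨H, F, hH, hF, hcode⟩ := code_exists hk hi hs hβk hA hgk hg hx' hz
  have hVk : ∀ B, B ⊆ V_ k → B ∈ V_ θ := fun B hB => mem_V_iff.2 ⟨k, hkθ, hB⟩
  have hzk : z ⊆ k.toZFSet := fun u hu => (ZFSet.mem_sep.1 hu).1
  have hzθ : z ∈ V_ θ := ZFSet.mem_vonNeumann_of_subset hzk (mem_V_toZFSet.2 hkθ)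
  obtain ⟨k', θ', z', K', h1, h2, h3, h4, h5, h6, h7, β', H', F', A', x', h8, h9⟩ :=
    hS (fun M E v => ∃ β H F A x, CodeE E (v 0) (v 1) β H F A x ∧ Realize E φ ![v 1, A, x])
      inferInstance θ hθ hC hkθ ⟨z, hzθ⟩ K hzk hK
      ⟨⟨β.toZFSet, mem_V_toZFSet.2 (hβk.trans hkθ)⟩, ⟨H, hVk H hH⟩, ⟨F, hVk F hF⟩, A, x, by
        rw [codeE_abs (supT_V θ).1]
        change CodeE zmem z K.1 _ H F A.1 x.1
        rw [hK]; exact hcode, (hφ _ _ _).2 h⟩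
  rw [codeE_abs (supT_V θ').1] at h8
  change CodeE zmem z'.1 K'.1 _ _ _ _ _ at h8
  rw [h6] at h8
  obtain ⟨h10, h11⟩ := code_decode (k := k') (A := A.1) hg hx' (z := z'.1) (by
    intro u
    rw [h7, hz]
    constructor
    · rintro ⟨⟨o, ho, rfl, h⟩, h'⟩
      exact ⟨o, zmem_ord.1 h', rfl, h⟩
    · rintro ⟨o, ho, rfl, h⟩
      exact ⟨⟨o, ho.trans h1, rfl, h⟩, zmem_ord.2 ho⟩) h8
  exact ⟨k', θ', K', A', x', h1, h5, h6, h11, h10, (hφ _ _ _).1 h9⟩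

end Paper

namespace Paper
open Ordinal Cardinal
open scoped ZFSet

/-! ### Local definability and `Σₙ₊₁`-definability -/

theorem sig_and_all {m : ℕ} : ∀ {k : ℕ} {Φ : SetFormula k}, IsSigma (m + 2) Φ →
    ∀ {D : SetFormula (k + 1)}, IsDelta0 D → ∃ Ψ : SetFormula k, IsSigma (m + 2) Ψ ∧
      ∀ v : Fin k → ZFSet.{0}, Realize zmem Ψ v ↔
        (Realize zmem Φ v ∧ ∀ a, Realize zmem D (Fin.snoc v a : Fin (k + 1) → ZFSet.{0}))
  | k, Φ, .ofDelta0 h, D, hD =>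
    ⟨((ren Fin.castSucc Φ).and D).all,
      .ofPi (.all (.ofDelta0 (isDelta0_and (ren_delta0 h _) hD))), fun v => by
        simp [realize_ren, forall_and]⟩
  | k, Φ, .ofPi h, D, hD => by
    obtain ⟨ψ, h1, h2⟩ := and_pi (ren_pi h Fin.castSucc) hD
    exact ⟨ψ.all, .ofPi (.all h1), fun v => by simp [h2, realize_ren, forall_and]⟩
  | k, _, .ex h, D, hD => by
    obtain ⟨ψ, h1, h2⟩ := sig_and_all h (ren_delta0 hD (swapR k))
    refine ⟨ψ.ex, .ex h1, fun v => ?_⟩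
    simp only [realize_ex, h2, realize_ren, snoc_swapR]
    constructor
    · rintro ⟨a, h, h1⟩; exact ⟨⟨a, h⟩, h1⟩
    · rintro ⟨⟨a, h⟩, h1⟩; exact ⟨a, h, h1⟩

/-- Relativization to a set. -/
def RelE {M : Type*} (E : M → M → Prop) (W : M) : ∀ {n : ℕ}, SetFormula n → (Fin n → M) → Prop
  | _, .mem i j, v => E (v i) (v j)
  | _, .eq i j, v => v i = v j
  | _, .fal, _ => False
  | _, .imp φ ψ, v => RelE E W φ v → RelE E W ψ v
  | _, .all φ, v => ∀ a, E a W → RelE E W φ (Fin.snoc v a)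

theorem rel_delta0 {k : ℕ} (φ : SetFormula k) : ∀ {l : ℕ} (σ : Fin k → Fin l) (j : Fin l),
    ∃ ψ : SetFormula l, IsDelta0 ψ ∧ ∀ (M : Type 1) (E : M → M → Prop) v, Realize E ψ v ↔
      RelE E (v j) φ (fun i => v (σ i)) := by
  induction φ with
  | mem i j => intro l σ t; exact ⟨.mem (σ i) (σ j), .mem _ _, fun _ _ _ => Iff.rfl⟩
  | eq i j => intro l σ t; exact ⟨.eq (σ i) (σ j), .eq _ _, fun _ _ _ => Iff.rfl⟩
  | fal => intro l σ t; exact ⟨.fal, .fal, fun _ _ _ => Iff.rfl⟩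
  | imp φ ψ h1 h2 =>
    intro l σ t
    obtain ⟨φ', a1, a2⟩ := h1 σ t
    obtain ⟨ψ', b1, b2⟩ := h2 σ t
    exact ⟨φ'.imp ψ', .imp a1 b1, fun M E v => by
      rw [realize_imp, a2, b2]; rfl⟩
  | all φ h =>
    intro l σ t
    obtain ⟨φ', a1, a2⟩ := h (liftR σ) t.castSucc
    exact ⟨_, .ball t a1, fun M E v => by
      simp only [realize_all, realize_imp, realize_mem, a2, snoc_liftR, Fin.snoc_last,
        Fin.snoc_castSucc]
      rfl⟩

instance Dfn0.relE {k l : ℕ} (φ : SetFormula k) (σ : Fin k → Fin l) (j : Fin l) :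
    Dfn0 (fun _ E v => RelE E (v j) φ (fun i => v (σ i))) := ⟨rel_delta0 φ σ j⟩

theorem rel_iff {W : ZFSet.{0}} {k : ℕ} (φ : SetFormula k) : ∀ v : Fin k → {x // x ∈ W},
    RelE zmem W φ (fun i => (v i).1) ↔ Realize (indE zmem (fun x => x ∈ W)) φ v := by
  induction φ with
  | mem i j => intro v; rfl
  | eq i j => intro v; exact Subtype.val_injective.eq_iff
  | fal => intro v; rfl
  | imp φ ψ h1 h2 => intro v; exact imp_congr (h1 v) (h2 v)
  | all φ h =>
    intro v
    constructor
    · intro h1 a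
      rw [← h, snoc_val]; exact h1 a.1 a.2
    · intro h1 a ha
      have := h1 ⟨a, ha⟩
      rw [← h, snoc_val] at this; exact this

/-- Every set lies in some level of the hierarchy. -/
def RankE {M : Type*} (E : M → M → Prop) : Prop := ∀ x, ∃ α, VMemE E x α

instance Dfn.rankE {k : ℕ} : Dfn (k := k) (fun _ E _ => RankE E) := by
  unfold RankE; infer_instance

theorem rankE_V {l : Ordinal.{0}} (hl : SC l) : RankE (vE l) := by
  intro x
  have hx := ZFSet.mem_vonNeumann.1 x.2
  refine ⟨⟨(Order.succ x.1.rank).toZFSet, mem_V_toZFSet.2 (hl _ hx)⟩, ?_⟩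
  rw [vmem_abs hl, vmem_iff, ZFSet.mem_vonNeumann]
  exact Order.lt_succ _

theorem good_eq {W : ZFSet.{0}} (hW : SupT (fun x => x ∈ W))
    (hr : RankE (indE zmem (fun x => x ∈ W))) : ∃ l, SC l ∧ W = V_ l := by
  have key : ∀ w ∈ W, ∃ a : Ordinal.{0}, a.toZFSet ∈ W ∧ w ∈ V_ a ∧ ∀ x : ZFSet.{0},
      x.rank ≤ w.rank → x ∈ W := by
    intro w hw
    obtain ⟨α, hα, f, hf, β, u, hβ, hp, hs⟩ := hr ⟨w, hw⟩
    rw [ordE_abs hW.1] at hα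
    rw [vhier_abs hW] at hf
    rw [pairMem_abs hW.1] at hp
    rw [subE_abs hW.1] at hs
    change β.1 ∈ α.1 at hβ
    obtain ⟨a, ha⟩ := ordE_iff.1 hα
    rw [ha] at hf hβ
    obtain ⟨b, hb, hbe⟩ := Ordinal.mem_toZFSet_iff.1 hβ
    rw [← hbe] at hp
    have hu := (vhier_val hf b hb _).1 hp
    rw [hu] at hs
    change w ⊆ _ at hs
    refine ⟨a, ha ▸ α.2, mem_V_iff.2 ⟨b, hb, hs⟩, fun x hx => ?_⟩
    refine hW.2 _ _ u.2 ?_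
    rw [hu]
    rw [ZFSet.subset_vonNeumann] at hs ⊢
    exact hx.trans hs
  have hWV : W = V_ W.rank := by
    ext x
    rw [ZFSet.mem_vonNeumann]
    constructor
    · exact fun h => ZFSet.rank_lt_of_mem h
    · intro h
      obtain ⟨w, hw, hxw⟩ := ZFSet.lt_rank_iff.1 h
      obtain ⟨a, -, -, h⟩ := key w hw
      exact h x hxw
  refine ⟨W.rank, ?_, hWV⟩
  intro a ha
  have haW : a.toZFSet ∈ W := by rw [hWV]; exact mem_V_toZFSet.2 ha
  obtain ⟨b, hb, hab, -⟩ := key _ haW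
  rw [mem_V_toZFSet] at hab
  rw [hWV, mem_V_toZFSet] at hb
  exact (Order.succ_le_of_lt hab).trans_lt hb

/-- `x` satisfies `P` together with `d` and `ξ` in some `V_λ`. -/
def LocP (P : Pred 3) (y d ξ : ZFSet.{0}) : Prop :=
  ∃ l : Ordinal.{0}, SC l ∧ ∃ Y D Ξ : {x // x ∈ V_ l}, Y.1 = y ∧ D.1 = d ∧ Ξ.1 = ξ ∧
    P _ (vE l) ![Y, D, Ξ]

theorem sig_of_loc {m : ℕ} {H : ZFSet.{0} → Prop} {ψ : SetFormula 2} (hψ : IsSigma (m + 2) ψ)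
    {q δ ξ x : ZFSet.{0}} (hq : H q) (hξ : H ξ) (hδ : ∀ d, Realize zmem ψ ![d, q] ↔ d = δ)
    {P : Pred 3} (hP : Dfn P) (hx : ∀ y, LocP P y δ ξ ↔ y = x) :
    SigmaDefinableSingleton (m + 2) x H := by
  obtain ⟨φ, hφ⟩ := hP.out
  obtain ⟨ρ, hρ⟩ := (Dfn.rankE (k := 0)).out
  have hD : Dfn0 (k := 6) (fun _ E v => TransE E (v 4) ∧
      (∀ b, E b (v 4) → (SubE E (v 5) b → E (v 5) (v 4))) ∧
      RelE E (v 4) ρ (fun i => v ((Fin.elim0 : Fin 0 → Fin 6) i)) ∧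
      (E (v 0) (v 4) ∧ E (v 3) (v 4) ∧ E (v 1) (v 4)) ∧
      RelE E (v 4) φ (fun i => v ((![0, 3, 1] : Fin 3 → Fin 6) i))) := inferInstance
  obtain ⟨D, hD0, hD1⟩ := hD.out
  obtain ⟨Ψ, hΨ, hΨ1⟩ := sig_and_all (ren_sigma hψ (![3, 2] : Fin 2 → Fin 5)) hD0
  have main : ∀ y, Realize zmem Ψ.ex.ex (Fin.cons y ![ξ, q]) ↔ LocP P y δ ξ := by
    intro y
    simp only [realize_ex, hΨ1, realize_ren, hD1]
    have e1 : ∀ d W : ZFSet.{0}, (fun i => (Fin.snoc (Fin.snoc (Fin.cons y ![ξ, q] : Fin 3 → ZFSet.{0}) d : 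
      Fin 4 → ZFSet.{0}) W : Fin 5 → ZFSet.{0}) ((![3, 2] : Fin 2 → Fin 5) i)) = ![d, q] := by
      intro d W; funext i; fin_cases i <;> rfl
    simp only [e1, hδ]
    have e2 : ∀ W a : ZFSet.{0}, (fun i => (Fin.snoc (Fin.snoc (Fin.snoc (Fin.cons y ![ξ, q] : Fin 3 → ZFSet.{0}) δ : 
      Fin 4 → ZFSet.{0}) W : Fin 5 → ZFSet.{0}) a : Fin 6 → ZFSet.{0}) ((![0, 3, 1] : Fin 3 → Fin 6) i)) =
        ![y, δ, ξ] := by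
      intro d W; funext i; fin_cases i <;> rfl
    constructor
    · rintro ⟨d, W, rfl, h⟩
      have h1 : TransE zmem W := (h ∅).1
      have h2 : ∀ a, ∀ b, zmem b W → (SubE zmem a b → zmem a W) := fun a => (h a).2.1
      have h3 := (h ∅).2.2.1
      have h4 : zmem y W ∧ zmem d W ∧ zmem ξ W := (h ∅).2.2.2.1
      have h5 := (h ∅).2.2.2.2
      rw [e2] at h5
      change RelE zmem W φ _ at h5
      change RelE zmem W ρ _ at h3
      have hW : SupT (fun x => x ∈ W) := ⟨fun x hx y hy => h1 x hx y hy, fun x y hx hy => h2 y x hx hy⟩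
      obtain ⟨l, hl, rfl⟩ := good_eq hW (by
        have := (rel_iff (W := W) ρ Fin.elim0).1 (by convert h3 using 1)
        exact (hρ _ _ _).1 this)
      refine ⟨l, hl, ⟨y, h4.1⟩, ⟨d, h4.2.1⟩, ⟨ξ, h4.2.2⟩, rfl, rfl, rfl, ?_⟩
      rw [← hφ]
      refine (rel_iff φ _).1 ?_
      convert h5 using 1
      funext i; fin_cases i <;> rfl
    · rintro ⟨l, hl, Y, D', Ξ, rfl, rfl, rfl, h⟩
      refine ⟨D'.1, V_ l, rfl, fun a => ⟨?_, ?_, ?_, ⟨?_, ?_, ?_⟩, ?_⟩⟩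
      · exact fun x hx y hy => (supT_V l).1 x hx y hy
      · exact fun b hb hs => (supT_V l).2 b a hb hs
      · change RelE zmem (V_ l) ρ _
        have := (rel_iff (W := V_ l) ρ Fin.elim0).2 ((hρ _ _ _).2 (rankE_V hl))
        convert this using 1
      · exact Y.2
      · exact D'.2
      · exact Ξ.2
      · rw [e2]
        change RelE zmem (V_ l) φ _
        have := (rel_iff φ _).2 ((hφ _ _ _).2 h)
        convert this using 1
        funext i; fin_cases i <;> rfl
  refine ⟨2, Ψ.ex.ex, ![ξ, q], .ex (.ex hΨ), ?_, ?_, ?_⟩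
  · intro i; fin_cases i
    exacts [hξ, hq]
  · exact (main x).2 ((hx x).2 rfl)
  · intro y hy
    exact (hx y).1 ((main y).1 hy)

end Paper

namespace Paper
open Ordinal Cardinal
open scoped ZFSet

/-! ### The first part of the lemma -/

/-- The situation of the lemma. -/
structure Setup (m : ℕ) (k d : Ordinal.{0}) (ψ : SetFormula 2) (q : ZFSet.{0}) : Prop where
  hk : k.card.ord = k
  hS : ShrewdO (m + 1) k
  hψ : IsSigma (m + 2) ψ
  hq : HMemE zmem q k.toZFSet
  hδ : ∀ x, Realize zmem ψ ![x, q] ↔ x = d.toZFSet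
  hkd : k ≤ d
  hmin : ∀ e : Ordinal.{0}, k ≤ e →
    SigmaDefinableSingleton (m + 2) e.toZFSet (fun x => HMemE zmem x k.toZFSet) → d ≤ e

theorem hmem_ord {k a : Ordinal.{0}} (hk : k.card.ord = k) (h : a < k) :
    HMemE zmem a.toZFSet k.toZFSet := by
  rw [hmem_iff hk]
  refine ⟨a.toZFSet, (ordE_iff'.1 (ordE_toZFSet a)).isTransitive, fun _ h => h, ?_⟩
  rw [Ordinal.card_toZFSet, ← Cardinal.lt_ord, hk]
  exact h

theorem hmem_mono {k k' : Ordinal.{0}} {x : ZFSet.{0}} (h : k ≤ k') (hx : HMemE zmem x k.toZFSet) :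
    HMemE zmem x k'.toZFSet := by
  obtain ⟨t, h1, h2, β, f, h3, h4⟩ := hx
  refine ⟨t, h1, h2, β, f, ?_, h4⟩
  obtain ⟨b, hb, rfl⟩ := Ordinal.mem_toZFSet_iff.1 h3
  exact zmem_ord.2 (hb.trans_le h)

theorem func_mem_V {l : Ordinal.{0}} (hl : SC l) {f a b : ZFSet.{0}} (ha : a ∈ V_ l) (hb : b ∈ V_ l)
    (h : IsFuncE zmem f a b) : f ∈ V_ l := by
  rw [ZFSet.mem_vonNeumann] at ha hb
  set o := max a.rank b.rank with ho
  have hol : o < l := max_lt ha hb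
  have hsub : f ⊆ V_ (Order.succ (Order.succ o)) := by
    intro p hp
    obtain ⟨x, y, hx, hy, hxy⟩ := h.1 p hp
    rw [opair_iff] at hxy
    subst hxy
    have hx' : x ∈ V_ o := ZFSet.mem_vonNeumann.2 ((ZFSet.rank_lt_of_mem hx).trans_le (le_max_left _ _))
    have hy' : y ∈ V_ o := ZFSet.mem_vonNeumann.2 ((ZFSet.rank_lt_of_mem hy).trans_le (le_max_right _ _))
    rw [mem_V_iff]
    refine ⟨_, Order.lt_succ _, ?_⟩
    intro s hs
    rw [mem_V_iff]
    refine ⟨_, Order.lt_succ _, ?_⟩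
    intro t ht
    simp only [ZFSet.pair, ZFSet.mem_insert_iff, ZFSet.mem_singleton] at hs
    rcases hs with rfl | rfl
    · rw [ZFSet.mem_singleton] at ht; rw [ht]; exact hx'
    · simp only [ZFSet.mem_insert_iff, ZFSet.mem_singleton] at ht
      rcases ht with rfl | rfl <;> assumption
  exact mem_V_iff.2 ⟨_, hl _ (hl _ hol), hsub⟩

section
variable {m : ℕ} {k d : Ordinal.{0}} {ψ : SetFormula 2} {q : ZFSet.{0}}

/-- Locally definable ordinals below `δ` are below `κ`. -/
theorem Setup.loc (S : Setup m k d ψ q) {P : Pred 3} (hP : Dfn P) {ξ a : Ordinal.{0}} (hξ : ξ < k)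
    (hx : ∀ y, LocP P y d.toZFSet ξ.toZFSet ↔ y = a.toZFSet) (ha : a < d) : a < k := by
  by_contra hn
  exact absurd ha (not_lt.2 (S.hmin a (not_lt.1 hn)
    (sig_of_loc S.hψ S.hq (hmem_ord S.hk hξ) S.hδ hP hx)))

theorem Setup.least (S : Setup m k d ψ q) {T : Pred 3} (hT : Dfn0 T)
    (hTf : ∀ f x d, T _ zmem ![f, x, d] → IsFuncE zmem f x d) {a : Ordinal.{0}} (ha : a < d)
    (hf : ∃ f, T _ zmem ![f, a.toZFSet, d.toZFSet]) :
    ∃ a' < k, a' ≤ a ∧ ∃ f, T _ zmem ![f, a'.toZFSet, d.toZFSet] := by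
  obtain ⟨φ, h0, hφ⟩ := hT.out
  let X : Set Ordinal.{0} := {a | ∃ f, T _ zmem ![f, a.toZFSet, d.toZFSet]}
  have hX : X.Nonempty := ⟨a, hf⟩
  let b := sInf X
  have hb : b ∈ X := csInf_mem hX
  have hba : b ≤ a := csInf_le' hf
  have habs : ∀ {l : Ordinal.{0}} (_ : SC l) (x D : {x // x ∈ V_ l}),
      (∃ f, Realize (vE l) φ ![f, x, D]) ↔ ∃ f, T _ zmem ![f, x.1, D.1] := by
    intro l hl x D
    have e : ∀ f : {x // x ∈ V_ l}, (fun i => ((![f, x, D] : Fin 3 → {x // x ∈ V_ l}) i).1) =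
        ![f.1, x.1, D.1] := by
      intro f; funext i; fin_cases i <;> rfl
    constructor
    · rintro ⟨f, hf⟩
      rw [delta0_abs (supT_V l).1 h0, e, hφ] at hf
      exact ⟨f.1, hf⟩
    · rintro ⟨f, hf⟩
      refine ⟨⟨f, func_mem_V hl x.2 D.2 (hTf _ _ _ hf)⟩, ?_⟩
      rw [delta0_abs (supT_V l).1 h0, e, hφ]
      exact hf
  refine ⟨b, ?_, hba, hb⟩
  refine S.loc (P := fun _ E v => E (v 0) (v 1) ∧ (∃ f, Realize E φ ![f, v 0, v 1]) ∧
    ∀ y, E y (v 0) → ¬ ∃ f, Realize E φ ![f, y, v 1]) inferInstance (ξ := 0) S.hS.limit.1 ?_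
    (hba.trans_lt ha)
  intro y
  constructor
  · rintro ⟨l, hl, Y, D, Ξ, rfl, h2, h3, h4, h5, h6⟩
    change zmem Y.1 D.1 at h4
    change ∃ f, Realize (vE l) φ ![f, Y, D] at h5
    change ∀ y, zmem y.1 Y.1 → ¬ ∃ f, Realize (vE l) φ ![f, y, D] at h6
    rw [habs hl, h2] at h5
    rw [h2] at h4
    obtain ⟨o, ho, hY⟩ := Ordinal.mem_toZFSet_iff.1 h4
    rw [← hY] at h5 h6 ⊢
    rw [toZ_inj]
    refine le_antisymm ?_ (csInf_le' h5)
    by_contra hlt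
    have hb1 : b < o := not_lt.1 (fun h => hlt (not_lt.1 (fun h' => absurd h (lt_asymm h')))) |>.lt_of_ne
      (fun h => hlt h.ge)
    have hbo : zmem b.toZFSet o.toZFSet := zmem_ord.2 hb1
    have hbV : b.toZFSet ∈ V_ l := (supT_V l).1 Y.1 Y.2 _ (hY ▸ hbo)
    refine h6 ⟨b.toZFSet, hbV⟩ hbo ?_
    rw [habs hl, h2]
    exact hb
  · rintro rfl
    obtain ⟨l, hl1, -, hl, -⟩ := reflection d
    have hbd := hba.trans_lt ha
    refine ⟨l, hl, ⟨b.toZFSet, mem_V_toZFSet.2 (hbd.trans hl1)⟩, ⟨d.toZFSet, mem_V_toZFSet.2 hl1⟩,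
      ⟨(0 : Ordinal.{0}).toZFSet, mem_V_toZFSet.2 (zero_le.trans_lt hl1)⟩, rfl, rfl, rfl,
      zmem_ord.2 hbd, ?_, ?_⟩
    · exact (habs hl _ _).2 hb
    · rintro y hy h
      obtain ⟨o, ho, hY⟩ := Ordinal.mem_toZFSet_iff.1 hy
      have h' := (habs hl _ _).1 h
      rw [← hY] at h'
      exact absurd ho (not_lt.2 (csInf_le' h'))

theorem Setup.card (S : Setup m k d ψ q) : d.card.ord = d := by
  by_contra hne
  have hlt : d.card.ord < d := lt_of_le_of_ne (Cardinal.ord_card_le d) hne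
  have hf0 : ∃ f, BijE zmem f d.card.ord.toZFSet d.toZFSet :=
    exists_bij (by rw [Ordinal.card_toZFSet, Ordinal.card_toZFSet, Cardinal.card_ord])
  obtain ⟨a, ha, -, f, hf⟩ := S.least (T := fun _ E v => BijE E (v 0) (v 1) (v 2)) inferInstance
    (fun f x d h => h.1.1) hlt hf0
  have h1 : a.toZFSet.card = d.toZFSet.card := bij_card hf
  rw [Ordinal.card_toZFSet, Ordinal.card_toZFSet] at h1
  have h2 : a.card < k.card := by rwa [← Cardinal.lt_ord, S.hk]
  exact absurd (h1 ▸ h2) (not_lt.2 (Ordinal.card_le_card S.hkd))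

theorem Setup.q_mem (S : Setup m k d ψ q) {θ : Ordinal.{0}} (hk : k ≤ θ) (hθ : θ.card.ord = θ)
    (hC : CV (m + 1) θ) : q ∈ V_ θ :=
  (hC.hmem (Nat.succ_pos m) hθ).1 (hmem_mono hk S.hq)

theorem Setup.lt (S : Setup m k d ψ q) : k < d := by
  refine lt_of_le_of_ne S.hkd ?_
  rintro rfl
  obtain ⟨θ, h1, h2, h3, h4⟩ := reflection k
  have hq := S.q_mem h1.le h2 (h4.cv _)
  have hK := mem_V_toZFSet.2 h1
  obtain ⟨k', θ', K', A', x', g1, g2, g3, -, g4, g5⟩ := S.hS.param S.hk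
    (P := fun _ E v => Realize E ψ ![v 0, v 2]) inferInstance h2 (h4.cv _) h1
    ⟨_, hK⟩ ⟨_, hK⟩ ⟨q, hq⟩ rfl (fun _ h => h) S.hq ((h4 ψ _).2 (by
      have : (fun i => ((![⟨k.toZFSet, hK⟩, ⟨q, hq⟩] : Fin 2 → {x // x ∈ V_ θ}) i).1) =
        ![k.toZFSet, q] := by funext i; fin_cases i <;> rfl
      exact (congrArg _ this).mpr ((S.hδ _).2 rfl)))
  have g6 := g2.up S.hψ _ g5
  rw [vec2_val] at g6
  change Realize zmem ψ ![K'.1, x'.1] at g6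
  rw [g4, g3, S.hδ, toZ_inj] at g6
  exact absurd g1 (by simp [g6])

theorem Setup.cof (S : Setup m k d ψ q) :
    (∃ γ, γ ∈ k.toZFSet ∧ ∃ f, CofinalMapZ f γ d.toZFSet) ∨ RegularE zmem d.toZFSet := by
  by_cases hr : RegularE zmem d.toZFSet
  · exact Or.inr hr
  left
  have : ∃ a < d, ∃ f, CofE zmem f a.toZFSet d.toZFSet := by
    unfold RegularE at hr
    simp only [ordE_toZFSet, true_and] at hr
    push Not at hr
    obtain ⟨γ, f, hγ, hf, h⟩ := hr
    obtain ⟨a, ha, rfl⟩ := Ordinal.mem_toZFSet_iff.1 hγ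
    refine ⟨a, ha, f, hf, ?_⟩
    intro β hβ
    obtain ⟨x, y, hp, hy⟩ := h β hβ
    obtain ⟨p, hpf, hpo⟩ := hp
    obtain ⟨x', y', hx', hy', hp'⟩ := hf.1 p hpf
    have heq := opair_iff.1 hpo
    rw [opair_iff.1 hp', ZFSet.pair_inj] at heq
    rw [heq.1] at hx'
    rw [heq.2] at hy'
    refine ⟨x, hx', y, ⟨p, hpf, hpo⟩, ?_⟩
    obtain ⟨b, hb, rfl⟩ := Ordinal.mem_toZFSet_iff.1 hβ
    obtain ⟨c, hc, rfl⟩ := Ordinal.mem_toZFSet_iff.1 hy'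
    rw [zmem_ord, not_lt] at hy
    unfold LeE
    rw [zmem_ord, toZ_inj]
    exact hy.lt_or_eq
  obtain ⟨a, ha, hf⟩ := this
  obtain ⟨b, hb, -, f, hf1, hf2⟩ := S.least (T := fun _ E v => CofE E (v 0) (v 1) (v 2)) inferInstance
    (fun f x d h => h.1) ha hf
  refine ⟨b.toZFSet, zmem_ord.2 hb, f, hf1, fun β hβ => ?_⟩
  obtain ⟨x, hx, y, hp, hl⟩ := hf2 β hβ
  exact ⟨x, y, hx, hp, hl⟩

end

end Paper

namespace Paper
open Ordinal Cardinal
open scoped ZFSet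

/-! ### Eliminating ordinal parameters -/

/-- Assignment with the `0`-th entry replaced by `z`, extended by `b`. -/
def updT {M : Type*} {N : ℕ} (v : Fin (2 + N) → M) (b z : M) : Fin (2 + N + 1) → M :=
  Fin.snoc (fun i => if i = Fin.castAdd N 0 then z else v i) b

theorem updT_append {M : Type*} {N : ℕ} (y d b z : M) (p : Fin N → M) :
    updT (Fin.append ![y, d] p) b z = Fin.append ![z, d] (Fin.snoc p b : Fin (N + 1) → M) := by
  rw [Fin.append_snoc]
  unfold updT
  congr 1
  funext i
  refine Fin.addCases (fun j => ?_) (fun j => ?_) i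
  · rw [Fin.append_left, Fin.append_left]
    by_cases h : j = 0
    · subst h; simp
    · have h1 : j = 1 := by omega
      subst h1
      rw [if_neg (by simp [Fin.ext_iff])]
      rfl
  · rw [Fin.append_right, Fin.append_right, if_neg]
    simp [Fin.ext_iff]

theorem od_min {U : Pred 2} (hU : Dfn U) (d : ZFSet.{0}) : ∀ (N : ℕ) (φ : SetFormula (2 + N))
    (p : Fin N → Ordinal.{0}) (x : ZFSet.{0}), U _ zmem ![x, d] →
    (∀ y, Realize zmem φ (Fin.append ![y, d] (fun i => (p i).toZFSet)) ↔ y = x) →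
    ∃ (χ : SetFormula 2) (x : ZFSet.{0}), U _ zmem ![x, d] ∧
      ∀ y, Realize zmem χ ![y, d] ↔ y = x
  | 0, φ, p, x, hx, h => by
    refine ⟨φ, x, hx, fun y => ?_⟩
    rw [← h y]
    have : (fun i => (p i).toZFSet) = Fin.elim0 := funext fun i => i.elim0
    rw [this, Fin.append_elim0]; rfl
  | N + 1, φ, p, x, hx, h => by
    let D : ∀ (M : Type 1) (_ : M → M → Prop), (Fin (2 + N) → M) → M → M → Prop :=
      fun M E v b y => U M E ![y, v (Fin.castAdd N 1)] ∧
        ∀ z, Realize E φ (updT v b z) ↔ z = y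
    have hD : ∀ {l : ℕ} (σ : Fin (2 + N) → Fin l) (j k : Fin l),
        Dfn (fun M E w => D M E (fun i => w (σ i)) (w j) (w k)) := by
      intro l σ j k
      have h1 : Dfn (k := l) (fun M E w => U M E ![w k, w (σ (Fin.castAdd N 1))]) :=
        (hU.ren (![k, σ (Fin.castAdd N 1)] : Fin 2 → Fin l)).congr fun M E v => by
          have : (fun i => v ((![k, σ (Fin.castAdd N 1)] : Fin 2 → Fin l) i)) =
              ![v k, v (σ (Fin.castAdd N 1))] := by funext i; fin_cases i <;> rfl
          rw [this]
      have h2 : Dfn (k := l + 1) (fun M E w => Realize E φ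
          (updT (fun i => w (σ i).castSucc) (w j.castSucc) (w (Fin.last l)))) :=
        (Dfn.realize φ (updT (fun i => (σ i).castSucc) j.castSucc (Fin.last l))).congr
          fun M E v => by
            have : (fun i => v (updT (fun i => (σ i).castSucc) j.castSucc (Fin.last l) i)) =
              updT (fun i => v (σ i).castSucc) (v j.castSucc) (v (Fin.last l)) := by
              funext i
              refine Fin.lastCases ?_ (fun i => ?_) i
              · simp [updT]
              · simp only [updT, Fin.snoc_castSucc]
                split_ifs <;> rfl
            exact iff_of_eq (congrArg (Realize E φ) this)
      have h3 : Dfn (k := l) (fun M E w => ∀ z, Realize E φ (updT (fun i => w (σ i)) (w j) z) ↔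
          z = w k) := inferInstance
      exact Dfn.and (h1 := h1) (h2 := h3)
    have hQ : Dfn (k := 2 + N) (fun M E v => ∃ b, OrdE E b ∧ D M E v b (v (Fin.castAdd N 0)) ∧
        ∀ b', E b' b → ¬ ∃ y, D M E v b' y) := by
      have a1 := hD (l := 2 + N + 1) (fun i => i.castSucc) (Fin.last _) (Fin.castAdd N 0).castSucc
      have a2 := hD (l := 2 + N + 1 + 1 + 1) (fun i => i.castSucc.castSucc.castSucc)
        (Fin.last _).castSucc (Fin.last _)
      have a3 : Dfn (k := 2 + N + 1 + 1) (fun M E v => ∃ y, D M E (fun i => v i.castSucc.castSucc)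
        (v (Fin.last _)) y) := Dfn.ex (h := a2)
      have a4 : Dfn (k := 2 + N + 1) (fun M E v => ∀ b', E b' (v (Fin.last _)) → ¬ ∃ y, D M E
        (fun i => v i.castSucc) b' y) := Dfn.all (P := fun M E v b' => E b' (v (Fin.last _)) → ¬ ∃ y, D M E
        (fun i => v i.castSucc) b' y) (h := Dfn.imp (h2 := Dfn.not (h1 := a3)))
      exact Dfn.ex (P := fun M E v b => OrdE E b ∧ D M E v b (v (Fin.castAdd N 0)) ∧
        ∀ b', E b' b → ¬ ∃ y, D M E v b' y) (h := Dfn.and (h2 := Dfn.and (h1 := a1) (h2 := a4)))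
    obtain ⟨φ', hφ'⟩ := hQ.out
    let p0 : Fin N → ZFSet.{0} := fun i => (p i.castSucc).toZFSet
    have hDv : ∀ y0 b y, D _ zmem (Fin.append ![y0, d] p0) b y ↔ (U _ zmem ![y, d] ∧
        ∀ z, Realize zmem φ (Fin.append ![z, d] (Fin.snoc p0 b : Fin (N + 1) → ZFSet.{0})) ↔ z = y) := by
      intro y0 b y
      simp only [D, updT_append, Fin.append_left]
      rfl
    let X : Set Ordinal.{0} := {b | ∃ y, U _ zmem ![y, d] ∧
        ∀ z, Realize zmem φ (Fin.append ![z, d] (Fin.snoc p0 b.toZFSet : Fin (N + 1) → ZFSet.{0})) ↔ z = y}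
    have hX : X.Nonempty := by
      refine ⟨p (Fin.last N), x, hx, fun z => ?_⟩
      rw [← h z]
      have : (Fin.snoc p0 (p (Fin.last N)).toZFSet : Fin (N + 1) → ZFSet.{0}) =
          fun i => (p i).toZFSet := by
        funext i
        refine Fin.lastCases ?_ (fun i => ?_) i <;> simp [p0]
      rw [this]
    obtain ⟨x', hx', hu⟩ := csInf_mem hX
    refine od_min hU d N φ' (fun i => p i.castSucc) x' hx' fun y => ?_
    rw [hφ']
    have e0 : Fin.append ![y, d] p0 (Fin.castAdd N 0) = y := by rw [Fin.append_left]; rfl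
    change (∃ b, OrdE zmem b ∧ D _ zmem (Fin.append ![y, d] p0) b
      (Fin.append ![y, d] p0 (Fin.castAdd N 0)) ∧ ∀ b', zmem b' b →
        ¬ ∃ y', D _ zmem (Fin.append ![y, d] p0) b' y') ↔ _
    rw [e0]
    simp only [hDv]
    constructor
    · rintro ⟨b, hb, ⟨hb1, hb2⟩, hb3⟩
      obtain ⟨β, rfl⟩ := ordE_iff.1 hb
      have : β = sInf X := by
        refine le_antisymm ?_ (csInf_le' ⟨y, hb1, hb2⟩)
        by_contra hlt
        exact hb3 (sInf X).toZFSet (zmem_ord.2 (not_le.1 hlt)) ⟨x', hx', hu⟩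
      subst this
      exact (hu y).1 ((hb2 y).2 rfl)
    · rintro rfl
      refine ⟨(sInf X).toZFSet, ordE_toZFSet _, ⟨hx', hu⟩, ?_⟩
      rintro b' hb' ⟨w, hw⟩
      obtain ⟨β, hβ, rfl⟩ := Ordinal.mem_toZFSet_iff.1 hb'
      exact absurd hβ (not_lt.2 (csInf_le' ⟨w, hw⟩))

/-! ### The least level at which something is definable -/

/-- Formula expressing that every set has a rank. -/
noncomputable def rhoF : SetFormula 0 := (Dfn.rankE (k := 0)).out.choose

theorem rhoF_spec (M : Type 1) (E : M → M → Prop) (v) : Realize E rhoF v ↔ RankE E :=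
  (Dfn.rankE (k := 0)).out.choose_spec M E v

/-- `W` is a level `V_λ` with `λ` a limit. -/
def GoodE {M : Type*} (E : M → M → Prop) (W : M) : Prop :=
  TransE E W ∧ (∀ a b, E b W → SubE E a b → E a W) ∧ RelE E W rhoF Fin.elim0

instance Dfn.goodE {k : ℕ} (i : Fin k) : Dfn (fun _ E v => GoodE E (v i)) := by
  refine Dfn.congr (P := fun _ E v => TransE E (v i) ∧ (∀ a b, E b (v i) → SubE E a b → E a (v i)) ∧
    RelE E (v i) rhoF (fun t => v ((Fin.elim0 : Fin 0 → Fin k) t))) inferInstance fun M E v => ?_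
  have : (fun t => v ((Fin.elim0 : Fin 0 → Fin k) t)) = Fin.elim0 := funext fun i => i.elim0
  rw [this]; rfl

theorem rel_abs {l : Ordinal.{0}} {k : ℕ} (φ : SetFormula k) (W : {x // x ∈ V_ l})
    (v : Fin k → {x // x ∈ V_ l}) :
    RelE (vE l) W φ v ↔ RelE zmem W.1 φ (fun i => (v i).1) := by
  have h : Dfn0 (k := k + 1) (fun _ E v => RelE E (v (Fin.last k)) φ (fun i => v (Fin.castSucc i))) :=
    inferInstance
  have := h.abs (E := zmem) (S := fun x => x ∈ V_ l) (supT_V l).1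
    (Fin.snoc v W : Fin (k + 1) → {x // x ∈ V_ l})
  simp only [Fin.snoc_last, Fin.snoc_castSucc] at this
  exact this

theorem goodE_iff {l : Ordinal.{0}} (W : {x // x ∈ V_ l}) :
    GoodE (vE l) W ↔ ∃ a, SC a ∧ W.1 = V_ a := by
  have e0 : ∀ w : Fin 0 → ZFSet.{0}, w = Fin.elim0 := fun w => funext fun i => i.elim0
  constructor
  · rintro ⟨h1, h2, h3⟩
    have t1 : ∀ x, x ∈ W.1 → x ∈ V_ l := fun x hx => (supT_V l).1 _ W.2 _ hx
    have hW : SupT (fun x => x ∈ W.1) := by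
      refine ⟨fun x hx y hy => ?_, fun x y hx hy => ?_⟩
      · exact h1 ⟨x, t1 x hx⟩ hx ⟨y, (supT_V l).1 _ (t1 x hx) _ hy⟩ hy
      · exact h2 ⟨y, (supT_V l).2 _ _ (t1 x hx) hy⟩ ⟨x, t1 x hx⟩ hx (fun z hz => hy hz)
    refine good_eq hW ?_
    rw [rel_abs] at h3
    rw [← rhoF_spec _ _ Fin.elim0, ← rel_iff]
    rw [e0 (fun _ => _)] at h3 ⊢
    exact h3
  · rintro ⟨a, ha, hW⟩
    refine ⟨fun x hx y hy => ?_, fun x y hy hs => ?_, ?_⟩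
    · change x.1 ∈ W.1 at hx
      change y.1 ∈ W.1
      rw [hW] at hx ⊢
      exact (supT_V a).1 _ hx _ hy
    · change y.1 ∈ W.1 at hy
      change x.1 ∈ W.1
      rw [hW] at hy ⊢
      rw [subE_abs (supT_V l).1] at hs
      exact (supT_V a).2 _ _ hy hs
    · rw [rel_abs, hW]
      have := (rel_iff (W := V_ a) rhoF Fin.elim0).2 ((rhoF_spec _ _ _).2 (rankE_V ha))
      rw [e0 (fun _ => _)] at this ⊢
      exact this

/-- `V_l` satisfies `χ(x, d)`. -/
def SatV (χ : SetFormula 2) (l : Ordinal.{0}) (x d : ZFSet.{0}) : Prop :=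
  ∃ (hx : x ∈ V_ l) (hd : d ∈ V_ l), Realize (vE l) χ ![⟨x, hx⟩, ⟨d, hd⟩]

/-- `χ(x, d)` holds in the least possible level. -/
def LeastE (χ : SetFormula 2) {M : Type*} (E : M → M → Prop) (x d : M) : Prop :=
  ∃ W, GoodE E W ∧ E x W ∧ E d W ∧ RelE E W χ ![x, d] ∧
    ∀ W', E W' W → GoodE E W' → ∀ x', E x' W' → E d W' → ¬ RelE E W' χ ![x', d]

theorem dfn_vec2 {k : ℕ} {P : ∀ (M : Type 1) (_ : M → M → Prop), (Fin 2 → M) → M → Prop}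
    (i j t : Fin k) (h : Dfn (k := k) (fun M E v => P M E (fun s => v ((![i, j] : Fin 2 → Fin k) s)) (v t))) :
    Dfn (fun M E v => P M E ![v i, v j] (v t)) := by
  refine h.congr fun M E v => ?_
  have : (fun s => v ((![i, j] : Fin 2 → Fin k) s)) = ![v i, v j] := by
    funext i; fin_cases i <;> rfl
  rw [this]

instance Dfn.rel2 {k : ℕ} (χ : SetFormula 2) (i j t : Fin k) :
    Dfn (fun _ E v => RelE E (v t) χ ![v i, v j]) :=
  dfn_vec2 (P := fun M E w t => RelE E t χ w) i j t inferInstance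

instance Dfn.leastE {k : ℕ} (χ : SetFormula 2) (i j : Fin k) :
    Dfn (fun _ E v => LeastE χ E (v i) (v j)) := by
  unfold LeastE; infer_instance

theorem rel_sat {χ : SetFormula 2} {a : Ordinal.{0}} {x d : ZFSet.{0}} (hx : x ∈ V_ a) (hd : d ∈ V_ a) :
    RelE zmem (V_ a) χ ![x, d] ↔ SatV χ a x d := by
  have := rel_iff χ (![⟨x, hx⟩, ⟨d, hd⟩] : Fin 2 → {x // x ∈ V_ a})
  rw [vec2_val] at this
  exact this.trans ⟨fun h => ⟨hx, hd, h⟩, fun ⟨_, _, h⟩ => h⟩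

theorem V_mem_V {a b : Ordinal.{0}} : (V_ a) ∈ V_ b ↔ a < b := by
  rw [ZFSet.mem_vonNeumann, ZFSet.rank_vonNeumann]

theorem leastE_iff {χ : SetFormula 2} {l : Ordinal.{0}} (x d : {x // x ∈ V_ l}) :
    LeastE χ (vE l) x d ↔ ∃ a < l, SC a ∧ SatV χ a x.1 d.1 ∧
      ∀ b < a, SC b → ∀ x', ¬ SatV χ b x' d.1 := by
  constructor
  · rintro ⟨W, h1, h2, h3, h4, h5⟩
    obtain ⟨a, ha, hW⟩ := (goodE_iff W).1 h1
    have hal : a < l := by have := W.2; rw [hW, V_mem_V] at this; exact this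
    change x.1 ∈ W.1 at h2
    change d.1 ∈ W.1 at h3
    rw [rel_abs, vec2_val, hW] at h4
    rw [hW] at h2 h3
    refine ⟨a, hal, ha, (rel_sat h2 h3).1 h4, ?_⟩
    intro b hb hSb x' hx'
    obtain ⟨k1, k2, k3⟩ := hx'
    refine h5 ⟨V_ b, V_mem_V.2 (hb.trans hal)⟩ ?_ ((goodE_iff _).2 ⟨b, hSb, rfl⟩)
      ⟨x', (supT_V l).1 _ (V_mem_V.2 (hb.trans hal)) _ k1⟩ k1 k2 ?_
    · change V_ b ∈ W.1; rw [hW, V_mem_V]; exact hb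
    · rw [rel_abs, vec2_val]
      exact (rel_sat k1 k2).2 ⟨k1, k2, k3⟩
  · rintro ⟨a, hal, ha, h4, h5⟩
    obtain ⟨k1, k2, k3⟩ := h4
    refine ⟨⟨V_ a, V_mem_V.2 hal⟩, (goodE_iff _).2 ⟨a, ha, rfl⟩, k1, k2, ?_, ?_⟩
    · rw [rel_abs, vec2_val]
      exact (rel_sat k1 k2).2 ⟨k1, k2, k3⟩
    · intro W' hW' hg x' hx' hd' hr
      obtain ⟨b, hb, hWb⟩ := (goodE_iff W').1 hg
      change W'.1 ∈ V_ a at hW'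
      change x'.1 ∈ W'.1 at hx'
      change d.1 ∈ W'.1 at hd'
      rw [rel_abs, vec2_val, hWb] at hr
      rw [hWb] at hW' hx' hd'
      exact h5 b (V_mem_V.1 hW') hb x'.1 ((rel_sat hx' hd').1 hr)

/-- Canonical choice of a set defined at the least possible level. -/
theorem exists_least {U : Pred 2} (hU : Dfn0 U) {d x : ZFSet.{0}} {χ : SetFormula 2}
    (hx : U _ zmem ![x, d]) (h : ∀ y, Realize zmem χ ![y, d] ↔ y = x) :
    ∃ (χ' : SetFormula 2) (x0 : ZFSet.{0}) (a : Ordinal.{0}), U _ zmem ![x0, d] ∧ x0 ∈ V_ a ∧ d ∈ V_ a ∧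
      (∀ {l : Ordinal.{0}} (X D : {x // x ∈ V_ l}), D.1 = d → LeastE χ' (vE l) X D → X.1 = x0) ∧
      ∀ {l : Ordinal.{0}} (X D : {x // x ∈ V_ l}), D.1 = d → X.1 = x0 → a < l →
        LeastE χ' (vE l) X D := by
  have hQ : Dfn (k := 2) (fun M E v => U M E v ∧ Realize E χ ![v 0, v 1] ∧
      ∀ y, Realize E χ ![y, v 1] → y = v 0) := by
    have : Dfn U := Dfn.of0
    infer_instance
  obtain ⟨χ', hχ'⟩ := hQ.out
  have hUabs : ∀ {l : Ordinal.{0}} (X D : {x // x ∈ V_ l}), U _ (vE l) ![X, D] ↔ U _ zmem ![X.1, D.1] := by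
    intro l X D
    have := hU.abs (E := zmem) (supT_V l).1 ![X, D]
    rw [vec2_val] at this
    exact this
  let X : Set Ordinal.{0} := {a | SC a ∧ ∃ y, SatV χ' a y d}
  have hX : X.Nonempty := by
    obtain ⟨θ, h1, h2, h3, h4⟩ := reflection (max x.rank d.rank)
    have hxθ : x ∈ V_ θ := ZFSet.mem_vonNeumann.2 ((le_max_left _ _).trans_lt h1)
    have hdθ : d ∈ V_ θ := ZFSet.mem_vonNeumann.2 ((le_max_right _ _).trans_lt h1)
    refine ⟨θ, h3, x, hxθ, hdθ, ?_⟩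
    rw [h4, vec2_val, hχ']
    exact ⟨hx, (h x).2 rfl, fun y hy => (h y).1 hy⟩
  obtain ⟨hSa, x0, k1, k2, k3⟩ := csInf_mem hX
  have k4 := (hχ' _ _ _).1 k3
  refine ⟨χ', x0, sInf X, (hUabs _ _).1 k4.1, k1, k2, ?_, ?_⟩
  · rintro l Y D rfl hL
    obtain ⟨a, hal, ha, hs, hm⟩ := (leastE_iff _ _).1 hL
    have : a = sInf X := by
      refine le_antisymm ?_ (csInf_le' ⟨ha, _, hs⟩)
      by_contra hlt
      exact hm _ (not_le.1 hlt) hSa x0 ⟨k1, k2, k3⟩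
    subst this
    obtain ⟨j1, j2, j3⟩ := hs
    have j4 := (hχ' _ _ _).1 j3
    have := k4.2.2 _ j4.2.1
    exact congrArg Subtype.val this
  · rintro l Y D rfl rfl hl
    rw [leastE_iff]
    refine ⟨_, hl, hSa, ⟨k1, k2, k3⟩, ?_⟩
    intro b hb hSb x' hx'
    exact absurd hb (not_lt.2 (csInf_le' ⟨hSb, x', hx'⟩))

end Paper

namespace Paper
open Ordinal Cardinal
open scoped ZFSet

/-! ### Basic facts about `HOD` -/

theorem od_ord (o : Ordinal.{0}) : IsODE zmem o.toZFSet :=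
  ⟨1, .eq 0 1, ![o.toZFSet], fun i => by fin_cases i; exact ordE_toZFSet o, rfl, fun _ h => h⟩

theorem hod_ord (o : Ordinal.{0}) : IsHODE zmem o.toZFSet := by
  refine ⟨od_ord o, fun z hz => ?_⟩
  have := hz o.toZFSet (ordE_toZFSet o).1 (fun _ h => h)
  obtain ⟨a, -, rfl⟩ := Ordinal.mem_toZFSet_iff.1 this
  exact od_ord a

theorem hod_trans : ∀ x, IsHODE zmem x → ∀ y, zmem y x → IsHODE zmem y := by
  intro x hx y hy
  refine ⟨hx.2 y fun t _ h2 => h2 y hy, fun z hz => hx.2 z fun t h1 h2 => ?_⟩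
  exact hz t h1 fun w hw => h1 y (h2 y hy) w hw

/-- `x` is a pair consisting of a sequence and a club set violating subtlety of `d`. -/
def UE {M : Type*} (E : M → M → Prop) (x d : M) : Prop :=
  ∃ t, E t x ∧ ∃ f, E f t ∧ ∃ s, E s x ∧ ∃ c, E c s ∧ OPairE E x f c ∧ CexE E f c d

theorem ue_iff {x d : ZFSet.{0}} :
    UE zmem x d ↔ ∃ f c, x = ZFSet.pair f c ∧ CexE zmem f c d := by
  constructor
  · rintro ⟨t, -, f, -, s, -, c, -, h1, h2⟩
    exact ⟨f, c, opair_iff.1 h1, h2⟩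
  · rintro ⟨f, c, rfl, h⟩
    refine ⟨{f, c}, ?_, f, ?_, {f, c}, ?_, c, ?_, opair_iff.2 rfl, h⟩ <;>
      simp [zmem, ZFSet.pair]

theorem od_pair {f c : ZFSet.{0}} (hf : IsODE zmem f) (hc : IsODE zmem c) (d : ZFSet.{0}) :
    ∃ (N : ℕ) (φ : SetFormula (2 + N)) (p : Fin N → Ordinal.{0}),
      ∀ y, Realize zmem φ (Fin.append ![y, d] (fun i => (p i).toZFSet)) ↔ y = ZFSet.pair f c := by
  obtain ⟨k1, φ1, p1, a1, a2, a3⟩ := hf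
  obtain ⟨k2, φ2, p2, b1, b2, b3⟩ := hc
  choose o1 ho1 using fun i => ordE_iff.1 (a1 i)
  choose o2 ho2 using fun i => ordE_iff.1 (b1 i)
  let σ1 : Fin (k1 + 1) → Fin (2 + (k1 + k2) + 1 + 1) :=
    Fin.cons (Fin.last _).castSucc (fun i => (Fin.natAdd 2 (Fin.castAdd k2 i)).castSucc.castSucc)
  let σ2 : Fin (k2 + 1) → Fin (2 + (k1 + k2) + 1 + 1) :=
    Fin.cons (Fin.last _) (fun i => (Fin.natAdd 2 (Fin.natAdd k1 i)).castSucc.castSucc)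
  have hD : Dfn (k := 2 + (k1 + k2) + 1 + 1) (fun M E w =>
    OPairE E (w (Fin.castAdd (k1 + k2) 0).castSucc.castSucc) (w (Fin.last _).castSucc) (w (Fin.last _)) ∧
      Realize E φ1 (fun i => w (σ1 i)) ∧ Realize E φ2 (fun i => w (σ2 i))) := inferInstance
  obtain ⟨Φ, hΦ⟩ := hD.out
  refine ⟨k1 + k2, Φ.ex.ex, Fin.append o1 o2, fun y => ?_⟩
  simp only [realize_ex, hΦ]
  have e1 : ∀ x z : ZFSet.{0}, (fun i => (Fin.snoc (Fin.snoc (Fin.append ![y, d]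
      (fun i => (Fin.append o1 o2 i).toZFSet)) x : Fin (2 + (k1 + k2) + 1) → ZFSet.{0}) z :
      Fin (2 + (k1 + k2) + 1 + 1) → ZFSet.{0}) (σ1 i)) = Fin.cons x p1 := by
    intro x z
    funext i
    refine Fin.cases ?_ (fun i => ?_) i
    · simp [σ1]
    · simp only [σ1, Fin.cons_succ, Fin.snoc_castSucc]
      rw [Fin.append_right, Fin.append_left, ho1]
  have e2 : ∀ x z : ZFSet.{0}, (fun i => (Fin.snoc (Fin.snoc (Fin.append ![y, d]
      (fun i => (Fin.append o1 o2 i).toZFSet)) x : Fin (2 + (k1 + k2) + 1) → ZFSet.{0}) z :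
      Fin (2 + (k1 + k2) + 1 + 1) → ZFSet.{0}) (σ2 i)) = Fin.cons z p2 := by
    intro x z
    funext i
    refine Fin.cases ?_ (fun i => ?_) i
    · simp [σ2]
    · simp only [σ2, Fin.cons_succ, Fin.snoc_castSucc]
      rw [Fin.append_right, Fin.append_right, ho2]
  simp only [e1, e2]
  simp only [Fin.snoc_castSucc, Fin.snoc_last, Fin.append_left]
  change (∃ a b, OPairE zmem y a b ∧ _) ↔ _
  constructor
  · rintro ⟨a, b, h1, h2, h3⟩
    rw [opair_iff.1 h1, a3 _ h2, b3 _ h3]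
  · rintro rfl
    exact ⟨f, c, opair_iff.2 rfl, a2, b2⟩

theorem opair_abs {l : Ordinal.{0}} (x f c : {x // x ∈ V_ l}) :
    OPairE (vE l) x f c ↔ x.1 = ZFSet.pair f.1 c.1 := by
  rw [← opair_iff]
  have h : Dfn0 (k := 3) (fun _ E v => OPairE E (v 0) (v 1) (v 2)) := inferInstance
  exact h.abs (E := zmem) (supT_V l).1 ![x, f, c]

theorem pair_mem_V {l : Ordinal.{0}} {f c : ZFSet.{0}} (h : ZFSet.pair f c ∈ V_ l) :
    f ∈ V_ l ∧ c ∈ V_ l := by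
  rw [ZFSet.mem_vonNeumann] at *
  rw [ZFSet.mem_vonNeumann]
  exact ⟨(pair_rank_left f c).trans h, (pair_rank_right f c).trans h⟩

section
variable {m : ℕ} {k d : Ordinal.{0}} {ψ : SetFormula 2} {q : ZFSet.{0}}

/-- No canonically definable pair violates subtlety. -/
theorem Setup.no_cex (S : Setup m k d ψ q) {f c : ZFSet.{0}} {a0 : Ordinal.{0}} {χ : SetFormula 2}
    (hC : CexE zmem f c d.toZFSet) (hx0 : ZFSet.pair f c ∈ V_ a0) (hd0 : d.toZFSet ∈ V_ a0)
    (hL1 : ∀ {l : Ordinal.{0}} (X D : {x // x ∈ V_ l}), D.1 = d.toZFSet → LeastE χ (vE l) X D →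
      X.1 = ZFSet.pair f c)
    (hL2 : ∀ {l : Ordinal.{0}} (X D : {x // x ∈ V_ l}), D.1 = d.toZFSet → X.1 = ZFSet.pair f c →
      a0 < l → LeastE χ (vE l) X D) : False := by
  obtain ⟨hseq, ⟨hcd, hcu, hcc⟩, hno⟩ := hC
  have hda : d < a0 := mem_V_toZFSet.1 hd0
  have hkd := S.lt
  have hup : ∀ {l : Ordinal.{0}}, a0 < l → ZFSet.pair f c ∈ V_ l := fun h => by
    rw [ZFSet.mem_vonNeumann] at *
    exact hx0.trans h
  -- the club set is unbounded in `κ`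
  have hub : ∀ ξ < k, ∃ a < k, a.toZFSet ∈ c ∧ ξ < a := by
    intro ξ hξ
    let X : Set Ordinal.{0} := {a | a.toZFSet ∈ c ∧ ξ < a}
    have hX : X.Nonempty := by
      obtain ⟨β, hβ, h⟩ := hcu ξ.toZFSet (zmem_ord.2 (hξ.trans hkd))
      obtain ⟨b, hb, rfl⟩ := Ordinal.mem_toZFSet_iff.1 (hcd β hβ)
      exact ⟨b, hβ, zmem_ord.1 h⟩
    have hm := csInf_mem hX
    have had : sInf X < d := zmem_ord.1 (hcd _ hm.1)
    refine ⟨sInf X, ?_, hm.1, hm.2⟩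
    refine S.loc (P := fun _ E v => ∃ X f c, LeastE χ E X (v 1) ∧ OPairE E X f c ∧ E (v 0) c ∧
      E (v 2) (v 0) ∧ ∀ z, E z (v 0) → E z c → ¬ E (v 2) z) inferInstance hξ ?_ had
    intro y
    constructor
    · rintro ⟨l, hl, Y, D, Ξ, rfl, h2, h3, X', F, C, h4, h5, h6, h7, h8⟩
      have e1 := hL1 X' D h2 h4
      rw [opair_abs] at h5
      rw [h5, ZFSet.pair_inj] at e1
      change Y.1 ∈ C.1 at h6
      change Ξ.1 ∈ Y.1 at h7
      change ∀ z : {x // x ∈ V_ l}, z.1 ∈ Y.1 → z.1 ∈ C.1 → ¬ Ξ.1 ∈ z.1 at h8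
      rw [e1.2] at h6 h8
      rw [h3] at h7 h8
      obtain ⟨o, ho, hY⟩ := Ordinal.mem_toZFSet_iff.1 (hcd _ h6)
      rw [← hY] at h6 h7 h8 ⊢
      rw [toZ_inj]
      refine le_antisymm ?_ (csInf_le' ⟨h6, zmem_ord.1 h7⟩)
      by_contra hlt
      have hb1 : sInf X < o := not_le.1 hlt
      have hbo : (sInf X).toZFSet ∈ o.toZFSet := zmem_ord.2 hb1
      have hbV : (sInf X).toZFSet ∈ V_ l := (supT_V l).1 Y.1 Y.2 _ (hY ▸ hbo)
      exact h8 ⟨_, hbV⟩ hbo hm.1 (zmem_ord.2 hm.2)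
    · rintro rfl
      obtain ⟨l, hl1, -, hl, -⟩ := reflection a0
      have hdl := hda.trans hl1
      obtain ⟨hfV, hcV⟩ := pair_mem_V (hup hl1)
      refine ⟨l, hl, ⟨_, mem_V_toZFSet.2 (had.trans hdl)⟩, ⟨d.toZFSet, mem_V_toZFSet.2 hdl⟩,
        ⟨ξ.toZFSet, mem_V_toZFSet.2 ((hξ.trans hkd).trans hdl)⟩, rfl, rfl, rfl,
        ⟨_, hup hl1⟩, ⟨f, hfV⟩, ⟨c, hcV⟩, hL2 _ _ rfl rfl hl1, (opair_abs _ _ _).2 rfl, hm.1,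
        zmem_ord.2 hm.2, ?_⟩
      intro z hz hzc hzx
      obtain ⟨o, ho, hY⟩ := Ordinal.mem_toZFSet_iff.1 hz
      change z.1 ∈ c at hzc
      change ξ.toZFSet ∈ z.1 at hzx
      rw [← hY] at hzc hzx
      exact absurd ho (not_lt.2 (csInf_le' ⟨hzc, zmem_ord.1 hzx⟩))
  have hkc : k.toZFSet ∈ c := by
    refine hcc k.toZFSet (zmem_ord.2 hkd) ⟨(0 : Ordinal.{0}).toZFSet, zmem_ord.2 S.hS.limit.1⟩ ?_
    intro α hα
    obtain ⟨ξ, hξ, rfl⟩ := Ordinal.mem_toZFSet_iff.1 hα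
    obtain ⟨a, ha, hac, hxa⟩ := hub ξ hξ
    exact ⟨_, hac, zmem_ord.2 hxa, zmem_ord.2 ha⟩
  obtain ⟨A, hA, hAk⟩ := (hseq k.toZFSet (zmem_ord.2 hkd)).1
  obtain ⟨θ, h1, h2, h3, h4⟩ := reflection a0
  have hdθ := hda.trans h1
  have hkθ := hkd.trans hdθ
  have hq := S.q_mem hkθ.le h2 (h4.cv _)
  have hK := mem_V_toZFSet.2 hkθ
  have hAV : A ∈ V_ θ := (supT_V θ).2 _ _ hK hAk
  obtain ⟨hfV, hcV⟩ := pair_mem_V (hup h1)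
  obtain ⟨k', θ', K', A', x', g1, g2, g3, gA, g4, D, X, F, C, g5, g6, g7, g8, g9⟩ := S.hS.param S.hk
    (P := fun _ E v => ∃ D X f c, Realize E ψ ![D, v 2] ∧ LeastE χ E X D ∧ OPairE E X f c ∧
      E (v 0) c ∧ PairMemE E f (v 0) (v 1)) inferInstance h2 (h4.cv _) hkθ
    ⟨_, hK⟩ ⟨A, hAV⟩ ⟨q, hq⟩ rfl hAk S.hq
    ⟨⟨d.toZFSet, mem_V_toZFSet.2 hdθ⟩, ⟨_, hup h1⟩, ⟨f, hfV⟩, ⟨c, hcV⟩, by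
      rw [h4, vec2_val]
      exact (S.hδ _).2 rfl, hL2 _ _ rfl rfl h1, (opair_abs _ _ _).2 rfl, hkc, by
      rw [pairMem_abs (supT_V θ).1]
      exact hA⟩
  have g10 := g2.up S.hψ _ g5
  rw [vec2_val] at g10
  change Realize zmem ψ ![D.1, x'.1] at g10
  rw [g4, S.hδ] at g10
  have e1 := hL1 X D g10 g6
  rw [opair_abs] at g7
  rw [g7, ZFSet.pair_inj] at e1
  change K'.1 ∈ C.1 at g8
  rw [pairMem_abs (supT_V θ').1] at g9
  change PairMemE zmem F.1 K'.1 A'.1 at g9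
  rw [e1.2, g3] at g8
  rw [e1.1, g3] at g9
  refine hno ⟨k'.toZFSet, g8, k.toZFSet, hkc, zmem_ord.2 g1, A'.1, g9, A, hA, ?_⟩
  exact fun z => gA z

theorem Setup.subtle (S : Setup m k d ψ q) : IsSubtleInHOD d.toZFSet := by
  refine ⟨hod_ord d, ⟨⟨?_, ?_⟩, ?_⟩, ?_⟩
  · have h : Dfn0 (k := 1) (fun _ E v => OrdE E (v 0)) := inferInstance
    exact (h.abs (E := zmem) hod_trans ![⟨d.toZFSet, hod_ord d⟩]).2 (ordE_toZFSet d)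
  · rintro α hα ⟨f, hf⟩
    have h : Dfn0 (k := 3) (fun _ E v => BijE E (v 0) (v 1) (v 2)) := inferInstance
    have hf' := (h.abs (E := zmem) hod_trans ![f, α, ⟨d.toZFSet, hod_ord d⟩]).1 hf
    exact (cardE_iff.2 S.card).2 α.1 hα ⟨f.1, hf'⟩
  · have h : Dfn0 (k := 1) (fun _ E v => InfiniteOrdE E (v 0)) := inferInstance
    refine (h.abs (E := zmem) hod_trans ![⟨d.toZFSet, hod_ord d⟩]).2 ?_
    change InfiniteOrdE zmem d.toZFSet
    have hlim : ∀ {o : Ordinal.{0}}, LimitE zmem o.toZFSet ↔ 0 < o ∧ SC o := by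
      intro o
      unfold LimitE
      rw [all_mem_ord]
      simp only [ex_mem_ord, zmem_ord, ordE_toZFSet, true_and]
      refine and_congr ⟨?_, ?_⟩ ⟨?_, ?_⟩
      · rintro ⟨w, hw⟩
        obtain ⟨a, ha, -⟩ := Ordinal.mem_toZFSet_iff.1 hw
        exact zero_le.trans_lt ha
      · exact fun h => ⟨_, zmem_ord.2 h⟩
      · intro h a ha
        obtain ⟨b, hb, hab⟩ := h a ha
        exact (Order.succ_le_of_lt hab).trans_lt hb
      · exact fun h a ha => ⟨_, h a ha, Order.lt_succ a⟩
    refine ⟨ordE_toZFSet d, (ω : Ordinal.{0}).toZFSet, ⟨hlim.2 ⟨omega0_pos, ?_⟩, ?_⟩, ?_⟩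
    · intro a ha
      exact isSuccLimit_omega0.succ_lt ha
    · intro x hx hl
      obtain ⟨a, ha, rfl⟩ := Ordinal.mem_toZFSet_iff.1 hx
      obtain ⟨n, rfl⟩ := lt_omega0.1 ha
      obtain ⟨h0, hs⟩ := hlim.1 hl
      cases n with
      | zero => simp at h0
      | succ n =>
        have := hs n (by exact_mod_cast Nat.lt_succ_self n)
        rw [← Order.succ_eq_add_one] at *
        simp at this
    · left
      refine zmem_ord.2 (lt_of_le_of_lt ?_ S.lt)
      have := aleph0_le_of_sc S.hS.limit.1 S.hS.limit.2
      rwa [← Cardinal.ord_le, Cardinal.ord_aleph0] at this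
  · intro f hf c hc
    by_contra hno
    have hcex : CexE hodMem f c ⟨d.toZFSet, hod_ord d⟩ := by
      refine ⟨hf, hc, ?_⟩
      rintro ⟨α, h1, β, h2, h3, A, h4, B, h5, h6⟩
      exact hno ⟨α, β, h1, h2, h3, A, B, h4, h5, h6⟩
    have h : Dfn0 (k := 3) (fun _ E v => CexE E (v 0) (v 1) (v 2)) := inferInstance
    have hcex' : CexE zmem f.1 c.1 d.toZFSet :=
      (h.abs (E := zmem) hod_trans ![f, c, ⟨d.toZFSet, hod_ord d⟩]).1 hcex
    obtain ⟨N, φ, p, hφ⟩ := od_pair f.2.1 c.2.1 d.toZFSet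
    have hU : Dfn0 (k := 2) (fun _ E v => UE E (v 0) (v 1)) := by unfold UE; infer_instance
    obtain ⟨χ, x, hx, hχ⟩ := od_min (U := fun _ E v => UE E (v 0) (v 1)) Dfn.of0 d.toZFSet N φ p
      (ZFSet.pair f.1 c.1) (ue_iff.2 ⟨_, _, rfl, hcex'⟩) hφ
    obtain ⟨χ', x0, a0, hU0, hx0, hd0, hL1, hL2⟩ := exists_least hU hx hχ
    obtain ⟨f', c', rfl, hc'⟩ := ue_iff.1 hU0
    exact S.no_cex hc' hx0 hd0 hL1 hL2

end

end Paper

namespace Paper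

/-- **Lemma 4.3.** Let `n > 0` be a natural number and let `κ` be a `C⁽ⁿ⁾`-weakly
shrewd cardinal that is not `C⁽ⁿ⁾`-strongly unfoldable.  If `δ` is the least ordinal
`ε ≥ κ` such that the set `{ε}` is definable by a `Σₙ₊₁`-formula with parameters in
`H(κ)`, then:
(1) `δ` is a cardinal greater than `κ` whose cofinality is either less than `κ` or
    equal to `δ`; and
(2) `δ` is a subtle cardinal in `HOD`. -/
theorem least_definable_above_shrewd_is_subtle_in_hod (n : ℕ) (hn : 0 < n)
    (κ : ZFSet.{0}) (h1 : CnWeaklyShrewdE zmem n κ)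
    (h2 : ¬ CnStronglyUnfoldableE zmem n κ) (δ : ZFSet.{0})
    (hδ : OrdE zmem δ ∧ (κ ∈ δ ∨ κ = δ) ∧
      SigmaDefinableSingleton (n + 1) δ (fun x => HMemE zmem x κ) ∧
      ∀ ε : ZFSet.{0}, OrdE zmem ε → (κ ∈ ε ∨ κ = ε) →
        SigmaDefinableSingleton (n + 1) ε (fun x => HMemE zmem x κ) →
        (δ ∈ ε ∨ δ = ε)) :
    (CardE zmem δ ∧ κ ∈ δ ∧
      ((∃ γ, γ ∈ κ ∧ ∃ f, CofinalMapZ f γ δ) ∨ RegularE zmem δ)) ∧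
    IsSubtleInHOD δ := by
  obtain ⟨m, rfl⟩ : ∃ m, n = m + 1 := ⟨n - 1, by omega⟩
  obtain ⟨k, rfl, hk, hS⟩ := shrewd_use hn h1
  obtain ⟨hord, hle, hdef, hmin⟩ := hδ
  obtain ⟨d, rfl⟩ := ordE_iff.1 hord
  have hLe : ∀ a b : Ordinal.{0}, (a.toZFSet ∈ b.toZFSet ∨ a.toZFSet = b.toZFSet) ↔ a ≤ b := by
    intro a b
    rw [toZ_inj, le_iff_lt_or_eq]
    exact or_congr zmem_ord Iff.rfl
  have hlim := hS.limit
  obtain ⟨ψ, q, hψ, hq, hu⟩ := sigma_one_param (H := fun x => HMemE zmem x k.toZFSet)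
    ⟨_, hmem_ord hk hlim.1⟩ (fun x y hx hy => hmem_pair hk (aleph0_le_of_sc hlim.1 hlim.2) hx hy) hdef
  have S : Setup m k d ψ q := ⟨hk, hS, hψ, hq, hu, (hLe _ _).1 hle, fun e he h =>
    (hLe _ _).1 (hmin _ (ordE_toZFSet e) ((hLe _ _).2 he) h)⟩
  exact ⟨⟨cardE_iff.2 S.card, zmem_ord.2 S.lt, S.cof⟩, S.subtle⟩

end Paper
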